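/- arXiv:2003.12882 — 2 statements merged into one kernel-verified Lean document; each statement's English description precedes it below -/
import Mathlib

section
/- Let n ≥ 2 be an integer, p a prime, e ≥ 1 an integer, and set q = p^e. For every ε > 0 there exists M such that for all integers m > M the following holds. Let K be a finite field with q^m elements, let G = SL_n(K), let S, T ⊆ G be subsets (not necessarily normal) with |S| ≥ ε·q^{m(n²−1)} and |T| ≥ ε·q^{m(n²−1)}, and let C be a conjugacy class of G not contained in the center of G. Then 1 − ε < #{(s,t) ∈ S × T : st⁻¹ ∈ C}·|G| / (|S|·|T|·|C|) < 1 + ε. -/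
section UnitaryAverages

open scoped InnerProductSpace

variable {G V : Type*} [Group G] [NormedAddCommGroup V] [InnerProductSpace ℝ V]

/-- The average of the operators `π (f i)` over a finite family of group elements. -/
noncomputable def avgOp {ι : Type*} [Fintype ι] (π : Representation ℝ G V) (f : ι → G) :
    V →ₗ[ℝ] V :=
  (Fintype.card ι : ℝ)⁻¹ • ∑ i, π (f i)

/-- The average of `π` over the conjugates of `g`, applied to a vector. -/
noncomputable def classAvg [Fintype G] (π : Representation ℝ G V) (g : G) (v : V) : V :=
  (Fintype.card G : ℝ)⁻¹ • ∑ x, π (x⁻¹ * g * x) v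

/-- The quadratic form of `B` averaged over the orbit of `v`. -/
noncomputable def orbitForm [Fintype G] (π : Representation ℝ G V) (v : V) (B : V →ₗ[ℝ] V) : ℝ :=
  (Fintype.card G : ℝ)⁻¹ * ∑ x, ⟪B (π x v), π x v⟫_ℝ

/-- The quadratic mean of `‖B u‖` for `u` in the orbit of `v`. -/
noncomputable def orbitNorm [Fintype G] (π : Representation ℝ G V) (v : V) (B : V →ₗ[ℝ] V) : ℝ :=
  √((Fintype.card G : ℝ)⁻¹ * ∑ x, ‖B (π x v)‖ ^ 2)

variable {π : Representation ℝ G V}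

theorem avgOp_apply {ι : Type*} [Fintype ι] (f : ι → G) (u : V) :
    avgOp π f u = (Fintype.card ι : ℝ)⁻¹ • ∑ i, π (f i) u := by
  simp [avgOp]

theorem avgOp_equiv {ι κ : Type*} [Fintype ι] [Fintype κ] (e : ι ≃ κ) (f : κ → G) :
    avgOp π (fun i => f (e i)) = avgOp π f := by
  rw [avgOp, avgOp, Fintype.card_congr e, Equiv.sum_comp e (fun j => π (f j))]

theorem avgOp_const {ι : Type*} [Fintype ι] [Nonempty ι] (g : G) :
    avgOp π (fun _ : ι => g) = π g := by
  ext u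
  rw [avgOp_apply]
  simp [← Nat.cast_smul_eq_nsmul ℝ, smul_smul]

theorem avgOp_mul {ι κ : Type*} [Fintype ι] [Fintype κ] (f : ι → G) (h : κ → G) :
    avgOp π f * avgOp π h = avgOp π (fun p : ι × κ => f p.1 * h p.2) := by
  simp only [avgOp, smul_mul_smul_comm, Finset.sum_mul_sum, Fintype.card_prod, Fintype.sum_prod_type,
    map_mul, Nat.cast_mul, mul_inv]

theorem mul_avgOp {ι : Type*} [Fintype ι] (g : G) (f : ι → G) :
    π g * avgOp π f = avgOp π (fun i => g * f i) := by
  simp only [avgOp, mul_smul_comm, Finset.mul_sum, map_mul]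

theorem avgOp_mul_rep {ι : Type*} [Fintype ι] (g : G) (f : ι → G) :
    avgOp π f * π g = avgOp π (fun i => f i * g) := by
  simp only [avgOp, smul_mul_assoc, Finset.sum_mul, map_mul]

theorem avgOp_prod {ι κ : Type*} [Fintype ι] [Fintype κ] (f : ι → κ → G) :
    avgOp π (fun p : ι × κ => f p.1 p.2) =
      (Fintype.card ι : ℝ)⁻¹ • ∑ i, avgOp π (f i) := by
  simp only [avgOp, Fintype.card_prod, Fintype.sum_prod_type, Nat.cast_mul, mul_inv, mul_smul,
    Finset.smul_sum]

theorem rep_mul_apply (g h : G) (u : V) : π (g * h) u = π g (π h u) := by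
  rw [map_mul]; rfl

section Norms

variable (hπ : ∀ g u, ‖π g u‖ = ‖u‖)
include hπ

theorem inner_rep (g : G) (u w : V) : ⟪π g u, π g w⟫_ℝ = ⟪u, w⟫_ℝ :=
  LinearIsometry.inner_map_map ⟨π g, hπ g⟩ u w

theorem inner_rep_left (g : G) (u w : V) : ⟪π g u, w⟫_ℝ = ⟪u, π g⁻¹ w⟫_ℝ := by
  rw [← inner_rep hπ g⁻¹, ← rep_mul_apply]
  simp

theorem norm_avgOp_le {ι : Type*} [Fintype ι] (f : ι → G) (u : V) : ‖avgOp π f u‖ ≤ ‖u‖ := by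
  rcases isEmpty_or_nonempty ι with h | h
  · simp [avgOp_apply]
  rw [avgOp_apply, norm_smul, norm_inv, RCLike.norm_natCast, inv_mul_le_iff₀ (by positivity)]
  refine (norm_sum_le _ _).trans ?_
  simp [hπ]

theorem inner_avgOp_left {ι : Type*} [Fintype ι] (f : ι → G) (u w : V) :
    ⟪avgOp π f u, w⟫_ℝ = ⟪u, avgOp π (fun i => (f i)⁻¹) w⟫_ℝ := by
  simp only [avgOp_apply, inner_smul_left, inner_smul_right, sum_inner, inner_sum,
    inner_rep_left hπ]
  simp

theorem norm_avgOp_sq {ι : Type*} [Fintype ι] (f : ι → G) (u : V) :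
    ‖avgOp π f u‖ ^ 2 = ⟪avgOp π (fun p : ι × ι => (f p.1)⁻¹ * f p.2) u, u⟫_ℝ := by
  rw [← real_inner_self_eq_norm_sq, inner_avgOp_left hπ, real_inner_comm, ← Module.End.mul_apply,
    avgOp_mul]

end Norms

section Orbit

variable [Fintype G] {v : V}

theorem classAvg_conj (g y : G) : classAvg π (y * g * y⁻¹) v = classAvg π g v := by
  unfold classAvg
  congr 1
  rw [← Equiv.sum_comp (Equiv.mulLeft y)]
  refine Finset.sum_congr rfl fun x _ => ?_
  simp [mul_assoc]

theorem classAvg_eq_of_isConj {g h : G} (H : IsConj g h) : classAvg π g v = classAvg π h v := by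
  obtain ⟨y, rfl⟩ := isConj_iff.1 H
  exact (classAvg_conj g y).symm

theorem orbitForm_sub (B C : V →ₗ[ℝ] V) :
    orbitForm π v (B - C) = orbitForm π v B - orbitForm π v C := by
  simp [orbitForm, inner_sub_left, Finset.sum_sub_distrib, mul_sub]

theorem orbitForm_smul (c : ℝ) (B : V →ₗ[ℝ] V) :
    orbitForm π v (c • B) = c * orbitForm π v B := by
  simp only [orbitForm, LinearMap.smul_apply, inner_smul_left, ← Finset.mul_sum]
  simp only [conj_trivial]
  ring

theorem orbitForm_sum {ι : Type*} (s : Finset ι) (B : ι → V →ₗ[ℝ] V) :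
    orbitForm π v (∑ i ∈ s, B i) = ∑ i ∈ s, orbitForm π v (B i) := by
  simp only [orbitForm, LinearMap.sum_apply, sum_inner]
  rw [Finset.sum_comm, Finset.mul_sum]

theorem orbitNorm_sq (B : V →ₗ[ℝ] V) :
    orbitNorm π v B ^ 2 = (Fintype.card G : ℝ)⁻¹ * ∑ x, ‖B (π x v)‖ ^ 2 :=
  Real.sq_sqrt (by positivity)

theorem orbitNorm_add_le (B C : V →ₗ[ℝ] V) :
    orbitNorm π v (B + C) ≤ orbitNorm π v B + orbitNorm π v C := by
  have key (D : V →ₗ[ℝ] V) : orbitNorm π v D =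
      √(Fintype.card G : ℝ)⁻¹ * ‖(WithLp.toLp 2 fun x : G => D (π x v))‖ := by
    rw [orbitNorm, Real.sqrt_mul (by positivity), PiLp.norm_eq_of_L2]
  rw [key, key, key, ← mul_add]
  gcongr
  exact norm_add_le (WithLp.toLp 2 fun x : G => B (π x v)) (WithLp.toLp 2 fun x : G => C (π x v))

theorem orbitNorm_neg (B : V →ₗ[ℝ] V) : orbitNorm π v (-B) = orbitNorm π v B := by
  simp [orbitNorm]

theorem orbitNorm_zero : orbitNorm π v 0 = 0 := by
  simp [orbitNorm]

theorem orbitNorm_sub_comm (B C : V →ₗ[ℝ] V) :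
    orbitNorm π v (B - C) = orbitNorm π v (C - B) := by
  rw [← orbitNorm_neg, neg_sub]

theorem orbitNorm_sub_le (B C D : V →ₗ[ℝ] V) :
    orbitNorm π v (B - D) ≤ orbitNorm π v (B - C) + orbitNorm π v (C - D) := by
  have := orbitNorm_add_le (π := π) (v := v) (B - C) (C - D)
  rwa [sub_add_sub_cancel] at this

theorem orbitNorm_mul_rep (B : V →ₗ[ℝ] V) (g : G) :
    orbitNorm π v (B * π g) = orbitNorm π v B := by
  unfold orbitNorm
  rw [← Equiv.sum_comp (Equiv.mulLeft g) (fun x => ‖B (π x v)‖ ^ 2)]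
  simp

variable (hπ : ∀ g u, ‖π g u‖ = ‖u‖)
include hπ

theorem orbitForm_conj (B : V →ₗ[ℝ] V) (g : G) :
    orbitForm π v (π g⁻¹ * B * π g) = orbitForm π v B := by
  unfold orbitForm
  rw [← Equiv.sum_comp (Equiv.mulLeft g) (fun x => ⟪B (π x v), π x v⟫_ℝ)]
  simp [inner_rep_left hπ]

theorem orbitForm_rep (g : G) : orbitForm π v (π g) = ⟪classAvg π g v, v⟫_ℝ := by
  simp only [orbitForm, classAvg, inner_smul_left, sum_inner, conj_trivial]
  congr 1
  refine Finset.sum_congr rfl fun x _ => ?_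
  rw [rep_mul_apply, rep_mul_apply, inner_rep_left hπ x⁻¹, inv_inv]

theorem abs_orbitForm_le {B : V →ₗ[ℝ] V} {c : ℝ} (hB : ∀ u, ‖B u‖ ≤ c * ‖u‖) :
    |orbitForm π v B| ≤ c * ‖v‖ ^ 2 := by
  rw [orbitForm, abs_mul, abs_of_nonneg (by positivity), inv_mul_le_iff₀ (by positivity)]
  refine (Finset.abs_sum_le_sum_abs _ _).trans ?_
  calc ∑ x, |⟪B (π x v), π x v⟫_ℝ| ≤ ∑ _x : G, c * ‖v‖ ^ 2 := by
        refine Finset.sum_le_sum fun x _ => ?_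
        refine (abs_real_inner_le_norm _ _).trans ?_
        have := hB (π x v)
        rw [hπ] at this ⊢
        nlinarith [norm_nonneg v]
    _ = _ := by simp

theorem abs_orbitForm_le_orbitNorm (B : V →ₗ[ℝ] V) :
    |orbitForm π v B| ≤ orbitNorm π v B * ‖v‖ := by
  have h1 : |orbitForm π v B| ≤ (Fintype.card G : ℝ)⁻¹ * ∑ x, ‖B (π x v)‖ * ‖v‖ := by
    rw [orbitForm, abs_mul, abs_of_nonneg (by positivity)]
    gcongr
    refine (Finset.abs_sum_le_sum_abs _ _).trans (Finset.sum_le_sum fun x _ => ?_)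
    simpa [hπ] using abs_real_inner_le_norm (B (π x v)) (π x v)
  refine h1.trans ?_
  rw [← Finset.sum_mul, ← mul_assoc]
  gcongr
  refine Real.le_sqrt_of_sq_le ?_
  have := sq_sum_le_card_mul_sum_sq (s := Finset.univ) (f := fun x => ‖B (π x v)‖)
  rw [mul_pow, sq (Fintype.card G : ℝ)⁻¹, mul_assoc]
  gcongr
  rw [inv_mul_le_iff₀ (by positivity)]
  simpa using this

theorem orbitNorm_rep_mul (B : V →ₗ[ℝ] V) (g : G) :
    orbitNorm π v (π g * B) = orbitNorm π v B := by
  simp [orbitNorm, hπ]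

theorem norm_conjAvg_le (B : V →ₗ[ℝ] V) :
    ‖(Fintype.card G : ℝ)⁻¹ • ∑ x, π x⁻¹ (B (π x v))‖ ≤ orbitNorm π v B := by
  refine Real.le_sqrt_of_sq_le ?_
  rw [norm_smul, mul_pow, norm_inv, RCLike.norm_natCast, sq (Fintype.card G : ℝ)⁻¹, mul_assoc]
  gcongr
  rw [inv_mul_le_iff₀ (by positivity)]
  have h1 : ‖∑ x, π x⁻¹ (B (π x v))‖ ≤ ∑ x, ‖B (π x v)‖ := by
    simpa [hπ] using norm_sum_le Finset.univ (fun x => π x⁻¹ (B (π x v)))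
  have := sq_sum_le_card_mul_sum_sq (s := Finset.univ) (f := fun x => ‖B (π x v)‖)
  refine le_trans ?_ (by simpa using this)
  gcongr

theorem orbitNorm_avgOp_sq {ι : Type*} [Fintype ι] (f : ι → G) :
    orbitNorm π v (avgOp π f) ^ 2 =
      orbitForm π v (avgOp π (fun p : ι × ι => (f p.1)⁻¹ * f p.2)) := by
  simp only [orbitNorm_sq, orbitForm, norm_avgOp_sq hπ]

/-- The average over a class is dominated by any average over conjugates of its members. -/
theorem norm_classAvg_le {ι : Type*} [Fintype ι] [Nonempty ι] (g : G) (f y : ι → G)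
    (h : ∀ i, f i = y i * g * (y i)⁻¹) :
    ‖classAvg π g v‖ ≤ orbitNorm π v (avgOp π f) := by
  refine le_trans (le_of_eq ?_) (norm_conjAvg_le hπ (avgOp π f))
  congr 1
  have h1 (i : ι) : classAvg π g v = classAvg π (f i) v := by rw [h, classAvg_conj]
  have h2 : classAvg π g v = (Fintype.card ι : ℝ)⁻¹ • ∑ i, classAvg π (f i) v := by
    simp [← h1, ← Nat.cast_smul_eq_nsmul ℝ, smul_smul]
  rw [h2]
  simp only [classAvg, avgOp_apply, map_smul, map_sum, Finset.smul_sum, rep_mul_apply]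
  rw [Finset.sum_comm]
  refine Finset.sum_congr rfl fun x _ => Finset.sum_congr rfl fun i _ => ?_
  rw [smul_comm]

/-- Van der Corput type inequality for class averages. -/
theorem norm_classAvg_sq_le {A : Type*} [AddCommGroup A] [Fintype A] (α : A → G)
    (hα : ∀ s t, α (s + t) = α s * α t) (g : G) :
    ‖classAvg π g v‖ ^ 2 ≤
      (Fintype.card A : ℝ)⁻¹ * ∑ t, ⟪classAvg π (g⁻¹ * α t * g * (α t)⁻¹) v, v⟫_ℝ := by
  have h1 := norm_classAvg_le (v := v) hπ g (fun t => α t * g * (α t)⁻¹) α (fun _ => rfl)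
  have h2 : ‖classAvg π g v‖ ^ 2 ≤ orbitNorm π v (avgOp π fun t => α t * g * (α t)⁻¹) ^ 2 := by
    gcongr
  refine h2.trans (le_of_eq ?_)
  rw [orbitNorm_avgOp_sq hπ, avgOp_prod (fun s t => (α s * g * (α s)⁻¹)⁻¹ * (α t * g * (α t)⁻¹))]
  rw [orbitForm_smul, orbitForm_sum]
  have h3 (s : A) : orbitForm π v (avgOp π fun t => (α s * g * (α s)⁻¹)⁻¹ * (α t * g * (α t)⁻¹)) =
      (Fintype.card A : ℝ)⁻¹ * ∑ t, ⟪classAvg π (g⁻¹ * α t * g * (α t)⁻¹) v, v⟫_ℝ := by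
    rw [avgOp, orbitForm_smul, orbitForm_sum]
    congr 1
    rw [← Equiv.sum_comp (Equiv.addLeft s)]
    refine Finset.sum_congr rfl fun t _ => ?_
    rw [orbitForm_rep hπ, ← classAvg_conj (g⁻¹ * α t * g * (α t)⁻¹) (α s)]
    congr 2
    simp only [Equiv.coe_addLeft, hα]
    group
  simp only [h3, Finset.sum_const, Finset.card_univ, ← Nat.cast_smul_eq_nsmul ℝ]
  simp

end Orbit

end UnitaryAverages

section OneParameter

open scoped InnerProductSpace

variable {G V : Type*} [Group G] [NormedAddCommGroup V] [InnerProductSpace ℝ V]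
  {π : Representation ℝ G V}

section Hom

variable {A : Type*} [AddCommGroup A] {α : A → G} (hα : ∀ s t, α (s + t) = α s * α t)
include hα

theorem oneParam_zero : α 0 = 1 := by simpa using hα 0 0

theorem oneParam_neg (s : A) : α (-s) = (α s)⁻¹ := by
  rw [eq_comm, inv_eq_iff_mul_eq_one, ← hα, add_neg_cancel, oneParam_zero hα]

variable [Fintype A]

theorem rep_mul_avgOp_oneParam (s : A) : π (α s) * avgOp π α = avgOp π α := by
  rw [mul_avgOp, ← avgOp_equiv (Equiv.addLeft s) α]
  simp [hα]

theorem avgOp_oneParam_mul_rep (s : A) : avgOp π α * π (α s) = avgOp π α := by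
  rw [avgOp_mul_rep, ← avgOp_equiv (Equiv.addRight s) α]
  simp [hα]

theorem avgOp_oneParam_idem : avgOp π α * avgOp π α = avgOp π α := by
  conv_lhs => enter [1]; rw [avgOp]
  rw [smul_mul_assoc, Finset.sum_mul]
  simp only [rep_mul_avgOp_oneParam hα]
  simp [← Nat.cast_smul_eq_nsmul ℝ, smul_smul]

theorem inner_avgOp_oneParam (hπ : ∀ g u, ‖π g u‖ = ‖u‖) (u w : V) :
    ⟪avgOp π α u, w⟫_ℝ = ⟪u, avgOp π α w⟫_ℝ := by
  rw [inner_avgOp_left hπ, ← avgOp_equiv (Equiv.neg A) α]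
  simp [oneParam_neg hα]

theorem norm_avgOp_oneParam_sq (hπ : ∀ g u, ‖π g u‖ = ‖u‖) (u : V) :
    ‖avgOp π α u‖ ^ 2 = ⟪avgOp π α u, u⟫_ℝ := by
  rw [← real_inner_self_eq_norm_sq, ← inner_avgOp_oneParam hα hπ, ← Module.End.mul_apply,
    avgOp_oneParam_idem hα]

variable [Fintype G]

theorem orbitNorm_avgOp_oneParam_sq (hπ : ∀ g u, ‖π g u‖ = ‖u‖) (v : V) :
    orbitNorm π v (avgOp π α) ^ 2 = orbitForm π v (avgOp π α) := by
  simp only [orbitNorm_sq, orbitForm, norm_avgOp_oneParam_sq hα hπ]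

end Hom

theorem orbitNorm_sub_sq [Fintype G] {P M : V →ₗ[ℝ] V} (v : V)
    (hP : ∀ u w, ⟪P u, w⟫_ℝ = ⟪u, P w⟫_ℝ) (hPP : P * P = P)
    (hM : ∀ u w, ⟪M u, w⟫_ℝ = ⟪u, M w⟫_ℝ) (hMM : M * M = M) (hPM : P * M = M) :
    orbitNorm π v (P - M) ^ 2 = orbitForm π v (P - M) := by
  rw [orbitNorm_sq, orbitForm]
  congr 1
  refine Finset.sum_congr rfl fun x _ => ?_
  generalize π x v = u
  have h1 : ⟪P u, P u⟫_ℝ = ⟪P u, u⟫_ℝ := by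
    rw [← hP, ← Module.End.mul_apply, hPP]
  have h2 : ⟪M u, M u⟫_ℝ = ⟪M u, u⟫_ℝ := by
    rw [← hM, ← Module.End.mul_apply, hMM]
  have h3 : ⟪P u, M u⟫_ℝ = ⟪M u, u⟫_ℝ := by
    rw [hP, ← Module.End.mul_apply, hPM, real_inner_comm]
  rw [← real_inner_self_eq_norm_sq, LinearMap.sub_apply, inner_sub_left, inner_sub_left,
    inner_sub_right, inner_sub_right, h1, h2, h3, real_inner_comm (P u), h3]
  ring

variable {F : Type*} [Field F] [Fintype F]

/-- If the conjugates of a one-parameter group `α` sweep out the plane `α × β`, then in orbit norm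
the projection to the `α`-invariants is close to the projection to the invariants of the plane. -/
theorem orbitNorm_sub_plane_sq_le [Fintype G] (hπ : ∀ g u, ‖π g u‖ = ‖u‖) (v : V) {α β x : F → G}
    (hα : ∀ s t, α (s + t) = α s * α t) (hβ : ∀ s t, β (s + t) = β s * β t)
    (hαβ : ∀ s t, α s * β t = β t * α s)
    (hx : ∀ s t, x s * α t * (x s)⁻¹ = α t * β (s * t)) :
    orbitNorm π v (avgOp π α - avgOp π (fun p : F × F => α p.1 * β p.2)) ^ 2 ≤
      2 * (Fintype.card F : ℝ)⁻¹ * ‖v‖ ^ 2 := by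
  set γ : F × F → G := fun p => α p.1 * β p.2 with hγ_def
  have hγ (s t) : γ (s + t) = γ s * γ t := by
    simp only [hγ_def, Prod.fst_add, Prod.snd_add, hα, hβ]
    rw [mul_assoc, ← mul_assoc (α t.1), hαβ t.1 s.2]
    simp only [mul_assoc]
  have hPM : avgOp π α * avgOp π γ = avgOp π γ := by
    conv_lhs => enter [1]; rw [avgOp]
    have h (s : F) : π (α s) * avgOp π γ = avgOp π γ := by
      have := rep_mul_avgOp_oneParam (π := π) hγ (s, 0)
      simpa [hγ_def, oneParam_zero hβ] using this
    rw [smul_mul_assoc, Finset.sum_mul]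
    simp only [h]
    simp [← Nat.cast_smul_eq_nsmul ℝ, smul_smul]
  rw [orbitNorm_sub_sq v (inner_avgOp_oneParam hα hπ) (avgOp_oneParam_idem hα)
    (inner_avgOp_oneParam hγ hπ) (avgOp_oneParam_idem hγ) hPM]
  have hQ : orbitForm π v (avgOp π α) =
      orbitForm π v (avgOp π (fun p : F × F => α p.1 * β (p.2 * p.1))) := by
    have h (s t : F) : orbitForm π v (π (α t * β (s * t))) = orbitForm π v (π (α t)) := by
      rw [← hx, orbitForm_rep hπ, orbitForm_rep hπ, classAvg_conj]
    simp only [avgOp, orbitForm_smul, orbitForm_sum, Fintype.sum_prod_type, h]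
    simp [← Finset.mul_sum]
    field_simp
  rw [orbitForm_sub, hQ, ← orbitForm_sub]
  refine (le_abs_self _).trans (abs_orbitForm_le hπ fun u => ?_)
  have h0 : (avgOp π (fun p : F × F => α p.1 * β (p.2 * p.1)) - avgOp π γ) u =
      ((Fintype.card F : ℝ)⁻¹ * (Fintype.card F : ℝ)⁻¹) • ∑ s, (u - π (β s) u) := by
    rw [LinearMap.sub_apply, avgOp_apply, avgOp_apply, ← smul_sub, ← Finset.sum_sub_distrib,
      Fintype.sum_prod_type, Finset.sum_eq_single 0]
    · simp [hγ_def, oneParam_zero hα, oneParam_zero hβ]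
    · intro t _ ht
      rw [Finset.sum_sub_distrib, sub_eq_zero]
      exact (Equiv.sum_comp (Equiv.mulRight₀ t ht) (fun s => π (α t * β s) u))
    · simp
  rw [h0, norm_smul, mul_comm (2 : ℝ), mul_assoc, norm_mul, norm_inv, RCLike.norm_natCast,
    mul_assoc]
  refine mul_le_mul_of_nonneg_left ?_ (by positivity)
  rw [inv_mul_le_iff₀ (by positivity)]
  refine (norm_sum_le _ _).trans ?_
  calc ∑ s, ‖u - π (β s) u‖ ≤ ∑ _s : F, 2 * ‖u‖ := by
        refine Finset.sum_le_sum fun s _ => (norm_sub_le _ _).trans ?_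
        rw [hπ]; linarith
    _ = _ := by simp

end OneParameter

section Transvections

open Matrix

theorem exists_dotProduct_eq_one {ι K : Type*} [Fintype ι] [DecidableEq ι] [Field K]
    {φ ψ : ι → K} (h : ∀ c : K, φ ≠ c • ψ) : ∃ a, φ ⬝ᵥ a = 1 ∧ ψ ⬝ᵥ a = 0 := by
  by_cases hψ : ψ = 0
  · have h0 : φ ≠ 0 := by simpa using h 0
    obtain ⟨i, hi⟩ := Function.ne_iff.1 h0
    exact ⟨Pi.single i (φ i)⁻¹, by simpa using mul_inv_cancel₀ hi, by simp [hψ]⟩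
  obtain ⟨j, hj⟩ := Function.ne_iff.1 hψ
  obtain ⟨i, hi⟩ := Function.ne_iff.1 (h (φ j / ψ j))
  replace hj : ψ j ≠ 0 := hj
  replace hi : φ i - ψ i / ψ j * φ j ≠ 0 := by
    rw [sub_ne_zero]
    convert hi using 1
    simp; ring
  refine ⟨(φ i - ψ i / ψ j * φ j)⁻¹ • (Pi.single i 1 - (ψ i / ψ j) • Pi.single j 1), ?_, ?_⟩
  · simp only [dotProduct_smul, dotProduct_sub, dotProduct_single_one, smul_eq_mul]
    exact inv_mul_cancel₀ hi
  · simp only [dotProduct_smul, dotProduct_sub, dotProduct_single_one, smul_eq_mul,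
      div_mul_cancel₀ _ hj, sub_self, mul_zero]

/-- Two linear conditions in dimension at least three have a common nonzero solution. -/
theorem exists_ne_zero_dotProduct_eq_zero_and {n : ℕ} (hn : 3 ≤ n) {K : Type*} [Field K]
    (φ ψ : Fin n → K) : ∃ w, w ≠ 0 ∧ φ ⬝ᵥ w = 0 ∧ ψ ⬝ᵥ w = 0 := by
  have h := LinearMap.ker_ne_bot_of_finrank_lt (f := Matrix.mulVecLin (Matrix.of ![φ, ψ]))
    (by simp; omega)
  obtain ⟨w, hw, h0⟩ := Submodule.exists_mem_ne_zero_of_ne_bot h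
  refine ⟨w, h0, ?_⟩
  have hw : Matrix.of ![φ, ψ] *ᵥ w = 0 := by simpa using hw
  exact ⟨congrFun hw 0, congrFun hw 1⟩

variable {ι K : Type*} [Fintype ι] [DecidableEq ι] [Field K]

/-- The transvection `u ↦ u + t (φ ⬝ᵥ u) w`. -/
def rootElt (w φ : ι → K) (h : φ ⬝ᵥ w = 0) (t : K) : SpecialLinearGroup ι K :=
  ⟨1 + vecMulVec (t • w) φ, by
    rw [vecMulVec_eq Unit, det_one_add_replicateCol_mul_replicateRow, dotProduct_smul, h]; simp⟩

theorem coe_rootElt (w φ : ι → K) (h : φ ⬝ᵥ w = 0) (t : K) :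
    (rootElt w φ h t : Matrix ι ι K) = 1 + vecMulVec (t • w) φ := rfl

theorem rootElt_mulVec (w φ : ι → K) (h : φ ⬝ᵥ w = 0) (t : K) (u : ι → K) :
    (rootElt w φ h t : Matrix ι ι K) *ᵥ u = u + (t * (φ ⬝ᵥ u)) • w := by
  rw [coe_rootElt, add_mulVec, one_mulVec, vecMulVec_mulVec]
  ext i
  simp; ring

theorem vecMul_rootElt (w φ : ι → K) (h : φ ⬝ᵥ w = 0) (t : K) (u : ι → K) :
    u ᵥ* (rootElt w φ h t : Matrix ι ι K) = u + (t * (u ⬝ᵥ w)) • φ := by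
  rw [coe_rootElt, vecMul_add, vecMul_one, vecMul_vecMulVec, dotProduct_smul]
  rfl

theorem specialLinearGroup_ext_mulVec {g h : SpecialLinearGroup ι K}
    (H : ∀ u, (g : Matrix ι ι K) *ᵥ u = (h : Matrix ι ι K) *ᵥ u) : g = h :=
  Subtype.ext (Matrix.mulVec_injective (funext H))

theorem rootElt_add (w φ : ι → K) (h : φ ⬝ᵥ w = 0) (s t : K) :
    rootElt w φ h (s + t) = rootElt w φ h s * rootElt w φ h t := by
  refine specialLinearGroup_ext_mulVec fun u => ?_
  simp only [Matrix.SpecialLinearGroup.coe_mul, ← mulVec_mulVec, rootElt_mulVec, dotProduct_add,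
    dotProduct_smul, h]
  module

theorem rootElt_mul_left (w φ ψ : ι → K) (h : φ ⬝ᵥ w = 0) (h' : ψ ⬝ᵥ w = 0) (s t : K) :
    rootElt w φ h t * rootElt w ψ h' (s * t) =
      rootElt w (φ + s • ψ) (by simp [add_dotProduct, h, h']) t := by
  refine specialLinearGroup_ext_mulVec fun u => ?_
  simp only [Matrix.SpecialLinearGroup.coe_mul, ← mulVec_mulVec, rootElt_mulVec, dotProduct_add,
    dotProduct_smul, h, add_dotProduct, smul_dotProduct, smul_eq_mul]
  module

theorem rootElt_mul_right (w x φ : ι → K) (h : φ ⬝ᵥ w = 0) (h' : φ ⬝ᵥ x = 0) (s t : K) :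
    rootElt w φ h t * rootElt x φ h' (s * t) =
      rootElt (w + s • x) φ (by simp [h, h']) t := by
  refine specialLinearGroup_ext_mulVec fun u => ?_
  simp only [Matrix.SpecialLinearGroup.coe_mul, ← mulVec_mulVec, rootElt_mulVec, dotProduct_add,
    dotProduct_smul, h', smul_eq_mul]
  module

theorem rootElt_comm_left (w φ ψ : ι → K) (h : φ ⬝ᵥ w = 0) (h' : ψ ⬝ᵥ w = 0) (s t : K) :
    rootElt w φ h s * rootElt w ψ h' t = rootElt w ψ h' t * rootElt w φ h s := by
  refine specialLinearGroup_ext_mulVec fun u => ?_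
  simp only [Matrix.SpecialLinearGroup.coe_mul, ← mulVec_mulVec, rootElt_mulVec, dotProduct_add,
    dotProduct_smul, h, h', smul_eq_mul]
  module

theorem rootElt_comm_right (w x φ : ι → K) (h : φ ⬝ᵥ w = 0) (h' : φ ⬝ᵥ x = 0) (s t : K) :
    rootElt w φ h s * rootElt x φ h' t = rootElt x φ h' t * rootElt w φ h s := by
  refine specialLinearGroup_ext_mulVec fun u => ?_
  simp only [Matrix.SpecialLinearGroup.coe_mul, ← mulVec_mulVec, rootElt_mulVec, dotProduct_add,
    dotProduct_smul, h, h', smul_eq_mul]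
  module

theorem mul_rootElt {g : SpecialLinearGroup ι K} {w φ w' φ' : ι → K} (h : φ ⬝ᵥ w = 0)
    (h' : φ' ⬝ᵥ w' = 0) (hw : (g : Matrix ι ι K) *ᵥ w = w') (hφ : φ' ᵥ* (g : Matrix ι ι K) = φ)
    (t : K) : g * rootElt w φ h t = rootElt w' φ' h' t * g := by
  refine specialLinearGroup_ext_mulVec fun u => ?_
  simp only [Matrix.SpecialLinearGroup.coe_mul, ← mulVec_mulVec, rootElt_mulVec, mulVec_add,
    mulVec_smul, hw, dotProduct_mulVec, hφ]

theorem rootElt_smul_left (w φ : ι → K) (h : φ ⬝ᵥ w = 0) (c t : K) :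
    rootElt (c • w) φ (by simp [h]) t = rootElt w φ h (c * t) := by
  refine specialLinearGroup_ext_mulVec fun u => ?_
  simp only [rootElt_mulVec]
  module

theorem rootElt_smul_right (w φ : ι → K) (h : φ ⬝ᵥ w = 0) (c t : K) :
    rootElt w (c • φ) (by simp [h]) t = rootElt w φ h (c * t) := by
  refine specialLinearGroup_ext_mulVec fun u => ?_
  simp only [rootElt_mulVec, smul_dotProduct, smul_eq_mul]
  module

end Transvections

section RootComparison

open Matrix

theorem orbitNorm_sub_le_of_sweep {G V F : Type*} [Group G] [NormedAddCommGroup V]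
    [InnerProductSpace ℝ V] {π : Representation ℝ G V} [Field F] [Fintype F] [Fintype G]
    (hπ : ∀ g u, ‖π g u‖ = ‖u‖) (v : V) {α β x y : F → G}
    (hα : ∀ s t, α (s + t) = α s * α t) (hβ : ∀ s t, β (s + t) = β s * β t)
    (hαβ : ∀ s t, α s * β t = β t * α s)
    (hx : ∀ s t, x s * α t * (x s)⁻¹ = α t * β (s * t))
    (hy : ∀ s t, y s * β t * (y s)⁻¹ = β t * α (s * t)) :
    orbitNorm π v (avgOp π α - avgOp π β) ≤ 2 * √(2 * (Fintype.card F : ℝ)⁻¹ * ‖v‖ ^ 2) := by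
  have h1 := Real.le_sqrt_of_sq_le (orbitNorm_sub_plane_sq_le hπ v hα hβ hαβ hx)
  have h2 := Real.le_sqrt_of_sq_le
    (orbitNorm_sub_plane_sq_le hπ v hβ hα (fun s t => (hαβ t s).symm) hy)
  have h3 : avgOp π (fun p : F × F => β p.1 * α p.2) = avgOp π (fun p : F × F => α p.1 * β p.2) := by
    rw [← avgOp_equiv (Equiv.prodComm F F)]
    simp [hαβ]
  rw [h3, orbitNorm_sub_comm] at h2
  linarith [orbitNorm_sub_le (π := π) (v := v) (avgOp π α)
    (avgOp π (fun p : F × F => α p.1 * β p.2)) (avgOp π β)]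

variable {ι K V : Type*} [Fintype ι] [DecidableEq ι] [Field K] [Fintype K] [DecidableEq K]
  [NormedAddCommGroup V] [InnerProductSpace ℝ V]
  {π : Representation ℝ (SpecialLinearGroup ι K) V} (hπ : ∀ g u, ‖π g u‖ = ‖u‖) (v : V)
include hπ

theorem orbitNorm_sub_rootElt_left_le {w φ ψ : ι → K} (h : φ ⬝ᵥ w = 0) (h' : ψ ⬝ᵥ w = 0)
    (hφ : φ ≠ 0) (hψ : ψ ≠ 0) :
    orbitNorm π v (avgOp π (rootElt w φ h) - avgOp π (rootElt w ψ h')) ≤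
      2 * √(2 * (Fintype.card K : ℝ)⁻¹ * ‖v‖ ^ 2) := by
  by_cases hc : ∃ c : K, ψ = c • φ
  · obtain ⟨c, rfl⟩ := hc
    have hc : c ≠ 0 := by rintro rfl; simp at hψ
    have : avgOp π (rootElt w (c • φ) h') = avgOp π (rootElt w φ h) := by
      rw [← avgOp_equiv (Equiv.mulLeft₀ c hc) (rootElt w φ h)]
      refine congrArg (avgOp π) (funext fun t => ?_)
      exact rootElt_smul_right w φ h c t
    rw [this, sub_self, orbitNorm_zero]
    positivity
  have hc' : ∀ c : K, φ ≠ c • ψ := by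
    rintro c rfl
    have hc0 : c ≠ 0 := by rintro rfl; simp at hφ
    exact hc ⟨c⁻¹, by rw [smul_smul, inv_mul_cancel₀ hc0, one_smul]⟩
  have key (φ ψ : ι → K) (h : φ ⬝ᵥ w = 0) (h' : ψ ⬝ᵥ w = 0) (H : ∀ c : K, φ ≠ c • ψ) :
      ∃ x : K → SpecialLinearGroup ι K, ∀ s t,
        x s * rootElt w φ h t * (x s)⁻¹ = rootElt w φ h t * rootElt w ψ h' (s * t) := by
    obtain ⟨a, ha, ha'⟩ := exists_dotProduct_eq_one H
    refine ⟨rootElt (-a) ψ (by simp [ha']), fun s t => ?_⟩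
    rw [mul_inv_eq_iff_eq_mul, rootElt_mul_left]
    refine mul_rootElt _ _ ?_ ?_ t
    · simp [rootElt_mulVec, h']
    · rw [vecMul_rootElt]
      simp [add_dotProduct, ha, ha']
  obtain ⟨x, hx⟩ := key φ ψ h h' hc'
  obtain ⟨y, hy⟩ := key ψ φ h' h (by simpa using hc)
  exact orbitNorm_sub_le_of_sweep hπ v (rootElt_add w φ h) (rootElt_add w ψ h')
    (rootElt_comm_left w φ ψ h h') hx hy

theorem orbitNorm_sub_rootElt_right_le {w x φ : ι → K} (h : φ ⬝ᵥ w = 0) (h' : φ ⬝ᵥ x = 0)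
    (hw : w ≠ 0) (hx : x ≠ 0) :
    orbitNorm π v (avgOp π (rootElt w φ h) - avgOp π (rootElt x φ h')) ≤
      2 * √(2 * (Fintype.card K : ℝ)⁻¹ * ‖v‖ ^ 2) := by
  by_cases hc : ∃ c : K, x = c • w
  · obtain ⟨c, rfl⟩ := hc
    have hc : c ≠ 0 := by rintro rfl; simp at hx
    have : avgOp π (rootElt (c • w) φ h') = avgOp π (rootElt w φ h) := by
      rw [← avgOp_equiv (Equiv.mulLeft₀ c hc) (rootElt w φ h)]
      refine congrArg (avgOp π) (funext fun t => ?_)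
      exact rootElt_smul_left w φ h c t
    rw [this, sub_self, orbitNorm_zero]
    positivity
  have hc' : ∀ c : K, w ≠ c • x := by
    rintro c rfl
    have hc0 : c ≠ 0 := by rintro rfl; simp at hw
    exact hc ⟨c⁻¹, by rw [smul_smul, inv_mul_cancel₀ hc0, one_smul]⟩
  have key (w x : ι → K) (h : φ ⬝ᵥ w = 0) (h' : φ ⬝ᵥ x = 0) (H : ∀ c : K, w ≠ c • x) :
      ∃ z : K → SpecialLinearGroup ι K, ∀ s t,
        z s * rootElt w φ h t * (z s)⁻¹ = rootElt w φ h t * rootElt x φ h' (s * t) := by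
    obtain ⟨b, hb, hb'⟩ := exists_dotProduct_eq_one H
    refine ⟨rootElt x b (by rwa [dotProduct_comm]), fun s t => ?_⟩
    rw [mul_inv_eq_iff_eq_mul, rootElt_mul_right]
    refine mul_rootElt _ _ ?_ ?_ t
    · simp [rootElt_mulVec, dotProduct_comm b w, hb]
    · simp [vecMul_rootElt, h']
  obtain ⟨y, hy⟩ := key w x h h' hc'
  obtain ⟨z, hz⟩ := key x w h' h (by simpa using hc)
  exact orbitNorm_sub_le_of_sweep hπ v (rootElt_add w φ h) (rootElt_add x φ h')
    (rootElt_comm_right w x φ h h') hy hz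

end RootComparison

section Displacement

variable {G V : Type*} [Group G] [Fintype G] [NormedAddCommGroup V] [InnerProductSpace ℝ V]
  {π : Representation ℝ G V} {v : V}

theorem orbitNorm_smul (c : ℝ) (B : V →ₗ[ℝ] V) :
    orbitNorm π v (c • B) = |c| * orbitNorm π v B := by
  rw [orbitNorm, orbitNorm, ← Real.sqrt_sq_eq_abs, ← Real.sqrt_mul (sq_nonneg c)]
  congr 1
  simp only [LinearMap.smul_apply, norm_smul, mul_pow, ← Finset.mul_sum, Real.norm_eq_abs, sq_abs]
  ring

theorem orbitNorm_sum_le {ι : Type*} (s : Finset ι) (B : ι → V →ₗ[ℝ] V) :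
    orbitNorm π v (∑ i ∈ s, B i) ≤ ∑ i ∈ s, orbitNorm π v (B i) := by
  classical
  induction s using Finset.induction_on with
  | empty => simp [orbitNorm_zero]
  | insert i s hi ih =>
    rw [Finset.sum_insert hi, Finset.sum_insert hi]
    exact (orbitNorm_add_le _ _).trans (by gcongr)

/-- If no element of the group moves an average much, and the vector has no invariant part, then
the average is small. -/
theorem orbitNorm_avgOp_le_of_displacement (hv : ∑ g, π g v = 0) {ι : Type*} [Fintype ι]
    [Nonempty ι] (f : ι → G) {c : ℝ}
    (hc : ∀ g, orbitNorm π v (π g * avgOp π f - avgOp π f) ≤ c) :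
    orbitNorm π v (avgOp π f) ≤ c := by
  have h1 (h : G) : ∑ g, π g * π h = ∑ g, π g := by
    rw [← Equiv.sum_comp (Equiv.mulRight h) (fun g => π g)]
    simp
  have h2 (x : G) : (∑ g, π g * avgOp π f) (π x v) = 0 := by
    have h3 : ∑ g, π g * avgOp π f = ∑ g, π g := by
      simp only [avgOp, mul_smul_comm, Finset.mul_sum, ← Finset.smul_sum]
      rw [Finset.sum_comm]
      simp only [h1]
      simp [← Nat.cast_smul_eq_nsmul ℝ, smul_smul]
    rw [h3, ← Module.End.mul_apply, Finset.sum_mul, h1]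
    simpa using hv
  have h4 : orbitNorm π v (avgOp π f) =
      (Fintype.card G : ℝ)⁻¹ * orbitNorm π v (∑ g, (π g * avgOp π f - avgOp π f)) := by
    rw [← abs_of_nonneg (a := (Fintype.card G : ℝ)⁻¹) (by positivity), ← orbitNorm_smul,
      ← orbitNorm_neg]
    unfold orbitNorm
    congr 2
    refine Finset.sum_congr rfl fun x _ => ?_
    rw [Finset.sum_sub_distrib, LinearMap.smul_apply, LinearMap.sub_apply, h2]
    simp [← Nat.cast_smul_eq_nsmul ℝ, smul_smul]
  rw [h4, inv_mul_le_iff₀ (by positivity)]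
  refine (orbitNorm_sum_le _ _).trans ((Finset.sum_le_sum fun g _ => hc g).trans ?_)
  simp

theorem displacement_mul_le (hπ : ∀ g u, ‖π g u‖ = ‖u‖) (B : V →ₗ[ℝ] V) (g h : G) :
    orbitNorm π v (π (g * h) * B - B) ≤
      orbitNorm π v (π g * B - B) + orbitNorm π v (π h * B - B) := by
  have h1 : π (g * h) * B - B = π g * (π h * B - B) + (π g * B - B) := by
    rw [map_mul]; noncomm_ring
  rw [h1]
  refine (orbitNorm_add_le _ _).trans ?_
  rw [orbitNorm_rep_mul hπ, add_comm]

end Displacement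

section BoundedGeneration

open Matrix

variable {n : ℕ} {K : Type*} [Field K]

theorem mulVec_inv_of_mulVec {g : SpecialLinearGroup (Fin n) K} {u w : Fin n → K}
    (h : (g : Matrix (Fin n) (Fin n) K) *ᵥ u = w) :
    ((g⁻¹ : SpecialLinearGroup (Fin n) K) : Matrix (Fin n) (Fin n) K) *ᵥ w = u := by
  rw [← h, mulVec_mulVec, ← Matrix.SpecialLinearGroup.coe_mul]
  simp

variable {d : SpecialLinearGroup (Fin n) K → ℝ} {δ : ℝ}
  (hmul : ∀ g h, d (g * h) ≤ d g + d h)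
  (hroot : ∀ w φ h t, d (rootElt w φ h t) ≤ δ)
include hmul hroot

theorem nonneg_of_rootElt_le : 0 ≤ δ := by
  have h1 : rootElt (0 : Fin n → K) 0 (by simp) 0 = 1 := oneParam_zero (rootElt_add _ _ _)
  have h2 := hroot 0 0 (by simp) 0
  have h3 := hmul 1 1
  rw [mul_one] at h3
  rw [h1] at h2
  linarith

theorem exists_mulVec_eq_single {k j : Fin n} (hkj : k < j) {x : Fin n → K} (hx : x j ≠ 0) :
    ∃ t : SpecialLinearGroup (Fin n) K, d t⁻¹ ≤ 2 * δ ∧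
      (∀ i < k, (t : Matrix _ _ K) *ᵥ Pi.single i 1 = Pi.single i 1) ∧
      (t : Matrix _ _ K) *ᵥ x = Pi.single k 1 := by
  set y : Fin n → K := Pi.single k 1 + Pi.single j (x j) with hy
  have h1 : Pi.single j (x j)⁻¹ ⬝ᵥ (y - x) = 0 := by simp [hy, hkj.ne']
  have h2 : Pi.single k 1 ⬝ᵥ Pi.single j (-x j) = 0 := by simp [hkj.ne]
  refine ⟨rootElt _ _ h2 1 * rootElt _ _ h1 1, ?_, ?_, ?_⟩
  · have hinv {w φ : Fin n → K} (h) : (rootElt w φ h 1)⁻¹ = rootElt w φ h (-1) :=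
      (oneParam_neg (rootElt_add w φ h) 1).symm
    rw [_root_.mul_inv_rev, hinv, hinv]
    linarith [hmul (rootElt _ _ h1 (-1)) (rootElt _ _ h2 (-1)), hroot _ _ h1 (-1),
      hroot _ _ h2 (-1)]
  · intro i hi
    simp only [Matrix.SpecialLinearGroup.coe_mul, ← mulVec_mulVec, rootElt_mulVec]
    simp [hi.ne', (hi.trans hkj).ne']
  · have : Pi.single j (x j)⁻¹ ⬝ᵥ x = 1 := by simp [hx]
    simp only [Matrix.SpecialLinearGroup.coe_mul, ← mulVec_mulVec, rootElt_mulVec, this]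
    rw [mul_one, one_smul, add_sub_cancel, hy]
    simp [hkj.ne, add_assoc, ← Pi.single_add]

theorem exists_mulVec_eq_single' {k j : Fin n} (hkj : k < j) {x : Fin n → K} (hx : x k ≠ 0) :
    ∃ t : SpecialLinearGroup (Fin n) K, d t⁻¹ ≤ 3 * δ ∧
      (∀ i < k, (t : Matrix _ _ K) *ᵥ Pi.single i 1 = Pi.single i 1) ∧
      (t : Matrix _ _ K) *ᵥ x = Pi.single k 1 := by
  have hδ := nonneg_of_rootElt_le hmul hroot
  by_cases hj : x j = 0
  · have h1 : Pi.single k (x k)⁻¹ ⬝ᵥ Pi.single j 1 = 0 := by simp [hkj.ne]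
    have h2 : (rootElt _ _ h1 1 : Matrix _ _ K) *ᵥ x = x + Pi.single j 1 := by
      simp [rootElt_mulVec, hx]
    obtain ⟨t, ht1, ht2, ht3⟩ := exists_mulVec_eq_single hmul hroot hkj
      (x := x + Pi.single j 1) (by simp [hj])
    refine ⟨t * rootElt _ _ h1 1, ?_, ?_, ?_⟩
    · rw [_root_.mul_inv_rev, ← oneParam_neg (rootElt_add _ _ h1)]
      linarith [hmul (rootElt _ _ h1 (-1)) t⁻¹, hroot _ _ h1 (-1)]
    · intro i hi
      rw [Matrix.SpecialLinearGroup.coe_mul, ← mulVec_mulVec, rootElt_mulVec]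
      simp [hi.ne', ht2 i hi]
    · rw [Matrix.SpecialLinearGroup.coe_mul, ← mulVec_mulVec, h2, ht3]
  · obtain ⟨t, ht1, ht⟩ := exists_mulVec_eq_single hmul hroot hkj hj
    exact ⟨t, by linarith, ht⟩

theorem exists_mulVec_col_eq_single {k : Fin n} (g : SpecialLinearGroup (Fin n) K)
    (hg : ∀ i < k, (g : Matrix _ _ K) *ᵥ Pi.single i 1 = Pi.single i 1) :
    ∃ t : SpecialLinearGroup (Fin n) K, d t⁻¹ ≤ 3 * δ ∧
      (∀ i < k, (t : Matrix _ _ K) *ᵥ Pi.single i 1 = Pi.single i 1) ∧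
      (t : Matrix _ _ K) *ᵥ ((g : Matrix (Fin n) (Fin n) K) *ᵥ Pi.single k 1) = Pi.single k 1 := by
  have hδ := nonneg_of_rootElt_le hmul hroot
  set x := (g : Matrix (Fin n) (Fin n) K) *ᵥ Pi.single k 1 with hx
  by_cases hj : ∃ j, k < j
  · obtain ⟨j, hkj⟩ := hj
    by_cases hk : x k = 0
    · by_cases hl : ∃ l, k < l ∧ x l ≠ 0
      · obtain ⟨l, hkl, hl⟩ := hl
        obtain ⟨t, ht1, ht⟩ := exists_mulVec_eq_single hmul hroot hkl hl
        exact ⟨t, by linarith, ht⟩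
      · push Not at hl
        exfalso
        have h1 : x = ∑ i, x i • Pi.single i (1 : K) := by
          simp [← Pi.single_smul, Finset.univ_sum_single]
        have h2 : (g : Matrix _ _ K) *ᵥ x = x := by
          conv_lhs => rw [h1]
          conv_rhs => rw [h1]
          rw [mulVec_sum]
          refine Finset.sum_congr rfl fun i _ => ?_
          rw [mulVec_smul]
          rcases lt_trichotomy i k with h | rfl | h
          · rw [hg i h]
          · simp [hk]
          · simp [hl i h]
        have h3 : x = Pi.single k 1 := by
          rw [← mulVec_inv_of_mulVec h2, mulVec_inv_of_mulVec hx.symm]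
        simp [h3] at hk
    · exact exists_mulVec_eq_single' hmul hroot hkj hk
  · push Not at hj
    have hxk : x k = 1 := by
      have h1 : (g : Matrix (Fin n) (Fin n) K).BlockTriangular id := by
        intro i j hij
        have := congrFun (hg j (lt_of_lt_of_le hij (hj i))) i
        simpa [show i ≠ j from fun h => hij.ne h.symm] using this
      have h2 := g.2
      rw [det_of_isUpperTriangular h1, Finset.prod_eq_single k] at h2
      · simpa [hx] using h2
      · intro i _ hik
        simpa using congrFun (hg i (lt_of_le_of_ne (hj i) hik)) i
      · simp
    have h1 : Pi.single k 1 ⬝ᵥ (Pi.single k 1 - x) = 0 := by simp [hxk]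
    refine ⟨rootElt _ _ h1 1, ?_, ?_, ?_⟩
    · rw [← oneParam_neg (rootElt_add _ _ h1)]
      linarith [hroot _ _ h1 (-1)]
    · intro i hi
      rw [rootElt_mulVec]
      simp [hi.ne']
    · rw [rootElt_mulVec]
      simp [hxk]

/-- Every element of `SL_n` is a product of boundedly many transvections, in the form of a bound for
subadditive functions. -/
theorem le_of_rootElt_le (hone : d 1 = 0) (g : SpecialLinearGroup (Fin n) K) :
    d g ≤ 3 * n * δ := by
  have key (j : ℕ) : ∀ k, k + j = n → ∀ g : SpecialLinearGroup (Fin n) K,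
      (∀ i : Fin n, i.val < k → (g : Matrix _ _ K) *ᵥ Pi.single i 1 = Pi.single i 1) →
      d g ≤ 3 * j * δ := by
    induction j with
    | zero =>
      intro k hk g hg
      have : g = 1 := by
        apply Subtype.ext
        refine Matrix.ext_of_mulVec_single fun i => ?_
        rw [hg i (by omega)]
        exact (one_mulVec _).symm
      simp [this, hone]
    | succ j ih =>
      intro k hk g hg
      obtain ⟨t, ht1, ht2, ht3⟩ := exists_mulVec_col_eq_single hmul hroot (k := ⟨k, by omega⟩) g
        (fun i hi => hg i hi)
      have h1 := ih (k + 1) (by omega) (t * g) fun i hi => by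
        rw [Matrix.SpecialLinearGroup.coe_mul, ← mulVec_mulVec]
        rcases Nat.lt_succ_iff_lt_or_eq.1 hi with h | h
        · rw [hg i h, ht2 i h]
        · rwa [show i = ⟨k, by omega⟩ from Fin.ext h]
      have h2 := hmul t⁻¹ (t * g)
      rw [inv_mul_cancel_left] at h2
      push_cast
      linarith
  exact key n 0 (zero_add n) g (by simp)

end BoundedGeneration

section HigherRank

open Matrix
open scoped InnerProductSpace

theorem exists_not_commute_single {ι K : Type*} [Fintype ι] [DecidableEq ι] [Field K]
    {g : SpecialLinearGroup ι K} (hg : g ∉ Subgroup.center (SpecialLinearGroup ι K)) :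
    ∃ i j, i ≠ j ∧ ¬ Commute (single i j (1 : K)) (g : Matrix ι ι K) := by
  contrapose! hg
  obtain ⟨r, hr⟩ := mem_range_scalar_of_commute_single (M := (g : Matrix ι ι K))
    fun i j hij => hg i j hij
  refine Subgroup.mem_center_iff.2 fun h => Subtype.ext ?_
  rw [Matrix.SpecialLinearGroup.coe_mul, Matrix.SpecialLinearGroup.coe_mul, ← hr]
  exact ((scalar_commute r (fun _ => Commute.all _ _) _).symm).eq

variable {n : ℕ} {K V : Type*} [Field K] [Fintype K] [DecidableEq K]
  [NormedAddCommGroup V] [InnerProductSpace ℝ V]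
  {π : Representation ℝ (SpecialLinearGroup (Fin n) K) V} (hπ : ∀ g u, ‖π g u‖ = ‖u‖)
  (hn : 3 ≤ n) {v : V}
include hπ hn

theorem orbitNorm_sub_rootElt_le {w φ x ψ : Fin n → K} (h : φ ⬝ᵥ w = 0) (h' : ψ ⬝ᵥ x = 0)
    (hw : w ≠ 0) (hφ : φ ≠ 0) (hx : x ≠ 0) (hψ : ψ ≠ 0) :
    orbitNorm π v (avgOp π (rootElt w φ h) - avgOp π (rootElt x ψ h')) ≤
      6 * √(2 * (Fintype.card K : ℝ)⁻¹ * ‖v‖ ^ 2) := by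
  obtain ⟨χ, hχ, h1, h2⟩ := exists_ne_zero_dotProduct_eq_zero_and hn w x
  rw [dotProduct_comm] at h1 h2
  have e1 := orbitNorm_sub_rootElt_left_le hπ v h h1 hφ hχ
  have e2 := orbitNorm_sub_rootElt_right_le hπ v h1 h2 hw hx
  have e3 := orbitNorm_sub_rootElt_left_le hπ v h2 h' hχ hψ
  have e4 := orbitNorm_sub_le (π := π) (v := v) (avgOp π (rootElt w φ h))
    (avgOp π (rootElt w χ h1)) (avgOp π (rootElt x ψ h'))
  have e5 := orbitNorm_sub_le (π := π) (v := v) (avgOp π (rootElt w χ h1))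
    (avgOp π (rootElt x χ h2)) (avgOp π (rootElt x ψ h'))
  linarith

theorem orbitNorm_rootElt_le (hv : ∑ g, π g v = 0) {w φ : Fin n → K} (h : φ ⬝ᵥ w = 0)
    (hw : w ≠ 0) (hφ : φ ≠ 0) :
    orbitNorm π v (avgOp π (rootElt w φ h)) ≤
      36 * n * √(2 * (Fintype.card K : ℝ)⁻¹ * ‖v‖ ^ 2) := by
  set η := √(2 * (Fintype.card K : ℝ)⁻¹ * ‖v‖ ^ 2) with hη
  have hη0 : 0 ≤ η := Real.sqrt_nonneg _
  refine orbitNorm_avgOp_le_of_displacement hv _ fun g => ?_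
  set P := avgOp π (rootElt w φ h)
  have h1 : orbitNorm π v (π 1 * P - P) = 0 := by rw [map_one, one_mul, sub_self, orbitNorm_zero]
  refine (le_of_rootElt_le (d := fun g => orbitNorm π v (π g * P - P)) (δ := 12 * η)
    (displacement_mul_le hπ P) ?_ h1 g).trans (le_of_eq (by ring))
  intro x ψ h' t
  by_cases h0 : x = 0 ∨ ψ = 0
  · have : rootElt x ψ h' t = 1 := by
      refine specialLinearGroup_ext_mulVec fun u => ?_
      rw [rootElt_mulVec]
      rcases h0 with rfl | rfl <;> simp
    simp only [this, h1]
    positivity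
  push Not at h0
  set Q := avgOp π (rootElt x ψ h')
  have h2 : π (rootElt x ψ h' t) * P - P = π (rootElt x ψ h' t) * (P - Q) + (Q - P) := by
    rw [mul_sub, rep_mul_avgOp_oneParam (rootElt_add x ψ h') t]
    abel
  have h3 := orbitNorm_sub_rootElt_le (v := v) hπ hn h h' hw hφ h0.1 h0.2
  simp only [h2]
  refine (orbitNorm_add_le _ _).trans ?_
  rw [orbitNorm_rep_mul hπ, orbitNorm_sub_comm Q P]
  linarith

theorem norm_classAvg_le_of_vecMul_ne (hv : ∑ g, π g v = 0)
    {x : SpecialLinearGroup (Fin n) K} {w ψ : Fin n → K} (hw : w ≠ 0)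
    (hxw : (x : Matrix (Fin n) (Fin n) K) *ᵥ w = w) (h : ψ ⬝ᵥ w = 0)
    (hψ : ψ ᵥ* (x : Matrix (Fin n) (Fin n) K) ≠ ψ) :
    ‖classAvg π x v‖ ≤ 36 * n * √(2 * (Fintype.card K : ℝ)⁻¹ * ‖v‖ ^ 2) := by
  set χ := ψ ᵥ* (x : Matrix (Fin n) (Fin n) K) with hχ
  have h1 : χ ⬝ᵥ w = 0 := by rw [hχ, ← dotProduct_mulVec, hxw, h]
  have h2 : (χ - ψ) ⬝ᵥ w = 0 := by rw [sub_dotProduct, h1, h, sub_zero]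
  refine le_trans ?_ (orbitNorm_rootElt_le hπ hn hv h2 hw (sub_ne_zero.2 hψ))
  rw [← orbitNorm_rep_mul hπ (avgOp π (rootElt w (χ - ψ) h2)) x, mul_avgOp]
  refine norm_classAvg_le hπ x _ (rootElt w ψ h) fun t => ?_
  rw [eq_mul_inv_iff_mul_eq, ← mul_rootElt h1 h hxw hχ.symm, mul_assoc]
  congr 1
  refine specialLinearGroup_ext_mulVec fun u => ?_
  simp only [Matrix.SpecialLinearGroup.coe_mul, ← mulVec_mulVec, rootElt_mulVec, dotProduct_add,
    dotProduct_smul, h2, sub_dotProduct, smul_eq_mul]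
  module

theorem norm_classAvg_le_of_fixed (hv : ∑ g, π g v = 0)
    {x : SpecialLinearGroup (Fin n) K} (hx : x ≠ 1) {w : Fin n → K} (hw : w ≠ 0)
    (hxw : (x : Matrix (Fin n) (Fin n) K) *ᵥ w = w) :
    ‖classAvg π x v‖ ≤ 36 * n * √(2 * (Fintype.card K : ℝ)⁻¹ * ‖v‖ ^ 2) := by
  by_cases H : ∃ ψ, ψ ⬝ᵥ w = 0 ∧ ψ ᵥ* (x : Matrix (Fin n) (Fin n) K) ≠ ψ
  · obtain ⟨ψ, h, hψ⟩ := H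
    exact norm_classAvg_le_of_vecMul_ne hπ hn hv hw hxw h hψ
  push Not at H
  obtain ⟨i, hi⟩ : ∃ i, Pi.single i 1 ᵥ* (x : Matrix (Fin n) (Fin n) K) ≠ Pi.single i 1 := by
    by_contra! h
    refine hx (Subtype.ext ?_)
    refine Matrix.ext_of_single_vecMul fun i => ?_
    rw [h i]
    exact (vecMul_one _).symm
  have hwi : w i ≠ 0 := fun h => hi (H _ (by simpa using h))
  obtain ⟨y, hy, h1, h2⟩ := exists_ne_zero_dotProduct_eq_zero_and hn
    (Pi.single i 1 ᵥ* (x : Matrix (Fin n) (Fin n) K)) (Pi.single i (1 : K))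
  refine norm_classAvg_le_of_vecMul_ne hπ hn hv hy ?_ h2 hi
  refine dotProduct_eq _ _ fun ψ => ?_
  have h3 := H (ψ - (ψ ⬝ᵥ w / w i) • Pi.single i 1) (by simp [sub_dotProduct, hwi])
  have h4 := congrArg (fun χ => χ ⬝ᵥ y) h3
  simp only [sub_vecMul, smul_vecMul, sub_dotProduct, smul_dotProduct, h1, h2, smul_zero,
    sub_zero] at h4
  rw [dotProduct_comm, dotProduct_mulVec, h4, dotProduct_comm]

theorem norm_classAvg_sq_le_of_three_le (hv : ∑ g, π g v = 0)
    {g : SpecialLinearGroup (Fin n) K} (hg : g ∉ Subgroup.center (SpecialLinearGroup (Fin n) K)) :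
    ‖classAvg π g v‖ ^ 2 ≤ (Fintype.card K : ℝ)⁻¹ * ‖v‖ ^ 2 +
      36 * n * √(2 * (Fintype.card K : ℝ)⁻¹ * ‖v‖ ^ 2) * ‖v‖ := by
  obtain ⟨i, j, hij, hc⟩ := exists_not_commute_single hg
  set w : Fin n → K := Pi.single i 1
  set ψ : Fin n → K := Pi.single j 1
  have h : ψ ⬝ᵥ w = 0 := by simp [w, ψ, hij]
  set D := 36 * n * √(2 * (Fintype.card K : ℝ)⁻¹ * ‖v‖ ^ 2)
  have hD : 0 ≤ D := by positivity
  refine (norm_classAvg_sq_le hπ (rootElt w ψ h) (rootElt_add w ψ h) g).trans ?_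
  have key (t : K) : ⟪classAvg π (g⁻¹ * rootElt w ψ h t * g * (rootElt w ψ h t)⁻¹) v, v⟫_ℝ ≤
      (if t = 0 then ‖v‖ ^ 2 else 0) + D * ‖v‖ := by
    split_ifs with ht
    · subst ht
      have h1 : (Fintype.card (SpecialLinearGroup (Fin n) K) : ℝ) ≠ 0 := by positivity
      rw [oneParam_zero (rootElt_add w ψ h)]
      simp [classAvg, ← Nat.cast_smul_eq_nsmul ℝ, smul_smul]
      positivity
    · rw [zero_add]
      refine (real_inner_le_norm _ _).trans ?_
      gcongr
      obtain ⟨y, hy, h1, h2⟩ := exists_ne_zero_dotProduct_eq_zero_and hn ψ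
        (ψ ᵥ* (g : Matrix (Fin n) (Fin n) K))
      rw [← dotProduct_mulVec] at h2
      refine norm_classAvg_le_of_fixed hπ hn hv ?_ hy ?_
      · intro h3
        rw [mul_inv_eq_one, mul_assoc, inv_mul_eq_iff_eq_mul] at h3
        refine hc ?_
        have h4 := congrArg Subtype.val h3
        rw [Matrix.SpecialLinearGroup.coe_mul, Matrix.SpecialLinearGroup.coe_mul, coe_rootElt,
          smul_vecMulVec, add_mul, mul_add, one_mul, mul_one, add_right_inj, smul_mul, Matrix.mul_smul]
          at h4
        rw [single_eq_single_vecMulVec_single]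
        exact smul_right_injective _ ht h4
      · rw [← oneParam_neg (rootElt_add w ψ h)]
        simp only [Matrix.SpecialLinearGroup.coe_mul, ← mulVec_mulVec, rootElt_mulVec, h1, h2,
          mul_zero, zero_smul, add_zero]
        exact mulVec_inv_of_mulVec rfl
  refine (mul_le_mul_of_nonneg_left (Finset.sum_le_sum fun t _ => key t)
    (by positivity)).trans (le_of_eq ?_)
  rw [Finset.sum_add_distrib, Finset.sum_ite_eq']
  simp [mul_add]

end HigherRank

section RankOneGroup

open Matrix

variable {K : Type*} [Field K]

/-- The upper unipotent element of `SL₂` with entry `a`. -/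
def upperUni (a : K) : SpecialLinearGroup (Fin 2) K := ⟨!![1, a; 0, 1], by simp⟩

/-- The lower unipotent element of `SL₂` with entry `b`. -/
def lowerUni (b : K) : SpecialLinearGroup (Fin 2) K := ⟨!![1, 0; b, 1], by simp⟩

/-- The antidiagonal element of `SL₂` with lower left entry `b`. -/
def antidiagElt (b : K) (hb : b ≠ 0) : SpecialLinearGroup (Fin 2) K :=
  ⟨!![0, -b⁻¹; b, 0], by simp [hb]⟩

theorem coe_upperUni (a : K) : (upperUni a).1 = !![1, a; 0, 1] := rfl

theorem coe_lowerUni (b : K) : (lowerUni b).1 = !![1, 0; b, 1] := rfl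

theorem coe_antidiagElt (b : K) (hb : b ≠ 0) : (antidiagElt b hb).1 = !![0, -b⁻¹; b, 0] := rfl

theorem upperUni_add (a b : K) : upperUni (a + b) = upperUni a * upperUni b := by
  apply Subtype.ext
  rw [Matrix.SpecialLinearGroup.coe_mul]
  simp [coe_upperUni, add_comm]

theorem lowerUni_add (a b : K) : lowerUni (a + b) = lowerUni a * lowerUni b := by
  apply Subtype.ext
  rw [Matrix.SpecialLinearGroup.coe_mul]
  simp [coe_lowerUni]

theorem antidiagElt_mul_lowerUni (b : K) (hb : b ≠ 0) (a : K) :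
    antidiagElt b hb * lowerUni (-b ^ 2 * a) = upperUni a * antidiagElt b hb := by
  apply Subtype.ext
  rw [Matrix.SpecialLinearGroup.coe_mul, Matrix.SpecialLinearGroup.coe_mul]
  simp [coe_upperUni, coe_lowerUni, coe_antidiagElt]
  field_simp

theorem coe_upper_lower_upper (a b c : K) :
    (upperUni a * lowerUni b * upperUni c : SpecialLinearGroup (Fin 2) K).1 =
      !![1 + a * b, (1 + a * b) * c + a; b, b * c + 1] := by
  rw [Matrix.SpecialLinearGroup.coe_mul, Matrix.SpecialLinearGroup.coe_mul]
  simp [coe_upperUni, coe_lowerUni]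

theorem eq_upper_lower_upper {g : SpecialLinearGroup (Fin 2) K} (h : g.1 1 0 ≠ 0) :
    g = upperUni ((g.1 0 0 - 1) / g.1 1 0) * lowerUni (g.1 1 0) *
      upperUni ((g.1 1 1 - 1) / g.1 1 0) := by
  apply Subtype.ext
  have hd := g.2
  rw [det_fin_two] at hd
  rw [coe_upper_lower_upper]
  ext i j
  fin_cases i <;> fin_cases j
  · simp; field_simp; ring
  · simp; field_simp; linear_combination -hd
  · simp
  · simp; field_simp; ring

theorem lowerUni_eq_mul (b : K) (hb : b ≠ 0) :
    lowerUni b = upperUni b⁻¹ * antidiagElt b hb * upperUni b⁻¹ := by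
  apply Subtype.ext
  rw [Matrix.SpecialLinearGroup.coe_mul, Matrix.SpecialLinearGroup.coe_mul]
  simp [coe_upperUni, coe_lowerUni, coe_antidiagElt, hb]

theorem exists_isConj_lower_left_ne_zero {g : SpecialLinearGroup (Fin 2) K}
    (hg : g ∉ Subgroup.center (SpecialLinearGroup (Fin 2) K)) :
    ∃ h, IsConj g h ∧ h.1 1 0 ≠ 0 := by
  by_cases h1 : g.1 1 0 = 0
  swap
  · exact ⟨g, IsConj.refl g, h1⟩
  by_cases h2 : g.1 0 1 = 0
  swap
  · refine ⟨antidiagElt 1 one_ne_zero * g * (antidiagElt 1 one_ne_zero)⁻¹,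
      isConj_iff.2 ⟨_, rfl⟩, ?_⟩
    rw [Matrix.SpecialLinearGroup.coe_mul, Matrix.SpecialLinearGroup.coe_mul,
      Matrix.SpecialLinearGroup.coe_inv, coe_antidiagElt]
    simpa [Matrix.mul_apply, Fin.sum_univ_two, Matrix.adjugate_fin_two, vecMul, dotProduct] using h2
  refine ⟨lowerUni 1 * g * (lowerUni 1)⁻¹, isConj_iff.2 ⟨_, rfl⟩, ?_⟩
  have h3 : g.1 0 0 ≠ g.1 1 1 := by
    intro h3
    refine hg (Subgroup.mem_center_iff.2 fun h => Subtype.ext ?_)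
    have h4 : g.1 = !![g.1 1 1, 0; 0, g.1 1 1] := by
      ext i j
      fin_cases i <;> fin_cases j <;> simp [h1, h2, h3]
    rw [Matrix.SpecialLinearGroup.coe_mul, Matrix.SpecialLinearGroup.coe_mul, h4]
    ext i j
    fin_cases i <;> fin_cases j <;> simp [Matrix.mul_apply, Fin.sum_univ_two, mul_comm]
  rw [Matrix.SpecialLinearGroup.coe_mul, Matrix.SpecialLinearGroup.coe_mul,
    Matrix.SpecialLinearGroup.coe_inv, coe_lowerUni]
  simpa [Matrix.mul_apply, Fin.sum_univ_two, Matrix.adjugate_fin_two, vecMul, dotProduct, h1, h2,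
    ← sub_eq_add_neg, sub_ne_zero] using h3

theorem exists_norm_form_eq [Fintype K] {T γ : K} (hT : T ^ 2 ≠ 4 ∨ ringChar K = 2) :
    ∃ p s : K, p ^ 2 + p * s * T + s ^ 2 = γ := by
  by_cases h2 : ringChar K = 2
  · obtain ⟨p, hp⟩ := FiniteField.isSquare_of_char_two h2 γ
    exact ⟨p, 0, by rw [hp]; ring⟩
  have h20 : (2 : K) ≠ 0 := Ring.two_ne_zero h2
  have h4 : 1 - T ^ 2 / 4 ≠ 0 := by
    have h40 : (4 : K) ≠ 0 := by
      rw [show (4 : K) = 2 * 2 by norm_num]; exact mul_ne_zero h20 h20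
    intro h
    refine hT.elim (fun h' => h' ?_) h2
    field_simp at h
    linear_combination -h
  obtain ⟨a, b, hab⟩ := FiniteField.exists_root_sum_quadratic
    (f := Polynomial.C 1 * Polynomial.X ^ 2 + Polynomial.C 0 * Polynomial.X + Polynomial.C (-γ))
    (g := Polynomial.C (1 - T ^ 2 / 4) * Polynomial.X ^ 2 + Polynomial.C 0 * Polynomial.X +
      Polynomial.C 0) (Polynomial.degree_quadratic one_ne_zero) (Polynomial.degree_quadratic h4)
    (FiniteField.odd_card_of_char_ne_two h2)
  simp at hab
  refine ⟨a - b * T / 2, b, ?_⟩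
  field_simp
  have h40 : (4 : K) = 2 ^ 2 := by norm_num
  rw [h40] at hab
  field_simp at hab
  linear_combination hab

theorem isConj_lower_mul_upper [Fintype K] {β γ : K} (hγ : γ ≠ 0) (hβ : β ≠ 0)
    (h : β * γ ≠ -4) :
    IsConj (lowerUni β * upperUni γ) (lowerUni (β * γ) * upperUni 1) := by
  obtain ⟨p, s, hps⟩ := exists_norm_form_eq (K := K) (T := β * γ + 2) (γ := γ⁻¹) (by
    by_cases h2 : ringChar K = 2
    · exact Or.inr h2
    · refine Or.inl fun hT => ?_
      have : (β * γ) * (β * γ + 4) = 0 := by linear_combination hT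
      rcases mul_eq_zero.1 this with h' | h'
      · exact mul_ne_zero hβ hγ h'
      · exact h (eq_neg_of_add_eq_zero_left h'))
  obtain ⟨M, hM⟩ : ∃ M : SpecialLinearGroup (Fin 2) K,
      M.1 = !![γ * (p + s), γ * s; s * (β * γ), p + s * (β * γ + 1)] := by
    refine ⟨⟨_, ?_⟩, rfl⟩
    rw [det_fin_two_of]
    linear_combination γ * hps + mul_inv_cancel₀ hγ
  refine IsConj.symm (isConj_iff.2 ⟨M, ?_⟩)
  rw [mul_inv_eq_iff_eq_mul]
  apply Subtype.ext
  simp only [Matrix.SpecialLinearGroup.coe_mul, hM, coe_upperUni, coe_lowerUni]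
  ext i j
  fin_cases i <;> fin_cases j <;> simp <;> ring

theorem isConj_commutator {g : SpecialLinearGroup (Fin 2) K} (h : g.1 1 0 ≠ 0) (t : K) :
    IsConj (g⁻¹ * upperUni t * g * (upperUni t)⁻¹)
      (lowerUni ((g.1 1 0) ^ 2 * -t) * upperUni (-t)) := by
  have h1 := eq_upper_lower_upper h
  have h2 := antidiagElt_mul_lowerUni _ h t
  rw [lowerUni_eq_mul _ h] at h1
  generalize (g.1 0 0 - 1) / g.1 1 0 = r at h1
  generalize (g.1 1 1 - 1) / g.1 1 0 = s at h1
  generalize hc : g.1 1 0 = c at *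
  have h3 : upperUni (-t) = (upperUni t)⁻¹ := oneParam_neg upperUni_add t
  have h4 (x : K) : Commute (upperUni x) (upperUni t) := by
    rw [Commute, SemiconjBy, ← upperUni_add, ← upperUni_add, add_comm]
  have h5 : lowerUni (c ^ 2 * -t) = (antidiagElt c h)⁻¹ * upperUni t * antidiagElt c h := by
    rw [mul_assoc, ← h2, inv_mul_cancel_left]
    ring_nf
  refine isConj_iff.2 ⟨upperUni c⁻¹ * upperUni s, ?_⟩
  rw [h3, h5, h1]
  have h6 : (upperUni r * upperUni c⁻¹)⁻¹ * upperUni t * (upperUni r * upperUni c⁻¹) =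
      upperUni t := by
    rw [mul_assoc, ← ((h4 r).mul_left (h4 c⁻¹)).eq, inv_mul_cancel_left]
  have h7 : (upperUni c⁻¹ * upperUni s) * (upperUni t)⁻¹ * (upperUni c⁻¹ * upperUni s)⁻¹ =
      (upperUni t)⁻¹ := by
    rw [(((h4 c⁻¹).mul_left (h4 s)).inv_right).eq, mul_inv_cancel_right]
  calc _ = (antidiagElt c h)⁻¹ * ((upperUni r * upperUni c⁻¹)⁻¹ * upperUni t *
      (upperUni r * upperUni c⁻¹)) * antidiagElt c h * ((upperUni c⁻¹ * upperUni s) *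
      (upperUni t)⁻¹ * (upperUni c⁻¹ * upperUni s)⁻¹) := by group
    _ = _ := by rw [h6, h7]

end RankOneGroup

section RankOneAverages

open Matrix
open scoped InnerProductSpace

variable {K V : Type*} [Field K] [Fintype K] [DecidableEq K] [NormedAddCommGroup V]
  [InnerProductSpace ℝ V] {π : Representation ℝ (SpecialLinearGroup (Fin 2) K) V}

omit [Field K] [DecidableEq K] in
theorem sum_rep_rep_eq_zero {G : Type*} [Group G] [Fintype G] {π : Representation ℝ G V} {u : V}
    (hu : ∑ g, π g u = 0) (x : G) : ∑ g, π g (π x u) = 0 := by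
  simp only [← rep_mul_apply]
  rw [← hu]
  exact Equiv.sum_comp (Equiv.mulRight x) (fun g => π g u)

theorem card_filter_lower_left_eq_zero_le :
    (Finset.univ.filter fun g : SpecialLinearGroup (Fin 2) K => g.1 1 0 = 0).card ≤
      Fintype.card K * Fintype.card K := by
  rw [← Fintype.card_prod, ← Finset.card_univ]
  refine Finset.card_le_card_of_injOn (fun g => (g.1 0 0, g.1 0 1)) (by simp) ?_
  intro g hg h hh heq
  simp only [Finset.coe_filter, Finset.mem_univ, true_and, Set.mem_ofPred_eq] at hg hh
  obtain ⟨h1, h2⟩ := Prod.ext_iff.1 heq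
  have hdg := g.2
  have hdh := h.2
  rw [det_fin_two, hg] at hdg
  rw [det_fin_two, hh] at hdh
  dsimp only at h1 h2
  have h0 : g.1 0 0 ≠ 0 := by
    rintro h0
    simp [h0] at hdg
  have h3 : g.1 1 1 = h.1 1 1 := by
    refine mul_left_cancel₀ h0 ?_
    rw [← h1] at hdh
    linear_combination hdg - hdh
  apply Subtype.ext
  ext i j
  fin_cases i <;> fin_cases j <;> simp [h1, h2, h3, hg, hh]

variable (hπ : ∀ g u, ‖π g u‖ = ‖u‖)
include hπ

theorem norm_upper_lower_upper_avgOp_le {u : V} (hu : ∑ g, π g u = 0) :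
    ‖(avgOp π upperUni * avgOp π lowerUni * avgOp π upperUni) u‖ ≤
      2 * (Fintype.card K : ℝ)⁻¹ * ‖u‖ := by
  set q : ℝ := (Fintype.card K : ℝ) with hq
  have hq0 : 0 < q := by rw [hq]; positivity
  rw [avgOp_mul, avgOp_mul, avgOp_apply, norm_smul]
  simp only [Fintype.card_prod, norm_inv, Nat.cast_mul, ← hq, norm_mul, Real.norm_of_nonneg hq0.le]
  rw [inv_mul_le_iff₀ (by positivity)]
  set F : (K × K) × K → V := fun p => π (upperUni p.1.1 * lowerUni p.1.2 * upperUni p.2) u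
  have hF (p) : ‖F p‖ = ‖u‖ := hπ _ _
  change ‖∑ p, F p‖ ≤ _
  rw [← Finset.sum_filter_add_sum_filter_not _ (fun p => p.1.2 = 0)]
  have h1 : ∑ p with ¬ p.1.2 = 0, F p = ∑ g : SpecialLinearGroup (Fin 2) K with ¬ g.1 1 0 = 0,
      π g u := by
    refine Finset.sum_nbij' (fun p => upperUni p.1.1 * lowerUni p.1.2 * upperUni p.2)
      (fun g => (((g.1 0 0 - 1) / g.1 1 0, g.1 1 0), (g.1 1 1 - 1) / g.1 1 0)) ?_ ?_ ?_ ?_ ?_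
    · rintro ⟨⟨a, b⟩, c⟩ hb
      rw [Finset.mem_filter, coe_upper_lower_upper]
      simpa using hb
    · simp
    · rintro ⟨⟨a, b⟩, c⟩ hb
      have hb : b ≠ 0 := by simpa using hb
      dsimp only
      rw [coe_upper_lower_upper]
      simp [hb]
    · intro g hg
      exact (eq_upper_lower_upper (by simpa using hg)).symm
    · intro p _
      rfl
  have h2 : ∑ g : SpecialLinearGroup (Fin 2) K with ¬ g.1 1 0 = 0, π g u =
      -∑ g : SpecialLinearGroup (Fin 2) K with g.1 1 0 = 0, π g u := by
    rw [eq_neg_iff_add_eq_zero, add_comm, Finset.sum_filter_add_sum_filter_not, hu]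
  have h3 : ‖∑ g : SpecialLinearGroup (Fin 2) K with g.1 1 0 = 0, π g u‖ ≤ q * q * ‖u‖ := by
    refine (norm_sum_le _ _).trans ?_
    simp only [hπ, Finset.sum_const, nsmul_eq_mul]
    gcongr
    rw [hq]
    exact_mod_cast card_filter_lower_left_eq_zero_le
  have h4 : ‖∑ p with p.1.2 = 0, F p‖ ≤ q * q * ‖u‖ := by
    refine (norm_sum_le _ _).trans ?_
    simp only [hF, Finset.sum_const, nsmul_eq_mul]
    gcongr
    have h5 : (Finset.univ.filter fun p : (K × K) × K => p.1.2 = 0).card ≤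
        (Finset.univ : Finset (K × K)).card := by
      refine Finset.card_le_card_of_injOn (fun p => (p.1.1, p.2)) (by simp) ?_
      rintro ⟨⟨a, b⟩, c⟩ h ⟨⟨a', b'⟩, c'⟩ h'
      simp only [Finset.coe_filter, Finset.mem_univ, true_and, Set.mem_ofPred_eq] at h h'
      simp [h, h']
    rw [Finset.card_univ, Fintype.card_prod] at h5
    rw [hq]
    exact_mod_cast h5
  rw [h1, h2, ← sub_eq_add_neg]
  refine (norm_sub_le _ _).trans ((add_le_add h4 h3).trans (le_of_eq ?_))
  field_simp
  ring

theorem norm_lower_upper_avgOp_sq_le {u : V} (hu : ∑ g, π g u = 0) :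
    ‖(avgOp π lowerUni * avgOp π upperUni) u‖ ^ 2 ≤ 2 * (Fintype.card K : ℝ)⁻¹ * ‖u‖ ^ 2 := by
  rw [Module.End.mul_apply, norm_avgOp_oneParam_sq lowerUni_add hπ, real_inner_comm,
    inner_avgOp_oneParam upperUni_add hπ, real_inner_comm]
  refine (real_inner_le_norm _ _).trans ?_
  rw [sq, ← mul_assoc]
  gcongr
  exact norm_upper_lower_upper_avgOp_le hπ hu

theorem norm_upper_rep_upper_avgOp_le {u : V} (hu : ∑ g, π g u = 0) {b : K} (hb : b ≠ 0) :
    ‖(avgOp π upperUni * π (lowerUni b) * avgOp π upperUni) u‖ ≤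
      √(2 * (Fintype.card K : ℝ)⁻¹) * ‖u‖ := by
  have h1 : avgOp π upperUni * π (antidiagElt b hb) = π (antidiagElt b hb) * avgOp π lowerUni := by
    rw [avgOp_mul_rep, mul_avgOp, ← avgOp_equiv (Equiv.mulLeft₀ (-b ^ 2) (by simpa using hb))
      (fun i => antidiagElt b hb * lowerUni i)]
    exact congrArg (avgOp π) (funext fun a => (antidiagElt_mul_lowerUni b hb a).symm)
  have h2 : avgOp π upperUni * π (lowerUni b) * avgOp π upperUni =
      π (antidiagElt b hb) * (avgOp π lowerUni * avgOp π upperUni) := by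
    rw [lowerUni_eq_mul b hb, map_mul, map_mul, ← mul_assoc, ← mul_assoc,
      avgOp_oneParam_mul_rep upperUni_add, mul_assoc, rep_mul_avgOp_oneParam upperUni_add, h1,
      mul_assoc]
  rw [h2, Module.End.mul_apply, hπ]
  refine le_of_sq_le_sq ?_ (by positivity)
  rw [mul_pow, Real.sq_sqrt (by positivity)]
  exact norm_lower_upper_avgOp_sq_le hπ hu

end RankOneAverages

section RankOneClassAverage

open Matrix
open scoped InnerProductSpace

variable {K V : Type*} [Field K] [Fintype K] [DecidableEq K] [NormedAddCommGroup V]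
  [InnerProductSpace ℝ V] {π : Representation ℝ (SpecialLinearGroup (Fin 2) K) V}
  (hπ : ∀ g u, ‖π g u‖ = ‖u‖)
include hπ

theorem norm_conj_avgOp_sq_le {u : V} (hu : ∑ g, π g u = 0) :
    ‖((Fintype.card K : ℝ)⁻¹ • ∑ b : K, π (lowerUni b) * avgOp π upperUni * π (lowerUni (-b))) u‖ ^ 2
      ≤ ((Fintype.card K : ℝ)⁻¹ + √(2 * (Fintype.card K : ℝ)⁻¹)) * ‖u‖ ^ 2 := by
  set q : ℝ := (Fintype.card K : ℝ) with hq
  have hq0 : 0 < q := by rw [hq]; positivity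
  set θ := √(2 * q⁻¹) with hθ
  have hθ0 : 0 ≤ θ := Real.sqrt_nonneg _
  set w : K → V := fun b => (π (lowerUni b) * avgOp π upperUni * π (lowerUni (-b))) u with hw
  have hdiag (b : K) : ⟪w b, w b⟫_ℝ ≤ ‖u‖ ^ 2 := by
    rw [real_inner_self_eq_norm_sq]
    gcongr
    simp only [hw, Module.End.mul_apply, hπ]
    exact (norm_avgOp_le hπ _ _).trans_eq (hπ _ _)
  have hoff (b c : K) (hbc : c ≠ b) : ⟪w b, w c⟫_ℝ ≤ θ * ‖u‖ ^ 2 := by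
    have h1 : ⟪w b, w c⟫_ℝ = ⟪π (lowerUni (-b)) u,
        (avgOp π upperUni * π (lowerUni (c - b)) * avgOp π upperUni) (π (lowerUni (-c)) u)⟫_ℝ := by
      simp only [hw, Module.End.mul_apply]
      rw [inner_rep_left hπ, inner_avgOp_oneParam upperUni_add hπ, ← rep_mul_apply,
        ← oneParam_neg lowerUni_add, ← lowerUni_add, neg_add_eq_sub]
    rw [h1]
    refine (real_inner_le_norm _ _).trans ?_
    have h2 := norm_upper_rep_upper_avgOp_le hπ (sum_rep_rep_eq_zero hu (lowerUni (-c)))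
      (sub_ne_zero.2 hbc)
    rw [hπ] at h2 ⊢
    calc _ ≤ ‖u‖ * (θ * ‖u‖) := by gcongr
      _ = _ := by ring
  have hsum : (((Fintype.card K : ℝ)⁻¹ • ∑ b : K,
      π (lowerUni b) * avgOp π upperUni * π (lowerUni (-b))) u) = q⁻¹ • ∑ b, w b := by
    simp [hw, hq]
  rw [hsum, norm_smul, mul_pow, norm_inv, Real.norm_of_nonneg hq0.le, ← real_inner_self_eq_norm_sq,
    sum_inner, inv_pow, inv_mul_le_iff₀ (by positivity)]
  have hrow (b : K) : ⟪w b, ∑ c, w c⟫_ℝ ≤ ‖u‖ ^ 2 + q * (θ * ‖u‖ ^ 2) := by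
    rw [inner_sum, ← Finset.add_sum_erase _ _ (Finset.mem_univ b)]
    refine add_le_add (hdiag b) ?_
    calc ∑ c ∈ Finset.univ.erase b, ⟪w b, w c⟫_ℝ
        ≤ ∑ c ∈ Finset.univ.erase b, θ * ‖u‖ ^ 2 :=
          Finset.sum_le_sum fun c hc => hoff b c (Finset.ne_of_mem_erase hc)
      _ ≤ ∑ _c : K, θ * ‖u‖ ^ 2 :=
          Finset.sum_le_sum_of_subset_of_nonneg (Finset.erase_subset _ _)
            fun _ _ _ => by positivity
      _ = _ := by simp [hq]
  refine (Finset.sum_le_sum fun b _ => hrow b).trans (le_of_eq ?_)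
  rw [Finset.sum_const, Finset.card_univ, nsmul_eq_mul, ← hq]
  field_simp

theorem orbitForm_avgOp_upperUni_le {v : V} (hv : ∑ g, π g v = 0) :
    orbitForm π v (avgOp π upperUni) ≤
      √((Fintype.card K : ℝ)⁻¹ + √(2 * (Fintype.card K : ℝ)⁻¹)) * ‖v‖ ^ 2 := by
  set η := (Fintype.card K : ℝ)⁻¹ + √(2 * (Fintype.card K : ℝ)⁻¹) with hη
  have hη0 : 0 ≤ η := by positivity
  set Q := (Fintype.card K : ℝ)⁻¹ •
    ∑ b : K, π (lowerUni b) * avgOp π upperUni * π (lowerUni (-b)) with hQ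
  have h1 : orbitForm π v (avgOp π upperUni) = orbitForm π v Q := by
    have h (b : K) : orbitForm π v (π (lowerUni b) * avgOp π upperUni * π (lowerUni (-b))) =
        orbitForm π v (avgOp π upperUni) := by
      rw [← orbitForm_conj hπ (avgOp π upperUni) (lowerUni (-b)),
        oneParam_neg (α := lowerUni (K := K)) lowerUni_add, inv_inv]
    simp [hQ, orbitForm_smul, orbitForm_sum, h]
  have h2 : orbitNorm π v Q ≤ √η * ‖v‖ := by
    refine le_of_sq_le_sq ?_ (by positivity)
    rw [mul_pow, Real.sq_sqrt hη0, orbitNorm_sq, inv_mul_le_iff₀ (by positivity)]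
    calc ∑ x, ‖Q (π x v)‖ ^ 2
        ≤ ∑ _x : SpecialLinearGroup (Fin 2) K, η * ‖v‖ ^ 2 := by
          refine Finset.sum_le_sum fun x _ => ?_
          have := norm_conj_avgOp_sq_le hπ (sum_rep_rep_eq_zero hv x)
          rwa [hπ x v] at this
      _ = _ := by simp
  rw [h1, sq, ← mul_assoc]
  exact (le_abs_self _).trans ((abs_orbitForm_le_orbitNorm hπ Q).trans (by gcongr))

theorem orbitForm_avgOp_lowerUni {v : V} :
    orbitForm π v (avgOp π lowerUni) = orbitForm π v (avgOp π upperUni) := by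
  rw [← orbitForm_conj hπ (avgOp π lowerUni) (antidiagElt (1 : K) one_ne_zero)⁻¹, inv_inv]
  congr 1
  have h1 : (1 : K) ≠ 0 := one_ne_zero
  rw [mul_avgOp, avgOp_mul_rep, ← avgOp_equiv (Equiv.mulLeft₀ (-1 ^ 2 : K) (by simp))
    (fun i => antidiagElt 1 h1 * lowerUni i * (antidiagElt 1 h1)⁻¹)]
  refine congrArg (avgOp π) (funext fun a => ?_)
  rw [mul_inv_eq_iff_eq_mul]
  exact antidiagElt_mul_lowerUni 1 h1 a

theorem orbitNorm_avgOp_lowerUni_sq_mul_le {κ : K} (hκ : κ ≠ 0) (v : V) :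
    orbitNorm π v (avgOp π fun t : K => lowerUni (κ * t ^ 2)) ^ 2 ≤
      (Fintype.card K : ℝ)⁻¹ * ‖v‖ ^ 2 + orbitForm π v (avgOp π lowerUni) := by
  have hL : 0 ≤ orbitForm π v (avgOp π lowerUni) := by
    rw [← orbitNorm_avgOp_oneParam_sq lowerUni_add hπ]
    positivity
  by_cases h2 : ringChar K = 2
  · have := ringChar.of_eq h2
    have hb : Function.Bijective fun t : K => κ * t ^ 2 := by
      rw [← Finite.injective_iff_bijective]
      intro s t hst
      exact CharTwo.sq_injective (mul_left_cancel₀ hκ hst)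
    have hB : avgOp π (fun t : K => lowerUni (κ * t ^ 2)) = avgOp π lowerUni :=
      avgOp_equiv (Equiv.ofBijective _ hb) lowerUni
    rw [hB, orbitNorm_avgOp_oneParam_sq lowerUni_add hπ]
    have : 0 ≤ (Fintype.card K : ℝ)⁻¹ * ‖v‖ ^ 2 := by positivity
    linarith
  have h20 : (2 : K) ≠ 0 := Ring.two_ne_zero h2
  have hb : Function.Bijective fun p : K × K => (p.2 - p.1, p.2 + p.1) := by
    rw [← Finite.injective_iff_bijective]
    rintro ⟨s, r⟩ ⟨s', r'⟩ h
    obtain ⟨h3, h4⟩ := Prod.ext_iff.1 h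
    dsimp only at h3 h4
    have h5 : r = r' := mul_left_cancel₀ h20 (by linear_combination h3 + h4)
    exact Prod.ext (by linear_combination h4 - h5) h5
  have h3 : avgOp π (fun p : K × K => (lowerUni (κ * p.1 ^ 2))⁻¹ * lowerUni (κ * p.2 ^ 2)) =
      avgOp π fun p : K × K => lowerUni (κ * p.1 * p.2) := by
    rw [← avgOp_equiv (Equiv.ofBijective _ hb) (fun p : K × K => lowerUni (κ * p.1 * p.2))]
    refine congrArg (avgOp π) (funext fun p => ?_)
    rw [← oneParam_neg lowerUni_add, ← lowerUni_add]
    congr 1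
    simp only [Equiv.ofBijective_apply]
    ring
  have h4 (a : K) (ha : a ≠ 0) : orbitForm π v (avgOp π fun b : K => lowerUni (κ * a * b)) =
      orbitForm π v (avgOp π lowerUni) :=
    congrArg _ (avgOp_equiv (Equiv.mulLeft₀ (κ * a) (mul_ne_zero hκ ha)) lowerUni)
  have h5 : orbitForm π v (avgOp π fun b : K => lowerUni (κ * 0 * b)) = ‖v‖ ^ 2 := by
    simp [oneParam_zero (α := lowerUni (K := K)) lowerUni_add, avgOp_const, orbitForm, hπ]
  rw [orbitNorm_avgOp_sq hπ, h3, avgOp_prod (fun a b : K => lowerUni (κ * a * b)), orbitForm_smul,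
    orbitForm_sum, ← Finset.add_sum_erase _ _ (Finset.mem_univ 0), mul_add, h5]
  gcongr
  rw [inv_mul_le_iff₀ (by positivity)]
  calc _ = ∑ a ∈ Finset.univ.erase (0 : K), orbitForm π v (avgOp π lowerUni) :=
        Finset.sum_congr rfl fun a ha => h4 a (Finset.ne_of_mem_erase ha)
    _ ≤ ∑ _a : K, orbitForm π v (avgOp π lowerUni) :=
        Finset.sum_le_sum_of_subset_of_nonneg (Finset.erase_subset _ _) fun _ _ _ => hL
    _ = _ := by simp

/-- Decay of averages over noncentral classes of `SL₂`. -/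
theorem norm_classAvg_sq_le_of_two {v : V} (hv : ∑ g, π g v = 0)
    {g : SpecialLinearGroup (Fin 2) K}
    (hg : g ∉ Subgroup.center (SpecialLinearGroup (Fin 2) K)) :
    ‖classAvg π g v‖ ^ 2 ≤
      (√((Fintype.card K : ℝ)⁻¹ + √((Fintype.card K : ℝ)⁻¹ + √(2 * (Fintype.card K : ℝ)⁻¹))) +
        6 * (Fintype.card K : ℝ)⁻¹) * ‖v‖ ^ 2 := by
  obtain ⟨h, hgh, hc⟩ := exists_isConj_lower_left_ne_zero hg
  rw [classAvg_eq_of_isConj hgh]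
  set c := h.1 1 0 with hc_def
  set δ := (Fintype.card K : ℝ)⁻¹ with hδ
  have hδ0 : 0 ≤ δ := by positivity
  set B := avgOp π fun t : K => lowerUni (c ^ 2 * t ^ 2)
  have hB : orbitNorm π v B ≤ √(δ + √(δ + √(2 * δ))) * ‖v‖ := by
    refine le_of_sq_le_sq ?_ (by positivity)
    rw [mul_pow, Real.sq_sqrt (by positivity), add_mul]
    refine (orbitNorm_avgOp_lowerUni_sq_mul_le hπ (pow_ne_zero 2 hc) v).trans ?_
    gcongr
    rw [orbitForm_avgOp_lowerUni hπ]
    exact orbitForm_avgOp_upperUni_le hπ hv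
  have hform (y) : |⟪classAvg π y v, v⟫_ℝ| ≤ ‖v‖ ^ 2 := by
    rw [← orbitForm_rep hπ, ← one_mul (‖v‖ ^ 2)]
    exact abs_orbitForm_le hπ fun u => by rw [hπ, one_mul]
  set good : K → ℝ := fun t => ⟪classAvg π (lowerUni (c ^ 2 * t ^ 2) * upperUni 1) v, v⟫_ℝ
    with hgood
  set term : K → ℝ := fun t => ⟪classAvg π (h⁻¹ * upperUni t * h * (upperUni t)⁻¹) v, v⟫_ℝ
    with hterm
  have hgoodsum : δ * ∑ t, good t ≤ √(δ + √(δ + √(2 * δ))) * ‖v‖ ^ 2 := by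
    have h1 : δ * ∑ t, good t = orbitForm π v (B * π (upperUni 1)) := by
      rw [avgOp_mul_rep, avgOp, orbitForm_smul, orbitForm_sum]
      simp only [hgood, orbitForm_rep hπ, hδ]
    rw [h1, sq, ← mul_assoc]
    refine (le_abs_self _).trans ((abs_orbitForm_le_orbitNorm hπ _).trans ?_)
    rw [orbitNorm_mul_rep]
    gcongr
  have heq (t : K) (ht : t ≠ 0) (ht' : c ^ 2 * t ^ 2 ≠ -4) : term t = good t := by
    simp only [hgood, hterm]
    rw [classAvg_eq_of_isConj (isConj_commutator hc t), classAvg_eq_of_isConj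
      (isConj_lower_mul_upper (neg_ne_zero.2 ht)
        (mul_ne_zero (pow_ne_zero 2 hc) (neg_ne_zero.2 ht)) ?_)]
    · congr 4
      ring
    · convert ht' using 1
      ring
  have hbad : ∑ t, (term t - good t) ≤ 6 * ‖v‖ ^ 2 := by
    obtain ⟨t₀, ht₀⟩ : ∃ t₀ : K, ∀ t, c ^ 2 * t ^ 2 = -4 → t = t₀ ∨ t = -t₀ := by
      by_cases h : ∃ t₀ : K, c ^ 2 * t₀ ^ 2 = -4
      · obtain ⟨t₀, h⟩ := h
        refine ⟨t₀, fun t ht => sq_eq_sq_iff_eq_or_eq_neg.1 ?_⟩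
        exact mul_left_cancel₀ (pow_ne_zero 2 hc) (ht.trans h.symm)
      · exact ⟨0, fun t ht => (h ⟨t, ht⟩).elim⟩
    have h3 : ∑ t, (term t - good t) = ∑ t ∈ ({0, t₀, -t₀} : Finset K), (term t - good t) := by
      refine (Finset.sum_subset (Finset.subset_univ _) fun t _ ht => ?_).symm
      simp only [Finset.mem_insert, Finset.mem_singleton, not_or] at ht
      rw [heq t ht.1 fun h' => (ht₀ t h').elim ht.2.1 ht.2.2, sub_self]
    rw [h3]
    have h4 : (({0, t₀, -t₀} : Finset K).card : ℝ) ≤ 3 := by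
      exact_mod_cast Finset.card_le_three
    calc _ ≤ ∑ t ∈ ({0, t₀, -t₀} : Finset K), 2 * ‖v‖ ^ 2 := by
          refine Finset.sum_le_sum fun t _ => ?_
          have h5 := le_of_abs_le (hform (h⁻¹ * upperUni t * h * (upperUni t)⁻¹))
          have h6 := neg_le_of_abs_le (hform (lowerUni (c ^ 2 * t ^ 2) * upperUni 1))
          simp only [hterm, hgood]
          linarith
      _ = ({0, t₀, -t₀} : Finset K).card * (2 * ‖v‖ ^ 2) := by simp
      _ ≤ 3 * (2 * ‖v‖ ^ 2) := by gcongr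
      _ = _ := by ring
  refine (norm_classAvg_sq_le hπ upperUni upperUni_add h).trans ?_
  have h7 := mul_le_mul_of_nonneg_left hbad hδ0
  rw [Finset.sum_sub_distrib, mul_sub] at h7
  change δ * ∑ t, term t ≤ _
  linarith

end RankOneClassAverage

section ClassMixing

open scoped InnerProductSpace

variable {G : Type*} [Group G] [Fintype G]

theorem sum_indicator_eq_card {α : Type*} [Fintype α] (S : Set α) :
    ∑ x, S.indicator (1 : α → ℝ) x = Nat.card S := by
  classical
  simp [Set.indicator, Fintype.card_subtype]

theorem sum_isConj_smul {V : Type*} [NormedAddCommGroup V] [InnerProductSpace ℝ V]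
    (π : Representation ℝ G V) (c : G) (v : V) :
    ∑ g, Set.indicator {x | IsConj c x} (1 : G → ℝ) g • π g v =
      (Nat.card {x | IsConj c x} : ℝ) • classAvg π c v := by
  classical
  obtain ⟨C, hCdef⟩ : ∃ C : Set G, C = {x | IsConj c x} := ⟨_, rfl⟩
  have hmem (g : G) : g ∈ C ↔ IsConj c g := by rw [hCdef]; rfl
  rw [← hCdef]
  have hC (x g : G) : C.indicator (1 : G → ℝ) (x * g * x⁻¹) = C.indicator 1 g := by
    have : IsConj c (x * g * x⁻¹) ↔ IsConj c g :=
      ⟨fun h => h.trans (isConj_iff.2 ⟨x, rfl⟩).symm, fun h => h.trans (isConj_iff.2 ⟨x, rfl⟩)⟩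
    simp only [Set.indicator, hmem, this, Pi.one_apply]
  have h1 (x : G) : ∑ g, C.indicator (1 : G → ℝ) g • π g v =
      ∑ g, C.indicator (1 : G → ℝ) g • π (x⁻¹ * g * x) v := by
    rw [← Equiv.sum_comp (MulAut.conj x).symm.toEquiv]
    refine Finset.sum_congr rfl fun g _ => ?_
    have := hC x⁻¹ g
    simp_all
  have h2 : ∑ g, C.indicator (1 : G → ℝ) g • π g v =
      ∑ g, C.indicator (1 : G → ℝ) g • classAvg π g v := by
    simp only [classAvg, Finset.smul_sum]
    rw [Finset.sum_comm]
    simp only [smul_comm _ (Fintype.card G : ℝ)⁻¹, ← Finset.smul_sum, ← h1]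
    simp [← Nat.cast_smul_eq_nsmul ℝ, smul_smul]
  have h3 (g : G) : C.indicator (1 : G → ℝ) g • classAvg π g v =
      C.indicator (1 : G → ℝ) g • classAvg π c v := by
    by_cases h : g ∈ C
    · rw [classAvg_eq_of_isConj ((hmem g).1 h)]
    · simp [h]
  rw [h2]
  simp only [h3, ← Finset.sum_smul, sum_indicator_eq_card]

variable (G) in
/-- The left regular representation on `ℓ²(G)`. -/
noncomputable def regularRep : Representation ℝ G (EuclideanSpace ℝ G) where
  toFun g := (LinearIsometryEquiv.piLpCongrLeft 2 ℝ ℝ (Equiv.mulLeft g)).toLinearEquiv.toLinearMap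
  map_one' := by
    ext f x
    exact congrArg f (show (1 : G)⁻¹ * x = x by simp)
  map_mul' g h := by
    ext f x
    exact congrArg f (show (g * h)⁻¹ * x = h⁻¹ * (g⁻¹ * x) by simp [mul_assoc])

theorem regularRep_apply (g : G) (f : EuclideanSpace ℝ G) (x : G) :
    regularRep G g f x = f (g⁻¹ * x) := rfl

theorem norm_regularRep (g : G) (f : EuclideanSpace ℝ G) : ‖regularRep G g f‖ = ‖f‖ :=
  (LinearIsometryEquiv.piLpCongrLeft 2 ℝ ℝ (Equiv.mulLeft g)).norm_map f

theorem card_pairs_eq_sum (S T C : Set G) :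
    (Nat.card {pr : G × G // pr.1 ∈ S ∧ pr.2 ∈ T ∧ pr.1 * pr.2⁻¹ ∈ C} : ℝ) =
      ⟪∑ g, C.indicator (1 : G → ℝ) g • regularRep G g (WithLp.toLp 2 (T.indicator 1)),
        WithLp.toLp 2 (S.indicator 1)⟫_ℝ := by
  classical
  have h1 : (Nat.card {pr : G × G // pr.1 ∈ S ∧ pr.2 ∈ T ∧ pr.1 * pr.2⁻¹ ∈ C} : ℝ) =
      ∑ x, ∑ t, S.indicator (1 : G → ℝ) x * (T.indicator (1 : G → ℝ) t *
        C.indicator (1 : G → ℝ) (x * t⁻¹)) := by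
    rw [Nat.card_eq_fintype_card, Fintype.card_subtype, ← Finset.sum_boole,
      Fintype.sum_prod_type]
    refine Finset.sum_congr rfl fun x _ => Finset.sum_congr rfl fun t _ => ?_
    simp only [Set.indicator, Pi.one_apply]
    split_ifs <;> simp_all
  rw [h1, PiLp.inner_apply]
  refine Finset.sum_congr rfl fun x _ => ?_
  rw [← Equiv.sum_comp ((Equiv.inv G).trans (Equiv.mulRight x))]
  simp only [WithLp.ofLp_sum, WithLp.ofLp_smul, Finset.sum_apply, Pi.smul_apply,
    regularRep_apply, smul_eq_mul]
  simp [Finset.mul_sum, mul_comm]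

/-- A spectral bound for the average over a conjugacy class gives equidistribution of the
quotients of two sets in that class. -/
theorem abs_card_pairs_ratio_sub_one_le {c : G} {D : ℝ} (hD0 : 0 ≤ D)
    (hD : ∀ w, ∑ g, regularRep G g w = 0 → ‖classAvg (regularRep G) c w‖ ≤ D * ‖w‖)
    {S T : Set G} (hS : S.Nonempty) (hT : T.Nonempty) :
    |(Nat.card {pr : G × G // pr.1 ∈ S ∧ pr.2 ∈ T ∧ pr.1 * pr.2⁻¹ ∈ {x | IsConj c x}} : ℝ) *
        Nat.card G / (Nat.card S * Nat.card T * Nat.card {x | IsConj c x}) - 1| ≤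
      D * (Nat.card G : ℝ) ^ 2 / (Nat.card S * Nat.card T) := by
  have hSc : 0 < (Nat.card S : ℝ) := by
    have := hS.to_subtype
    exact_mod_cast Nat.card_pos
  have hTc : 0 < (Nat.card T : ℝ) := by
    have := hT.to_subtype
    exact_mod_cast Nat.card_pos
  have hCc : 0 < (Nat.card {x | IsConj c x} : ℝ) := by
    have : Nonempty {x | IsConj c x} := ⟨⟨c, IsConj.refl c⟩⟩
    exact_mod_cast Nat.card_pos
  have hG : 0 < (Nat.card G : ℝ) := by exact_mod_cast Nat.card_pos
  have hTG : (Nat.card T : ℝ) ≤ Nat.card G := by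
    exact_mod_cast Nat.card_le_card_of_injective (Subtype.val : T → G) Subtype.val_injective
  rw [card_pairs_eq_sum, sum_isConj_smul]
  set τ : ℝ := Nat.card T / Nat.card G with hτ
  have hτ0 : 0 ≤ τ := by positivity
  have hτ1 : τ ≤ 1 := (div_le_one hG).2 hTG
  set e : EuclideanSpace ℝ G := WithLp.toLp 2 1 with he
  set s : EuclideanSpace ℝ G := WithLp.toLp 2 (S.indicator 1) with hs
  set w : EuclideanSpace ℝ G := WithLp.toLp 2 (T.indicator 1) - τ • e with hw
  have hwx (x : G) : w x = T.indicator (1 : G → ℝ) x - τ := by simp [hw, he]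
  have hT1 : WithLp.toLp 2 (T.indicator (1 : G → ℝ)) = w + τ • e := by simp [hw]
  have hwsum : ∑ g, regularRep G g w = 0 := by
    ext x
    simp only [WithLp.ofLp_sum, Finset.sum_apply, regularRep_apply]
    refine (Equiv.sum_comp ((Equiv.inv G).trans (Equiv.mulRight x)) (fun g => w g)).trans ?_
    simp only [hwx, Finset.sum_sub_distrib, sum_indicator_eq_card, hτ]
    simp
    field_simp
    simp
  have hnorm {f : EuclideanSpace ℝ G} (hf : ∀ x, |f x| ≤ 1) : ‖f‖ ≤ √(Nat.card G) := by
    rw [EuclideanSpace.norm_eq]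
    refine Real.sqrt_le_sqrt ?_
    calc ∑ x, ‖f x‖ ^ 2 ≤ ∑ _x : G, (1 : ℝ) :=
          Finset.sum_le_sum fun x _ => pow_le_one₀ (norm_nonneg _) (hf x)
      _ = _ := by simp
  have hwn : ‖w‖ ≤ √(Nat.card G) := by
    refine hnorm fun x => ?_
    rw [hwx, abs_le]
    by_cases h : x ∈ T <;> simp [h] <;> constructor <;> linarith
  have hsn : ‖s‖ ≤ √(Nat.card G) := by
    refine hnorm fun x => ?_
    by_cases h : x ∈ S <;> simp [hs, h]
  have hce : classAvg (regularRep G) c e = e := by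
    have h (g : G) : regularRep G g e = e := by
      ext x
      simp [regularRep_apply, he]
    simp [classAvg, h, ← Nat.cast_smul_eq_nsmul ℝ, smul_smul]
  have hes : ⟪e, s⟫_ℝ = Nat.card S := by
    rw [← sum_indicator_eq_card, PiLp.inner_apply]
    simp [he, hs]
  have hcw : classAvg (regularRep G) c (w + τ • e) = classAvg (regularRep G) c w + τ • e := by
    conv_rhs => rw [← hce]
    simp [classAvg, Finset.sum_add_distrib, Finset.smul_sum, smul_comm τ]
  have herr : |⟪classAvg (regularRep G) c w, s⟫_ℝ| ≤ D * Nat.card G := by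
    refine (abs_real_inner_le_norm _ _).trans ?_
    calc _ ≤ D * √(Nat.card G) * √(Nat.card G) := by
          gcongr
          exact (hD w hwsum).trans (by gcongr)
      _ = _ := by rw [mul_assoc, Real.mul_self_sqrt hG.le]
  rw [hT1, hcw, inner_smul_left, inner_add_left, inner_smul_left, hes]
  generalize ⟪classAvg (regularRep G) c w, s⟫_ℝ = E at herr ⊢
  have hE : (Nat.card {x | IsConj c x} : ℝ) * (E + τ * Nat.card S) * Nat.card G /
      (Nat.card S * Nat.card T * Nat.card {x | IsConj c x}) - 1 =
      E * Nat.card G / (Nat.card S * Nat.card T) := by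
    rw [hτ]
    field_simp
    ring
  simp only [conj_trivial]
  rw [hE, abs_div, abs_mul, abs_of_pos hG, abs_of_pos (mul_pos hSc hTc), sq, ← mul_assoc]
  gcongr

end ClassMixing

section SpecialLinearEquidistribution

open Matrix Filter Topology

/-- Averages over noncentral classes of `SLₙ` decay as the field grows. -/
theorem exists_norm_classAvg_le {n : ℕ} (hn : 2 ≤ n) :
    ∃ F : ℝ → ℝ, Tendsto F (𝓝 0) (𝓝 0) ∧ (∀ δ, 0 ≤ F δ) ∧
      ∀ {K V : Type} [Field K] [Fintype K] [DecidableEq K] [NormedAddCommGroup V]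
        [InnerProductSpace ℝ V] (π : Representation ℝ (SpecialLinearGroup (Fin n) K) V),
        (∀ g u, ‖π g u‖ = ‖u‖) → ∀ v, ∑ g, π g v = 0 →
          ∀ g ∉ Subgroup.center (SpecialLinearGroup (Fin n) K),
            ‖classAvg π g v‖ ≤ F (Fintype.card K : ℝ)⁻¹ * ‖v‖ := by
  rcases hn.eq_or_lt with rfl | hn
  · refine ⟨fun δ => √(√(δ + √(δ + √(2 * δ))) + 6 * δ), ?_, fun _ => Real.sqrt_nonneg _, ?_⟩
    · exact Continuous.tendsto' (by fun_prop) _ _ (by simp)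
    · intro K V _ _ _ _ _ π hπ v hv g hg
      refine le_of_sq_le_sq ?_ (by positivity)
      rw [mul_pow, Real.sq_sqrt (by positivity)]
      exact norm_classAvg_sq_le_of_two hπ hv hg
  · refine ⟨fun δ => √(|δ| + 36 * n * √(2 * δ)), ?_, fun _ => Real.sqrt_nonneg _, ?_⟩
    · exact Continuous.tendsto' (by fun_prop) _ _ (by simp)
    · intro K V _ _ _ _ _ π hπ v hv g hg
      refine le_of_sq_le_sq ?_ (by positivity)
      rw [mul_pow, Real.sq_sqrt (by positivity), abs_of_nonneg (by positivity)]
      refine (norm_classAvg_sq_le_of_three_le hπ hn hv hg).trans (le_of_eq ?_)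
      rw [Real.sqrt_mul (by positivity), Real.sqrt_sq (norm_nonneg v)]
      ring

theorem exists_norm_classAvg_regularRep_le {n : ℕ} (hn : 2 ≤ n) :
    ∃ F : ℝ → ℝ, Tendsto F (𝓝 0) (𝓝 0) ∧ (∀ δ, 0 ≤ F δ) ∧
      ∀ (K : Type) [Field K] [Fintype K] [DecidableEq K],
        ∀ g ∉ Subgroup.center (SpecialLinearGroup (Fin n) K),
          ∀ v, ∑ h, regularRep (SpecialLinearGroup (Fin n) K) h v = 0 →
            ‖classAvg (regularRep _) g v‖ ≤ F (Fintype.card K : ℝ)⁻¹ * ‖v‖ := by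
  obtain ⟨F, hF, hF0, hdecay⟩ := exists_norm_classAvg_le hn
  refine ⟨F, hF, hF0, ?_⟩
  intro K _ _ _ g hg v hv
  refine hdecay (regularRep (SpecialLinearGroup (Fin n) K)) ?_ v hv g hg
  exact fun g u => norm_regularRep g u

theorem card_specialLinearGroup_le {n : ℕ} (hn : n ≠ 0) (K : Type*) [Field K] [Fintype K]
    [DecidableEq K] :
    Fintype.card (SpecialLinearGroup (Fin n) K) ≤ 2 * Fintype.card K ^ (n ^ 2 - 1) := by
  obtain ⟨k, rfl⟩ := Nat.exists_eq_succ_of_ne_zero hn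
  have h1 : Fintype.card (Kˣ × SpecialLinearGroup (Fin (k + 1)) K) ≤
      Fintype.card (Matrix (Fin (k + 1)) (Fin (k + 1)) K) := by
    refine Fintype.card_le_of_injective (fun p => p.2.1.updateRow 0 ((p.1 : K) • p.2.1 0)) ?_
    have hdet (c : Kˣ) (g : SpecialLinearGroup (Fin (k + 1)) K) :
        (g.1.updateRow 0 ((c : K) • g.1 0)).det = c := by
      rw [det_updateRow_smul, updateRow_eq_self, g.2, mul_one]
    rintro ⟨c, g⟩ ⟨c', g'⟩ h
    dsimp only at h
    have hc : c = c' := Units.ext (by rw [← hdet c g, h, hdet])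
    subst hc
    refine Prod.ext rfl (Subtype.ext ?_)
    ext i j
    have hij := congrFun (congrFun h i) j
    by_cases hi : i = 0
    · subst hi
      simpa using hij
    · simpa [updateRow_apply, hi] using hij
  rw [Fintype.card_prod, Fintype.card_units,
    Fintype.card_congr (Matrix.of (m := Fin (k + 1)) (n := Fin (k + 1)) (α := K)).symm,
    Fintype.card_fun, Fintype.card_fun, ← pow_mul] at h1
  have h2 : 2 ≤ Fintype.card K := Fintype.one_lt_card
  have h3 : (k + 1) ^ 2 - 1 + 1 = (k + 1) * (k + 1) := by
    rw [Nat.sub_add_cancel (Nat.one_le_pow _ _ k.succ_pos), sq]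
  refine Nat.le_of_mul_le_mul_left (c := Fintype.card K) ?_ (by omega)
  calc Fintype.card K * Fintype.card (SpecialLinearGroup (Fin (k + 1)) K)
      ≤ 2 * (Fintype.card K - 1) * Fintype.card (SpecialLinearGroup (Fin (k + 1)) K) := by
        gcongr
        omega
    _ ≤ 2 * Fintype.card K ^ (Fintype.card (Fin (k + 1)) * Fintype.card (Fin (k + 1))) := by
        rw [mul_assoc]
        gcongr
    _ = _ := by
        rw [Fintype.card_fin, ← h3, pow_succ]
        ring

end SpecialLinearEquidistribution

/-- equidistribution for bounded rank, type A: fix `n ≥ 2` and a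
prime power `q = p^e`. For every `ε > 0` there is `M` such that for all `m > M`,
any finite field `K` with `q^m` elements, any subsets `S, T` of `G = SL_n(K)` of
size at least `ε·q^(m(n²-1))`, and any non-central conjugacy class `C` of `G`,
the number of pairs `(s,t) ∈ S × T` with `st⁻¹ ∈ C` is within a factor
`(1 ± ε)` of `|S||T||C|/|G|`. -/
theorem stmt_18 (n : ℕ) (hn : 2 ≤ n) (p e : ℕ) (hp : p.Prime) (he : 1 ≤ e)
    (q : ℕ) (hq : q = p ^ e) (ε : ℝ) (hε : 0 < ε) :
    ∃ M : ℕ, ∀ m : ℕ, M < m →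
      ∀ (K : Type) [Field K] [Fintype K] [DecidableEq K], Fintype.card K = q ^ m →
        ∀ S T : Set (Matrix.SpecialLinearGroup (Fin n) K),
          ε * (q : ℝ) ^ (m * (n ^ 2 - 1)) ≤ (Nat.card S : ℝ) →
          ε * (q : ℝ) ^ (m * (n ^ 2 - 1)) ≤ (Nat.card T : ℝ) →
          ∀ C : Set (Matrix.SpecialLinearGroup (Fin n) K),
            (∃ c : Matrix.SpecialLinearGroup (Fin n) K, C = {x | IsConj c x}) →
            ¬ C ⊆ (Subgroup.center (Matrix.SpecialLinearGroup (Fin n) K) : Set _) →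
            1 - ε <
              (Nat.card {pr : Matrix.SpecialLinearGroup (Fin n) K ×
                  Matrix.SpecialLinearGroup (Fin n) K //
                  pr.1 ∈ S ∧ pr.2 ∈ T ∧ pr.1 * pr.2⁻¹ ∈ C} : ℝ) *
                (Nat.card (Matrix.SpecialLinearGroup (Fin n) K) : ℝ) /
                ((Nat.card S : ℝ) * (Nat.card T : ℝ) * (Nat.card C : ℝ)) ∧
            (Nat.card {pr : Matrix.SpecialLinearGroup (Fin n) K ×
                Matrix.SpecialLinearGroup (Fin n) K //
                pr.1 ∈ S ∧ pr.2 ∈ T ∧ pr.1 * pr.2⁻¹ ∈ C} : ℝ) *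
              (Nat.card (Matrix.SpecialLinearGroup (Fin n) K) : ℝ) /
              ((Nat.card S : ℝ) * (Nat.card T : ℝ) * (Nat.card C : ℝ)) <
            1 + ε := by
  obtain ⟨F, hF, hF0, hdecay⟩ := exists_norm_classAvg_regularRep_le hn
  have hq1 : 1 < q := hq ▸ Nat.one_lt_pow (by omega) hp.one_lt
  have hlim : Filter.Tendsto (fun m : ℕ => F (((q ^ m : ℕ) : ℝ)⁻¹)) Filter.atTop (nhds 0) :=
    hF.comp (tendsto_inv_atTop_zero.comp
      (tendsto_natCast_atTop_atTop.comp (tendsto_pow_atTop_atTop_of_one_lt hq1)))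
  obtain ⟨M, hM⟩ := Filter.eventually_atTop.1
    (hlim.eventually_lt_const (show (0 : ℝ) < ε ^ 3 / 4 by positivity))
  refine ⟨M, fun m hm K _ _ _ hK S T hS hT C hC hCc => ?_⟩
  obtain ⟨c, rfl⟩ := hC
  have hc : c ∉ Subgroup.center (Matrix.SpecialLinearGroup (Fin n) K) := by
    refine fun hc => hCc fun x hx => ?_
    obtain ⟨y, rfl⟩ := isConj_iff.1 hx
    rwa [Subgroup.mem_center_iff.1 hc y, mul_inv_cancel_right]
  rw [pow_mul] at hS hT
  have hKq : (q : ℝ) ^ m = Fintype.card K := by rw [hK, Nat.cast_pow]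
  rw [hKq] at hS hT
  set Q : ℝ := (Fintype.card K : ℝ) ^ (n ^ 2 - 1) with hQ
  have hQ0 : 0 < Q := by positivity
  have hG : (Nat.card (Matrix.SpecialLinearGroup (Fin n) K) : ℝ) ≤ 2 * Q := by
    rw [Nat.card_eq_fintype_card, hQ]
    exact_mod_cast card_specialLinearGroup_le (by omega) K
  have hne {S : Set (Matrix.SpecialLinearGroup (Fin n) K)} (hS : ε * Q ≤ Nat.card S) :
      S.Nonempty := by
    rw [Set.nonempty_iff_ne_empty]
    rintro rfl
    have := mul_pos hε hQ0
    simp at hS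
    linarith
  have hδ := hM m hm.le
  rw [← hK] at hδ
  have key := abs_card_pairs_ratio_sub_one_le (hF0 _) (hdecay K c hc) (hne hS) (hne hT)
  have hS0 := (mul_pos hε hQ0).trans_le hS
  have hT0 := (mul_pos hε hQ0).trans_le hT
  have hlt := key.trans_lt ((div_lt_iff₀ (mul_pos hS0 hT0)).2 (
    calc _ ≤ F (Fintype.card K : ℝ)⁻¹ * (2 * Q) ^ 2 := by
          gcongr
          exact hF0 _
      _ < ε ^ 3 / 4 * (2 * Q) ^ 2 := by gcongr
      _ = ε * ((ε * Q) * (ε * Q)) := by ring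
      _ ≤ _ := by gcongr))
  rw [abs_lt] at hlt
  constructor <;> linarith [hlt.1, hlt.2]
end

section
/- Let n ≥ 10, and let σ₁ = (1,2,3)(4,5,…,n) and σ₂ = (1,2,3,4)(5,6,…,n) in the symmetric group S_n. Then there are exactly twelve irreducible complex characters χ of S_n satisfying χ(σ₁)·χ(σ₂) ≠ 0, and for each of these twelve characters one has χ(σ₁)·χ(σ₂) = 1 or χ(σ₁)·χ(σ₂) = −1. -/
section Frobenius

open Finset

/-- The sum of the monomials `∏ m, z (f m)` over all colourings `f` that are invariant under `g`.
It is the product over the cycles of `g`, of length `c`, of the power sums `∑ k, z k ^ c`. -/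
def invariantColouringSum {ι κ A : Type*} [Fintype ι] [DecidableEq ι] [Fintype κ] [DecidableEq κ]
    [CommRing A] (z : κ → A) (g : Equiv.Perm ι) : A :=
  ∑ f : ι → κ with ∀ m, f (g m) = f m, ∏ m, z (f m)

/-- The number of points of each colour. -/
noncomputable def colourCount {ι κ : Type*} [Fintype ι] [Fintype κ] [DecidableEq κ]
    (f : ι → κ) : κ →₀ ℕ :=
  Finsupp.equivFunOnFinite.symm fun k => #{m | f m = k}

section colourCount

variable {ι κ : Type*} [Fintype ι] [Fintype κ] [DecidableEq κ]

theorem colourCount_apply (f : ι → κ) (k : κ) : colourCount f k = #{m | f m = k} := rfl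

theorem prod_comp_eq_prod_pow_colourCount {A : Type*} [CommRing A] (z : κ → A) (f : ι → κ) :
    ∏ m, z (f m) = ∏ k, z k ^ colourCount f k := by
  simp only [colourCount_apply]
  rw [← Finset.prod_fiberwise univ f]
  refine Finset.prod_congr rfl fun k _ => ?_
  rw [Finset.prod_congr rfl fun m hm => by rw [(Finset.mem_filter.1 hm).2], Finset.prod_const]

theorem sum_colourCount (f : ι → κ) : ∑ k, colourCount f k = Fintype.card ι := by
  simp only [colourCount_apply]
  exact (Finset.card_eq_sum_card_fiberwise (fun _ _ => Finset.mem_univ _)).symm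

theorem colourCount_comp_perm (f : ι → κ) (g : Equiv.Perm ι) :
    colourCount (f ∘ g) = colourCount f := by
  ext k
  simp only [colourCount_apply]
  exact Finset.card_equiv g (by simp)

theorem exists_perm_comp_eq_of_colourCount_eq {f f' : ι → κ} (h : colourCount f = colourCount f') :
    ∃ g : Equiv.Perm ι, f ∘ g = f' := by
  have hk : ∀ k, Nonempty ({m // f' m = k} ≃ {m // f m = k}) := fun k => by
    refine ⟨Fintype.equivOfCardEq ?_⟩
    simpa [Fintype.card_subtype, colourCount_apply] using (DFunLike.congr_fun h k).symm
  exact ⟨Equiv.ofFiberEquiv fun k => (hk k).some, funext fun m => Equiv.ofFiberEquiv_map _ m⟩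

theorem exists_colourCount_eq {l : κ →₀ ℕ} (hl : ∑ k, l k = Fintype.card ι) :
    ∃ f : ι → κ, colourCount f = l := by
  have e : ι ≃ (Σ k, Fin (l k)) := Fintype.equivOfCardEq (by simp [hl])
  refine ⟨fun m => (e m).1, ?_⟩
  ext k
  rw [colourCount_apply, ← Fintype.card_subtype,
    Fintype.card_congr ((e.subtypeEquiv fun m => Iff.rfl :
      {m // (e m).1 = k} ≃ {p : Σ k, Fin (l k) // p.1 = k}).trans
      (Equiv.sigmaSubtype k)), Fintype.card_fin]

end colourCount

theorem invariantColouringSum_mul {ι κ κ' A : Type*} [Fintype ι] [DecidableEq ι] [Fintype κ]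
    [DecidableEq κ] [Fintype κ'] [DecidableEq κ'] [CommRing A] (z : κ → A) (z' : κ' → A)
    (g : Equiv.Perm ι) :
    invariantColouringSum z g * invariantColouringSum z' g =
      invariantColouringSum (fun p : κ × κ' => z p.1 * z' p.2) g := by
  unfold invariantColouringSum
  rw [Finset.sum_mul_sum, ← Finset.sum_product']
  refine Finset.sum_equiv (Equiv.arrowProdEquivProdArrow ι (fun _ => κ) (fun _ => κ')).symm ?_ ?_
  · simp [Prod.ext_iff, forall_and]
  · simp [Finset.prod_mul_distrib]

theorem sum_perm_invariantColouringSum {ι κ A : Type*} [Fintype ι] [DecidableEq ι] [Fintype κ]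
    [DecidableEq κ] [CommRing A] (z : κ → A) :
    ∑ g : Equiv.Perm ι, invariantColouringSum z g =
      (Nat.factorial (Fintype.card ι) : A) *
        ∑ l ∈ univ.finsuppAntidiag (Fintype.card ι), ∏ k, z k ^ l k := by
  unfold invariantColouringSum
  simp only [Finset.sum_filter]
  rw [Finset.sum_comm, ← Finset.sum_fiberwise_of_maps_to (s := univ)
    (t := univ.finsuppAntidiag (Fintype.card ι)) (g := colourCount), Finset.mul_sum]
  · refine Finset.sum_congr rfl fun l hl => ?_
    obtain ⟨f₀, rfl⟩ := exists_colourCount_eq (ι := ι) (Finset.mem_finsuppAntidiag.1 hl).1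
    have hstab : ∀ f : ι → κ, colourCount f = colourCount f₀ →
        ∑ g : Equiv.Perm ι, (if ∀ m, f (g m) = f m then ∏ m, z (f m) else 0) =
          ∑ g : Equiv.Perm ι, if f₀ ∘ g = f then ∏ k, z k ^ colourCount f₀ k else 0 := by
      intro f hf
      obtain ⟨h, rfl⟩ := exists_perm_comp_eq_of_colourCount_eq hf.symm
      refine Fintype.sum_equiv (Equiv.mulLeft h) _ _ fun g => ?_
      rw [prod_comp_eq_prod_pow_colourCount, hf]
      simp [funext_iff]
    rw [Finset.sum_congr rfl fun f hf => hstab f (Finset.mem_filter.1 hf).2, Finset.sum_comm]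
    simp [Finset.sum_ite_eq, colourCount_comp_perm, Fintype.card_perm]
  · intro f _
    simp [sum_colourCount]

/-- Cauchy's determinant in the form `det (1 / (1 - xᵢ yⱼ))`, over any commutative ring. -/
theorem Matrix.det_of_mul_one_sub_eq_one {A : Type*} [CommRing A] :
    ∀ {N : ℕ} (x y : Fin N → A) (u : Fin N → Fin N → A),
      (∀ i j, u i j * (1 - x i * y j) = 1) →
      (Matrix.of u).det =
        (Matrix.vandermonde x).det * (Matrix.vandermonde y).det * ∏ i, ∏ j, u i j := by
  intro N
  induction N with
  | zero => intro x y u _; simp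
  | succ N ih =>
    intro x y u hu
    have hrow : ∀ i j k, u i j - u k j = (x i - x k) * (y j * u i j * u k j) := by
      intro i j k
      linear_combination (u k j) * hu i j - u i j * hu k j
    have hcol : ∀ i j k, y j * u i j - y k * u i k = (y j - y k) * (u i j * u i k) := by
      intro i j k
      linear_combination (u i k * y k) * hu i j - (u i j * y j) * hu i k
    let D : Matrix (Fin (N + 1)) (Fin (N + 1)) A :=
      Matrix.of fun i j => Fin.cases 1 (fun i' => y j * u i'.succ j) i
    let E : Matrix (Fin (N + 1)) (Fin (N + 1)) A :=
      Matrix.of fun i j => Fin.cases (D i 0) (fun j' => D i j'.succ - D i 0) j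
    have h1 : (Matrix.of u).det = (Matrix.of fun i j =>
        (Fin.cons 1 (fun i' => x i'.succ - x 0) : Fin (N + 1) → A) i *
          (Matrix.of fun i j => u 0 j * D i j) i j).det := by
      refine Matrix.det_eq_of_forall_row_eq_smul_add_const
        (fun i => if i = 0 then 0 else 1) 0 (by simp) ?_
      intro i j
      refine Fin.cases ?_ (fun i => ?_) i
      · simp [D]
      · simp only [D, Matrix.of_apply, Fin.cons_succ, Fin.cons_zero, Fin.cases_succ,
          Fin.cases_zero, Fin.succ_ne_zero, if_false]
        linear_combination hrow i.succ j 0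
    have h2 : D.det = E.det := by
      rw [← Matrix.det_transpose D, ← Matrix.det_transpose E]
      refine Matrix.det_eq_of_forall_row_eq_smul_add_const
        (fun i => if i = 0 then 0 else 1) 0 (by simp) ?_
      intro i j
      refine Fin.cases ?_ (fun i => ?_) i
      · simp [E]
      · simp [E]
    have h3 : E.det = (Matrix.of fun i j : Fin N => u i.succ 0 *
        (Matrix.of fun i j : Fin N => (y j.succ - y 0) *
          (Matrix.of fun i j : Fin N => u i.succ j.succ) i j) i j).det := by
      rw [Matrix.det_succ_row_zero, Finset.sum_eq_single 0]
      · simp only [Fin.val_zero, pow_zero, one_mul, Fin.succAbove_zero]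
        have : E 0 0 = 1 := by simp [E, D]
        rw [this, one_mul]
        congr 1
        ext i j
        simp only [E, D, Matrix.of_apply, Matrix.submatrix_apply, Fin.cases_succ]
        linear_combination hcol i.succ j.succ 0
      · intro j _ hj
        obtain ⟨j, rfl⟩ := Fin.exists_succ_eq.2 hj
        simp [E, D]
      · simp
    have h4 := ih (fun i => x i.succ) (fun i => y i.succ) (fun i j => u i.succ j.succ)
      (fun i j => hu _ _)
    rw [h1, Matrix.det_mul_column, Matrix.det_mul_row, h2, h3, Matrix.det_mul_column,
      Matrix.det_mul_row, h4]
    simp only [Matrix.det_vandermonde, Fin.prod_univ_succ, Fin.cons_zero, Fin.cons_succ,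
      Fin.prod_Ioi_zero, Fin.prod_Ioi_succ, Finset.prod_mul_distrib]
    ring

/-- The part of degree `n + N.choose 2` of Cauchy's determinant identity. -/
theorem vandermonde_mul_vandermonde_mul_sum {A : Type*} [CommRing A] {N : ℕ} (x y : Fin N → A)
    (n : ℕ) :
    (Matrix.vandermonde x).det * (Matrix.vandermonde y).det *
        ∑ l ∈ univ.finsuppAntidiag n, ∏ p : Fin N × Fin N, (x p.1 * y p.2) ^ l p =
      ∑ w : Equiv.Perm (Fin N), (Equiv.Perm.sign w : A) *
        ∑ l ∈ univ.finsuppAntidiag (n + ∑ i : Fin N, (i : ℕ)), ∏ i, (x i * y (w i)) ^ l i := by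
  let x' : Fin N → PowerSeries A := fun i => PowerSeries.X * PowerSeries.C (x i)
  let y' : Fin N → PowerSeries A := fun i => PowerSeries.C (y i)
  let u : Fin N → Fin N → PowerSeries A := fun i j => PowerSeries.mk fun m => (x i * y j) ^ m
  have hu : ∀ i j, u i j * (1 - x' i * y' j) = 1 := by
    intro i j
    ext m
    have : x' i * y' j = PowerSeries.C (x i * y j) * PowerSeries.X := by
      simp only [x', y', map_mul]; ring
    rw [this, mul_sub, mul_one, ← mul_assoc]
    cases m with
    | zero => simp [u]
    | succ m =>
      rw [map_sub, PowerSeries.coeff_succ_mul_X, PowerSeries.coeff_mul_C]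
      simp [u, PowerSeries.coeff_one, pow_succ]
  have key := Matrix.det_of_mul_one_sub_eq_one x' y' u hu
  have hx : (Matrix.vandermonde x').det =
      PowerSeries.X ^ (∑ i : Fin N, (i : ℕ)) * PowerSeries.C (Matrix.vandermonde x).det := by
    have : Matrix.vandermonde x' = Matrix.of fun (i j : Fin N) =>
        (PowerSeries.X : PowerSeries A) ^ (j : ℕ) *
          (PowerSeries.C (R := A)).mapMatrix (Matrix.vandermonde x) i j := by
      ext1 i j
      simp [Matrix.vandermonde_apply, x', mul_pow]
    rw [this, Matrix.det_mul_row, Finset.prod_pow_eq_pow_sum, ← RingHom.map_det]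
  have hy : (Matrix.vandermonde y').det = PowerSeries.C (Matrix.vandermonde y).det := by
    rw [RingHom.map_det]
    congr 1
    ext1 i j
    simp [Matrix.vandermonde_apply, y']
  rw [hx, hy] at key
  have h2 := congrArg (PowerSeries.coeff (n + ∑ i : Fin N, (i : ℕ))) key
  rw [← Finset.univ_product_univ]
  rw [← Finset.prod_product' univ univ u, mul_assoc, mul_assoc, PowerSeries.coeff_X_pow_mul,
    ← mul_assoc, ← map_mul, PowerSeries.coeff_C_mul, PowerSeries.coeff_prod] at h2
  simp only [u, PowerSeries.coeff_mk] at h2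
  rw [← h2, ← Matrix.det_transpose, Matrix.det_apply', map_sum]
  refine Finset.sum_congr rfl fun w _ => ?_
  rw [← map_intCast (PowerSeries.C (R := A)), PowerSeries.coeff_C_mul, PowerSeries.coeff_prod]
  simp

open MvPolynomial in
/-- The coefficient of `x ^ β` in the product of the Vandermonde determinant with the power sum
symmetric function of the cycle type of `g`. By Frobenius' formula these are, up to sign, the values
of the irreducible characters of the symmetric group. -/
noncomputable def frobeniusCoeff {ι : Type*} [Fintype ι] [DecidableEq ι] {N : ℕ} (β : Fin N →₀ ℕ)
    (g : Equiv.Perm ι) : ℤ :=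
  coeff β ((Matrix.vandermonde X).det * invariantColouringSum X g : MvPolynomial (Fin N) ℤ)

theorem RingHom.map_det_vandermonde {A B : Type*} [CommRing A] [CommRing B] (φ : A →+* B) {N : ℕ}
    (x : Fin N → A) :
    φ (Matrix.vandermonde x).det = (Matrix.vandermonde fun i => φ (x i)).det := by
  rw [RingHom.map_det]
  congr 1
  ext1 i j
  simp [Matrix.vandermonde_apply]

theorem RingHom.map_invariantColouringSum {ι κ A B : Type*} [Fintype ι] [DecidableEq ι] [Fintype κ]
    [DecidableEq κ] [CommRing A] [CommRing B] (φ : A →+* B) (x : κ → A) (g : Equiv.Perm ι) :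
    φ (invariantColouringSum x g) = invariantColouringSum (fun k => φ (x k)) g := by
  simp [invariantColouringSum]

theorem invariantColouringSum_inv {ι κ A : Type*} [Fintype ι] [DecidableEq ι] [Fintype κ]
    [DecidableEq κ] [CommRing A] (x : κ → A) (g : Equiv.Perm ι) :
    invariantColouringSum x g⁻¹ = invariantColouringSum x g := by
  unfold invariantColouringSum
  congr 1
  ext f
  simp only [Finset.mem_filter, Finset.mem_univ, true_and]
  exact ⟨fun h m => by simpa using (h (g m)).symm, fun h m => by simpa using (h (g⁻¹ m)).symm⟩

theorem frobeniusCoeff_inv {ι : Type*} [Fintype ι] [DecidableEq ι] {N : ℕ} (β : Fin N →₀ ℕ)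
    (g : Equiv.Perm ι) : frobeniusCoeff β g⁻¹ = frobeniusCoeff β g := by
  simp [frobeniusCoeff, invariantColouringSum_inv]

open MvPolynomial in
theorem sum_frobeniusCoeff_mul {ι : Type*} [Fintype ι] [DecidableEq ι] {N : ℕ} {β : Fin N →₀ ℕ}
    (γ : Fin N →₀ ℕ) (hβ : ∑ i, β i = Fintype.card ι + ∑ i : Fin N, (i : ℕ)) :
    ∑ g : Equiv.Perm ι, frobeniusCoeff β g * frobeniusCoeff γ g =
      (Nat.factorial (Fintype.card ι) : ℤ) *
        ∑ w : Equiv.Perm (Fin N),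
          if ∀ i, γ (w i) = β i then (Equiv.Perm.sign w : ℤ) else 0 := by
  let B := MvPolynomial (Fin N) ℤ
  let A := MvPolynomial (Fin N) B
  let F : Equiv.Perm ι → B := fun g => (Matrix.vandermonde X).det * invariantColouringSum X g
  let x : Fin N → A := X
  let y : Fin N → A := fun j => C (X j)
  have hF : ∀ g, map C (F g) * C (F g) =
      (Matrix.vandermonde x).det * (Matrix.vandermonde y).det *
        invariantColouringSum (fun p : Fin N × Fin N => x p.1 * y p.2) g := by
    intro g
    rw [← invariantColouringSum_mul]
    simp only [F, map_mul, RingHom.map_det_vandermonde, RingHom.map_invariantColouringSum, map_X]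
    ring
  have hcoeff : ∀ g, coeff γ (coeff β (map C (F g) * C (F g) : A)) =
      frobeniusCoeff β g * frobeniusCoeff γ g := by
    intro g
    rw [mul_comm (map C (F g)), coeff_C_mul, coeff_map, mul_comm, coeff_C_mul]
    rfl
  have hmon : ∀ (w : Equiv.Perm (Fin N)) (l : Fin N →₀ ℕ),
      (∏ i, (x i * y (w i)) ^ l i : A) = monomial l (monomial (l.mapDomain w) 1) := by
    intro w l
    have h1 : (∏ i, x i ^ l i : A) = monomial l 1 := by
      rw [monomial_eq, Finsupp.prod_fintype _ _ (by simp)]; simp [x]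
    have h2 : (∏ i, X (w i) ^ l i : B) = monomial (l.mapDomain w) 1 := by
      rw [monomial_eq, Finsupp.prod_fintype _ _ (by simp), C_1, one_mul,
        ← Equiv.prod_comp w fun j => X j ^ l.mapDomain w j]
      simp only [Finsupp.mapDomain_apply w.injective]
    simp only [mul_pow, Finset.prod_mul_distrib, h1, y]
    rw [Finset.prod_congr rfl fun i _ => (map_pow (C (σ := Fin N) (R := B)) _ _).symm,
      ← map_prod, h2, mul_comm, C_mul_monomial, mul_one]
  simp only [← hcoeff, hF]
  rw [← coeff_sum, ← coeff_sum, ← Finset.mul_sum, sum_perm_invariantColouringSum,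
    mul_left_comm, vandermonde_mul_vandermonde_mul_sum]
  simp only [hmon]
  rw [← map_natCast (C (σ := Fin N) (R := B)), coeff_C_mul,
    ← map_natCast (C (σ := Fin N) (R := ℤ)), coeff_C_mul, coeff_sum, coeff_sum]
  congr 1
  refine Finset.sum_congr rfl fun w _ => ?_
  rw [← map_intCast (C (σ := Fin N) (R := B)), coeff_C_mul,
    ← map_intCast (C (σ := Fin N) (R := ℤ)), coeff_C_mul, coeff_sum, coeff_sum,
    Finset.sum_eq_single β]
  · rw [coeff_monomial, if_pos rfl, coeff_monomial]
    have : β.mapDomain w = γ ↔ ∀ i, γ (w i) = β i := by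
      constructor
      · rintro rfl i
        exact Finsupp.mapDomain_apply w.injective _ _
      · intro h
        ext i
        obtain ⟨i, rfl⟩ := w.surjective i
        rw [Finsupp.mapDomain_apply w.injective, h]
    simp [this]
  · intro l _ hl
    rw [coeff_monomial, if_neg hl, coeff_zero]
  · intro h
    exact absurd (by simp [hβ]) h

section VirtualCharacters

open CategoryTheory

/-- The set of irreducible complex characters of `G`. -/
def irreducibleCharacters (G : Type) [Group G] : Set (G → ℂ) :=
  {χ | ∃ V : FDRep ℂ G, Simple V ∧ χ = FDRep.character V}

variable {G : Type} [Group G]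

theorem Representation.character_eq_add_of_isCompl {V : Type} [AddCommGroup V] [Module ℂ V]
    [FiniteDimensional ℂ V] (ρ : Representation ℂ G V) {W W' : Subrepresentation ρ}
    (h : IsCompl W.toSubmodule W'.toSubmodule) :
    ρ.character = W.toRepresentation.character + W'.toRepresentation.character := by
  funext g
  let e := Submodule.prodEquivOfIsCompl _ _ h
  have : ρ g = e.conj ((W.toRepresentation g).prodMap (W'.toRepresentation g)) := by
    ext v
    obtain ⟨⟨a, b⟩, rfl⟩ := e.surjective v
    simp [LinearEquiv.conj_apply, e, Subrepresentation.toRepresentation]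
  rw [Pi.add_apply, Representation.character, this, LinearMap.trace_conj',
    LinearMap.trace_prodMap']
  rfl

variable [Fintype G]

theorem sum_irreducibleCharacters_mul {χ χ' : G → ℂ} (hχ : χ ∈ irreducibleCharacters G)
    (hχ' : χ' ∈ irreducibleCharacters G) :
    ∑ g, χ g * χ' g⁻¹ = if χ = χ' then (Nat.card G : ℂ) else 0 := by
  obtain ⟨V, hV, rfl⟩ := hχ
  obtain ⟨W, hW, rfl⟩ := hχ'
  have h0 : (Nat.card G : ℂ) ≠ 0 := Nat.cast_ne_zero.2 Nat.card_pos.ne'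
  have := invertibleOfNonzero h0
  have hiso : ∀ U : FDRep ℂ G, Simple U →
      ∑ g, U.character g * U.character g⁻¹ = (Nat.card G : ℂ) := fun U hU =>
    (FDRep.simple_iff_char_is_norm_one U).1 hU
  split_ifs with h
  · rw [h, hiso W hW]
  · have horth := FDRep.char_orthonormal V W
    rw [if_neg fun ⟨i⟩ => h (FDRep.char_iso i)] at horth
    exact (mul_eq_zero.1 horth).resolve_left (inv_ne_zero h0)

theorem Representation.character_mem_closure_irreducibleCharacters {V : Type} [AddCommGroup V]
    [Module ℂ V] [FiniteDimensional ℂ V] (ρ : Representation ℂ G V) :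
    ρ.character ∈ AddSubgroup.closure (irreducibleCharacters G) := by
  induction hd : Module.finrank ℂ V using Nat.strong_induction_on generalizing V with
  | _ d ih =>
    have h0 : (Nat.card G : ℂ) ≠ 0 := Nat.cast_ne_zero.2 Nat.card_pos.ne'
    by_cases hirr : ρ.IsIrreducible
    · refine AddSubgroup.subset_closure ⟨FDRep.of ρ, ?_, rfl⟩
      rw [FDRep.simple_iff_char_is_norm_one]
      have := invertibleOfNonzero h0
      have horth := Representation.char_orthonormal ρ ρ
      rw [if_pos ⟨Representation.Equiv.refl ρ⟩, inv_mul_eq_one₀ h0] at horth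
      exact horth.symm
    · rcases subsingleton_or_nontrivial V with hV | hV
      · have : ρ.character = 0 := by
          funext g
          rw [Representation.character, Subsingleton.elim (ρ g) 0, map_zero, Pi.zero_apply]
        rw [this]
        exact zero_mem _
      · have hW : ∃ W : Subrepresentation ρ, W ≠ ⊥ ∧ W ≠ ⊤ := by
          by_contra! hcon
          have : Nontrivial (Subrepresentation ρ) := ⟨⊥, ⊤, fun h => by
            have := congrArg Subrepresentation.toSubmodule h
            exact bot_ne_top (α := Submodule ℂ V) this⟩
          exact hirr ⟨fun W => or_iff_not_imp_left.2 (hcon W)⟩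
        obtain ⟨W, hW0, hW1⟩ := hW
        have : NeZero (Nat.card G : ℂ) := ⟨h0⟩
        obtain ⟨W', hWW'⟩ := exists_isCompl W
        have hcompl : IsCompl W.toSubmodule W'.toSubmodule := by
          rw [isCompl_iff, disjoint_iff, codisjoint_iff] at hWW' ⊢
          exact ⟨congrArg Subrepresentation.toSubmodule hWW'.1,
            congrArg Subrepresentation.toSubmodule hWW'.2⟩
        have hlt : W.toSubmodule ≠ ⊤ := fun h =>
          hW1 (Subrepresentation.toSubmodule_injective h)
        have hlt' : W'.toSubmodule ≠ ⊤ := fun h => by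
          rw [h] at hcompl
          exact hW0 (Subrepresentation.toSubmodule_injective (eq_bot_of_isCompl_top hcompl))
        rw [Representation.character_eq_add_of_isCompl ρ hcompl]
        exact add_mem (ih _ (hd ▸ Submodule.finrank_lt hlt) _ rfl)
          (ih _ (hd ▸ Submodule.finrank_lt hlt') _ rfl)

theorem exists_irreducibleCharacter_eq_or_eq_neg {ψ : G → ℂ}
    (hψ : ψ ∈ AddSubgroup.closure (irreducibleCharacters G))
    (hnorm : ∑ g, ψ g * ψ g⁻¹ = Nat.card G) :
    ∃ χ ∈ irreducibleCharacters G, ψ = χ ∨ ψ = -χ := by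
  classical
  have h0 : (Nat.card G : ℂ) ≠ 0 := Nat.cast_ne_zero.2 Nat.card_pos.ne'
  rw [← Submodule.span_int_eq_addSubgroupClosure, Submodule.mem_toAddSubgroup,
    Finsupp.mem_span_iff_linearCombination] at hψ
  obtain ⟨c, rfl⟩ := hψ
  have hc : ∑ χ ∈ c.support, c χ * c χ = 1 := by
    have h1 : ∑ g, (Finsupp.linearCombination ℤ Subtype.val c : G → ℂ) g *
        (Finsupp.linearCombination ℤ Subtype.val c : G → ℂ) g⁻¹ =
        ∑ χ ∈ c.support, ∑ χ' ∈ c.support, (c χ * c χ' : ℂ) *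
          ∑ g, χ.1 g * χ'.1 g⁻¹ := by
      simp only [Finsupp.linearCombination_apply, Finsupp.sum, Finset.sum_apply, Finset.sum_mul_sum]
      rw [Finset.sum_comm]
      refine Finset.sum_congr rfl fun χ _ => ?_
      rw [Finset.sum_comm]
      refine Finset.sum_congr rfl fun χ' _ => ?_
      rw [Finset.mul_sum]
      refine Finset.sum_congr rfl fun g _ => ?_
      simp only [Pi.smul_apply, zsmul_eq_mul]
      ring
    rw [h1] at hnorm
    simp only [fun χ χ' : irreducibleCharacters G => sum_irreducibleCharacters_mul χ.2 χ'.2,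
      mul_ite, mul_zero, ← Subtype.ext_iff, Finset.sum_ite_eq] at hnorm
    rw [Finset.sum_congr rfl fun χ hχ => if_pos hχ, ← Finset.sum_mul] at hnorm
    have := mul_right_cancel₀ h0 (hnorm.trans (one_mul _).symm)
    exact_mod_cast this
  obtain ⟨χ, hχ⟩ : c.support.Nonempty := by
    rw [Finset.nonempty_iff_ne_empty]
    rintro h
    simp [h] at hc
  have hpos : ∀ χ ∈ c.support, 1 ≤ c χ * c χ := fun χ hχ => by
    have := mul_self_pos.2 (Finsupp.mem_support_iff.1 hχ)
    omega
  have hsupp : c.support = {χ} := by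
    refine Finset.eq_singleton_iff_unique_mem.2 ⟨hχ, fun χ' hχ' => ?_⟩
    by_contra hne
    have := Finset.add_le_sum (f := fun χ => c χ * c χ) (fun i _ => mul_self_nonneg (c i))
      hχ hχ' (Ne.symm hne)
    have h1 := hpos χ hχ
    have h2 := hpos χ' hχ'
    omega
  refine ⟨χ.1, χ.2, ?_⟩
  rw [hsupp, Finset.sum_singleton, mul_self_eq_one_iff] at hc
  rw [Finsupp.linearCombination_apply, Finsupp.sum, hsupp, Finset.sum_singleton]
  rcases hc with hc | hc <;> simp [hc]

end VirtualCharacters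

theorem exists_irreducibleCharacters_of_orthogonal {G T : Type} [Group G] [Fintype G] [Fintype T]
    [DecidableEq T] (ψ : T → G → ℤ)
    (hψ : ∀ t, (fun g => (ψ t g : ℂ)) ∈ AddSubgroup.closure (irreducibleCharacters G))
    (hinv : ∀ t g, ψ t g⁻¹ = ψ t g)
    (horth : ∀ s t, ∑ g, ψ s g * ψ t g = if s = t then (Nat.card G : ℤ) else 0)
    (σ : G)
    (hσ : (Nat.card {g | IsConj σ g} : ℤ) * ∑ t, ψ t σ ^ 2 = Nat.card G) :
    ∃ χ : T → G → ℂ, Function.Injective χ ∧ (∀ t, χ t ∈ irreducibleCharacters G) ∧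
      (∀ t, (∀ g, χ t g = ψ t g) ∨ ∀ g, χ t g = -ψ t g) ∧
      ∀ φ ∈ irreducibleCharacters G, φ σ ≠ 0 → ∃ t, φ = χ t := by
  classical
  have hG : (Nat.card G : ℤ) ≠ 0 := Nat.cast_ne_zero.2 Nat.card_pos.ne'
  have hex : ∀ t, ∃ χ ∈ irreducibleCharacters G, (∀ g, χ g = ψ t g) ∨ ∀ g, χ g = -ψ t g := by
    intro t
    obtain ⟨χ, hχ, h⟩ := exists_irreducibleCharacter_eq_or_eq_neg (hψ t) (by
      have := horth t t
      rw [if_pos rfl] at this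
      simp only [hinv]
      exact_mod_cast this)
    refine ⟨χ, hχ, h.imp (fun h g => ?_) fun h g => ?_⟩
    · exact (congrFun h g).symm
    · rw [congrFun h g, Pi.neg_apply, neg_neg]
  choose χ hχ hsign using hex
  refine ⟨χ, ?_, hχ, hsign, ?_⟩
  · intro s t hst
    by_contra hne
    have h1 := horth s t
    have h2 := horth t t
    rw [if_neg hne] at h1
    rw [if_pos rfl] at h2
    have hpm : (∀ g, ψ s g = ψ t g) ∨ ∀ g, ψ s g = -ψ t g := by
      rcases hsign s with hs | hs <;> rcases hsign t with ht | ht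
      · exact .inl fun g => by exact_mod_cast (hs g).symm.trans ((congrFun hst g).trans (ht g))
      · exact .inr fun g => by exact_mod_cast (hs g).symm.trans ((congrFun hst g).trans (ht g))
      · refine .inr fun g => ?_
        have := (hs g).symm.trans ((congrFun hst g).trans (ht g))
        have : -ψ s g = ψ t g := by exact_mod_cast this
        omega
      · refine .inl fun g => ?_
        have := (hs g).symm.trans ((congrFun hst g).trans (ht g))
        have : -ψ s g = -ψ t g := by exact_mod_cast this
        omega
    rcases hpm with h | h <;> simp only [h, neg_mul, Finset.sum_neg_distrib, h2] at h1 <;> omega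
  · intro φ hφ hφσ
    by_contra! hne
    have hclass : ∀ χ ∈ irreducibleCharacters G, ∀ g, IsConj σ g → χ g = χ σ := by
      rintro _ ⟨V, -, rfl⟩ g hg
      obtain ⟨c, rfl⟩ := isConj_iff.1 hg
      exact V.char_conj σ c
    have hψclass : ∀ t g, IsConj σ g → ψ t g = ψ t σ := by
      intro t g hg
      have := hclass _ (hχ t) g hg
      rcases hsign t with h | h <;> rw [h, h] at this
      · exact_mod_cast this
      · exact_mod_cast neg_injective this
    have hind : ∀ f : G → ℤ, (∀ g, IsConj σ g → f g = f σ) →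
        ∑ g, (if IsConj σ g then f g else 0) = Nat.card {g | IsConj σ g} * f σ := by
      intro f hf
      rw [← Finset.sum_filter, Finset.sum_congr rfl fun g hg => hf g (Finset.mem_filter.1 hg).2,
        Finset.sum_const, nsmul_eq_mul, Nat.card_eq_fintype_card, Fintype.card_subtype]
      rfl
    set z : ℤ := ∑ t, ψ t σ ^ 2 with hz
    set k : ℤ := (Nat.card {g | IsConj σ g} : ℤ) with hk
    have hF : ∀ g, (if IsConj σ g then z else 0) = ∑ t, ψ t σ * ψ t g := by
      have h1 : ∑ g, (if IsConj σ g then z else 0) * (if IsConj σ g then z else 0) =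
          k * (z * z) := by
        rw [← hind (fun _ => z * z) fun _ _ => rfl]
        refine Finset.sum_congr rfl fun g _ => ?_
        split_ifs <;> simp
      have h2 : ∑ g, (if IsConj σ g then z else 0) * ∑ t, ψ t σ * ψ t g = k * (z * z) := by
        have hσz : ∑ t, ψ t σ * ψ t σ = z := Finset.sum_congr rfl fun t _ => (pow_two _).symm
        have := hind (fun g => z * ∑ t, ψ t σ * ψ t g) fun g hg => by
          simp only [fun t => hψclass t g hg]
        simp only [hσz] at this
        rw [← this]
        exact Finset.sum_congr rfl fun g _ => by rw [ite_mul, zero_mul]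
      have h3 : ∑ g, (∑ t, ψ t σ * ψ t g) * ∑ t, ψ t σ * ψ t g = k * (z * z) := by
        have : ∀ s, ∑ g, ψ s σ * ψ s g * ∑ t, ψ t σ * ψ t g = Nat.card G * ψ s σ ^ 2 := by
          intro s
          have : ∀ g t, ψ s σ * ψ s g * (ψ t σ * ψ t g) = ψ s σ * ψ t σ * (ψ s g * ψ t g) :=
            fun g t => mul_mul_mul_comm _ _ _ _
          simp only [Finset.mul_sum, this]
          rw [Finset.sum_comm]
          simp only [← Finset.mul_sum, horth, mul_ite, mul_zero, Finset.sum_ite_eq,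
            Finset.mem_univ, if_true]
          ring
        simp only [Finset.sum_mul]
        rw [Finset.sum_comm, Finset.sum_congr rfl fun s _ => this s, ← Finset.mul_sum, ← hz, ← hσ,
          mul_assoc]
      have h4 : ∑ g, ((if IsConj σ g then z else 0) - ∑ t, ψ t σ * ψ t g) ^ 2 = 0 := by
        simp only [sub_sq, Finset.sum_add_distrib, Finset.sum_sub_distrib]
        simp only [pow_two, mul_assoc, ← Finset.mul_sum, h1, h2, h3]
        ring
      rw [Finset.sum_eq_zero_iff_of_nonneg fun g _ => sq_nonneg _] at h4
      exact fun g => sub_eq_zero.1 (pow_eq_zero_iff two_ne_zero |>.1 (h4 g (Finset.mem_univ g)))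
    have hzero : ∀ t, ∑ g, (ψ t g : ℂ) * φ g = 0 := by
      intro t
      have h := sum_irreducibleCharacters_mul hφ (hχ t)
      rw [if_neg (hne t)] at h
      rcases hsign t with ht | ht <;> simp only [ht, hinv, mul_neg, Finset.sum_neg_distrib,
        neg_eq_zero] at h <;> simpa only [mul_comm] using h
    have h1 : ∑ g, ((if IsConj σ g then z else 0 : ℤ) : ℂ) * φ g = k * z * φ σ := by
      have : ∀ g, ((if IsConj σ g then z else 0 : ℤ) : ℂ) * φ g =
          if IsConj σ g then z * φ σ else 0 := by
        intro g
        split_ifs with hg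
        · rw [hclass φ hφ g hg]
        · simp
      simp only [this]
      rw [← Finset.sum_filter, Finset.sum_const, nsmul_eq_mul, hk, Nat.card_eq_fintype_card,
        Fintype.card_subtype]
      push_cast
      rw [mul_assoc]
      rfl
    have h2 : ∑ g, ((if IsConj σ g then z else 0 : ℤ) : ℂ) * φ g = 0 := by
      simp only [hF]
      push_cast
      simp only [Finset.sum_mul, mul_assoc]
      rw [Finset.sum_comm]
      simp only [← Finset.mul_sum, hzero, mul_zero, Finset.sum_const_zero]
    rw [h1, ← Int.cast_mul, hσ] at h2
    exact (mul_ne_zero (by exact_mod_cast hG) hφσ) h2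

theorem card_fixed_mem_closure_irreducibleCharacters {G X : Type} [Group G] [Fintype G] [Fintype X]
    [DecidableEq X] (ρ : G →* Equiv.Perm X) :
    (fun g => (#{x | ρ g x = x} : ℂ)) ∈ AddSubgroup.closure (irreducibleCharacters G) := by
  let R : Representation ℂ G (X → ℂ) :=
    { toFun := fun g => LinearMap.funLeft ℂ ℂ (ρ g⁻¹)
      map_one' := by ext; simp [LinearMap.funLeft_apply]
      map_mul' := fun g h => by ext; simp [LinearMap.funLeft_apply] }
  have hR : (fun g => (#{x | ρ g x = x} : ℂ)) = R.character := by
    funext g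
    rw [Representation.character, LinearMap.trace_eq_matrix_trace ℂ (Pi.basisFun ℂ X),
      Matrix.trace, Finset.card_filter, Nat.cast_sum]
    refine Finset.sum_congr rfl fun x _ => ?_
    have : (ρ g).symm x = x ↔ ρ g x = x := by rw [Equiv.symm_apply_eq, eq_comm]
    simp [R, LinearMap.funLeft_apply, Pi.single_apply, this]
  rw [hR]
  exact Representation.character_mem_closure_irreducibleCharacters R

open MvPolynomial in
theorem coeff_invariantColouringSum {ι κ : Type*} [Fintype ι] [DecidableEq ι] [Fintype κ]
    [DecidableEq κ] (g : Equiv.Perm ι) (l : κ →₀ ℕ) :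
    coeff l (invariantColouringSum X g : MvPolynomial κ ℤ) =
      #{f : {f : ι → κ // colourCount f = l} | ∀ m, f.1 (g m) = f.1 m} := by
  have hmon : ∀ f : ι → κ, (∏ m, X (f m) : MvPolynomial κ ℤ) = monomial (colourCount f) 1 := by
    intro f
    rw [prod_comp_eq_prod_pow_colourCount, monomial_eq, Finsupp.prod_fintype _ _ (by simp), C_1,
      one_mul]
  simp only [invariantColouringSum, hmon, coeff_sum, coeff_monomial]
  rw [← Finset.sum_filter, Finset.sum_const, nsmul_one, Finset.filter_filter]
  congr 1
  rw [← Finset.card_map (Function.Embedding.subtype _)]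
  congr 1
  ext f
  simp [and_comm]

theorem coeff_invariantColouringSum_mem_closure {ι κ : Type} [Fintype ι] [DecidableEq ι]
    [Fintype κ] [DecidableEq κ] (l : κ →₀ ℕ) :
    (fun g : Equiv.Perm ι =>
      ((MvPolynomial.coeff l (invariantColouringSum MvPolynomial.X g) : ℤ) : ℂ)) ∈
      AddSubgroup.closure (irreducibleCharacters (Equiv.Perm ι)) := by
  let ρ : Equiv.Perm ι →* Equiv.Perm {f : ι → κ // colourCount f = l} :=
    { toFun := fun g => (Equiv.arrowCongr g (Equiv.refl κ)).subtypeEquiv fun f => by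
        have : Equiv.arrowCongr g (Equiv.refl κ) f = f ∘ (g⁻¹ : Equiv.Perm ι) := rfl
        rw [this, colourCount_comp_perm]
      map_one' := rfl
      map_mul' := fun _ _ => rfl }
  convert card_fixed_mem_closure_irreducibleCharacters ρ using 2 with g
  rw [coeff_invariantColouringSum, Int.cast_natCast]
  congr 2
  ext f
  simp only [Finset.mem_filter, Finset.mem_univ, true_and]
  rw [Subtype.ext_iff, funext_iff]
  have hρ : ∀ m, (ρ g f).1 m = f.1 (g⁻¹ m) := fun _ => rfl
  refine ⟨fun h m => ?_, fun h m => ?_⟩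
  · rw [hρ, ← h]
    exact congrArg f.1 (g.apply_symm_apply m)
  · rw [← h, hρ]
    exact congrArg f.1 (g.symm_apply_apply m)

theorem det_vandermonde_X_eq_sum {N : ℕ} :
    (Matrix.vandermonde (MvPolynomial.X (R := ℤ) (σ := Fin N))).det =
      ∑ w : Equiv.Perm (Fin N), MvPolynomial.monomial
        (Finsupp.equivFunOnFinite.symm fun i => (w i : ℕ)) (Equiv.Perm.sign w : ℤ) := by
  rw [← Matrix.det_transpose, Matrix.det_apply']
  refine Finset.sum_congr rfl fun w _ => ?_
  simp only [Matrix.transpose_apply, Matrix.vandermonde_apply]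
  rw [MvPolynomial.monomial_eq, Finsupp.prod_fintype _ _ (by simp)]
  simp

theorem frobeniusCoeff_mem_closure {ι : Type} [Fintype ι] [DecidableEq ι] {N : ℕ}
    (β : Fin N →₀ ℕ) :
    (fun g : Equiv.Perm ι => (frobeniusCoeff β g : ℂ)) ∈
      AddSubgroup.closure (irreducibleCharacters (Equiv.Perm ι)) := by
  have : (fun g : Equiv.Perm ι => (frobeniusCoeff β g : ℂ)) =
      ∑ w : Equiv.Perm (Fin N), fun g => (((MvPolynomial.monomial
        (Finsupp.equivFunOnFinite.symm fun i => (w i : ℕ)) (Equiv.Perm.sign w : ℤ) *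
          invariantColouringSum MvPolynomial.X g).coeff β : ℤ) : ℂ) := by
    funext g
    rw [frobeniusCoeff, det_vandermonde_X_eq_sum, Finset.sum_mul, MvPolynomial.coeff_sum,
      Int.cast_sum, Finset.sum_apply]
  rw [this]
  refine AddSubgroup.sum_mem _ fun w _ => ?_
  simp only [MvPolynomial.coeff_monomial_mul']
  split_ifs
  · convert AddSubgroup.zsmul_mem _ (coeff_invariantColouringSum_mem_closure _)
      (Equiv.Perm.sign w : ℤ) using 1
    funext g
    rw [Pi.smul_apply, zsmul_eq_mul, ← Int.cast_mul]
  · simp only [Int.cast_zero]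
    exact AddSubgroup.zero_mem _

theorem List.Nodup.apply_eq_of_formPerm_invariant {ι κ : Type*} [DecidableEq ι] {l : List ι}
    (hl : l.Nodup) {f : ι → κ} (hf : ∀ m ∈ l, f (l.formPerm m) = f m) {x y : ι} (hx : x ∈ l)
    (hy : y ∈ l) : f x = f y := by
  have hcycle := hl.isCycleOn_formPerm
  obtain ⟨i, rfl⟩ := Equiv.Perm.IsCycleOn.exists_pow_eq (s := l.toFinset) (by simpa using hcycle)
    (List.mem_toFinset.2 hx) (List.mem_toFinset.2 hy) |>.imp fun _ h => h.2
  induction i with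
  | zero => rfl
  | succ i ih =>
    have hi : (l.formPerm ^ i) x ∈ l := by
      clear ih hy
      induction i with
      | zero => exact hx
      | succ i ih =>
        rw [pow_succ', Equiv.Perm.mul_apply]
        exact List.formPerm_mem_iff_mem.2 ih
    rw [ih hi, pow_succ', Equiv.Perm.mul_apply, hf _ hi]

theorem invariantColouringSum_formPerm_mul_formPerm {ι κ A : Type*} [Fintype ι] [DecidableEq ι]
    [Fintype κ] [DecidableEq κ] [CommRing A] (z : κ → A) {l₁ l₂ : List ι} (hl : (l₁ ++ l₂).Nodup)
    (huniv : ∀ m, m ∈ l₁ ++ l₂) (h₁ : l₁ ≠ []) (h₂ : l₂ ≠ []) :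
    invariantColouringSum z (l₁.formPerm * l₂.formPerm) =
      (∑ k, z k ^ l₁.length) * ∑ k, z k ^ l₂.length := by
  obtain ⟨x₁, hx₁⟩ := List.exists_mem_of_ne_nil l₁ h₁
  obtain ⟨x₂, hx₂⟩ := List.exists_mem_of_ne_nil l₂ h₂
  obtain ⟨hn₁, hn₂, hdisj⟩ := List.nodup_append'.1 hl
  have hmem₂ : ∀ m, m ∈ l₂ ↔ m ∉ l₁ := fun m =>
    ⟨fun h h' => hdisj h' h, (List.mem_append.1 (huniv m)).resolve_left⟩
  have happly₁ : ∀ m ∈ l₁, (l₁.formPerm * l₂.formPerm) m = l₁.formPerm m := fun m hm => by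
    rw [Equiv.Perm.mul_apply, List.formPerm_apply_of_notMem (fun h => (hmem₂ m).1 h hm)]
  have happly₂ : ∀ m ∉ l₁, (l₁.formPerm * l₂.formPerm) m = l₂.formPerm m := fun m hm => by
    rw [Equiv.Perm.mul_apply, List.formPerm_apply_of_notMem (l := l₁)]
    rwa [← hmem₂, List.formPerm_mem_iff_mem, hmem₂]
  have hinv₁ : ∀ f : ι → κ, (∀ m, f ((l₁.formPerm * l₂.formPerm) m) = f m) → ∀ m ∈ l₁,
      f m = f x₁ := fun f hf m hm =>
    hn₁.apply_eq_of_formPerm_invariant (fun k hk => by rw [← happly₁ k hk, hf]) hm hx₁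
  have hinv₂ : ∀ f : ι → κ, (∀ m, f ((l₁.formPerm * l₂.formPerm) m) = f m) → ∀ m ∉ l₁,
      f m = f x₂ := fun f hf m hm =>
    hn₂.apply_eq_of_formPerm_invariant
      (fun k hk => by rw [← happly₂ k ((hmem₂ k).1 hk), hf]) ((hmem₂ m).2 hm) hx₂
  rw [Finset.sum_mul_sum, ← Finset.sum_product', invariantColouringSum]
  refine Finset.sum_nbij' (fun f => (f x₁, f x₂)) (fun p m => if m ∈ l₁ then p.1 else p.2)
    (by simp) ?_ ?_ ?_ ?_
  · intro p _
    simp only [Finset.mem_filter, Finset.mem_univ, true_and]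
    intro m
    by_cases hm : m ∈ l₁
    · rw [happly₁ m hm, if_pos hm, if_pos (List.formPerm_mem_iff_mem.2 hm)]
    · rw [happly₂ m hm, if_neg hm, if_neg]
      rwa [← hmem₂, List.formPerm_mem_iff_mem, hmem₂]
  · intro f hf
    funext m
    split_ifs with hm
    · exact (hinv₁ f (Finset.mem_filter.1 hf).2 m hm).symm
    · exact (hinv₂ f (Finset.mem_filter.1 hf).2 m hm).symm
  · simp [hx₁, (hmem₂ x₂).1 hx₂]
  · intro f hf
    have huniv' : (univ : Finset ι) = l₁.toFinset ∪ l₂.toFinset := by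
      ext m
      simpa using huniv m
    rw [huniv', Finset.prod_union (List.disjoint_toFinset_iff_disjoint.2 hdisj),
      Finset.prod_congr rfl fun m hm =>
        by rw [hinv₁ f (Finset.mem_filter.1 hf).2 m (List.mem_toFinset.1 hm)],
      Finset.prod_congr (s₁ := l₂.toFinset) rfl fun m hm =>
        by rw [hinv₂ f (Finset.mem_filter.1 hf).2 m ((hmem₂ m).1 (List.mem_toFinset.1 hm))],
      Finset.prod_const, Finset.prod_const, List.toFinset_card_of_nodup hn₁,
      List.toFinset_card_of_nodup hn₂]

theorem card_isConj_formPerm_mul_formPerm {ι : Type*} [Fintype ι] [DecidableEq ι] {l₁ l₂ : List ι}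
    (hl : (l₁ ++ l₂).Nodup) (huniv : ∀ m, m ∈ l₁ ++ l₂) (h₁ : 2 ≤ l₁.length) (h₂ : 2 ≤ l₂.length)
    (hne : l₁.length ≠ l₂.length) :
    Nat.card {g | IsConj (l₁.formPerm * l₂.formPerm) g} * (l₁.length * l₂.length) =
      (Fintype.card ι).factorial := by
  obtain ⟨hn₁, hn₂, hdisj⟩ := List.nodup_append'.1 hl
  have hι : l₁.length + l₂.length = Fintype.card ι := by
    rw [← List.length_append, ← List.toFinset_card_of_nodup hl, Finset.card_eq_iff_eq_univ]
    ext m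
    simpa using huniv m
  have hcycle : (l₁.formPerm * l₂.formPerm).cycleType = {l₁.length, l₂.length} := by
    rw [((List.formPerm_disjoint_iff hn₁ hn₂ h₁ h₂).2 hdisj).cycleType_mul,
      (List.isCycle_formPerm hn₁ h₁).cycleType, (List.isCycle_formPerm hn₂ h₂).cycleType,
      List.support_formPerm_of_nodup l₁ hn₁ (by rintro x rfl; simp at h₁),
      List.support_formPerm_of_nodup l₂ hn₂ (by rintro x rfl; simp at h₂),
      List.toFinset_card_of_nodup hn₁, List.toFinset_card_of_nodup hn₂]
    rfl
  rw [← Equiv.Perm.card_isConj_mul_eq (l₁.formPerm * l₂.formPerm), hcycle]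
  simp [hι, hne]

/-- The sign of the permutation `γ` of `{0, …, N - 1}`, or `0` if `γ` is not a permutation. -/
def signOfFun {N : ℕ} (γ : Fin N → ℤ) : ℤ :=
  ∑ w : Equiv.Perm (Fin N), if ∀ m, ((w m : ℕ) : ℤ) = γ m then (Equiv.Perm.sign w : ℤ) else 0

theorem signOfFun_eq_zero_of_le {N : ℕ} {γ : Fin N → ℤ} {m : Fin N} (hm : (N : ℤ) ≤ γ m) :
    signOfFun γ = 0 := by
  refine Finset.sum_eq_zero fun w _ => if_neg fun h => ?_
  have := h m
  have := (w m).2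
  omega

theorem signOfFun_id {N : ℕ} {γ : Fin N → ℤ} (hγ : ∀ m : Fin N, γ m = (m : ℕ)) :
    signOfFun γ = 1 := by
  rw [signOfFun, Finset.sum_eq_single 1]
  · simp [hγ]
  · refine fun w _ hw => if_neg fun h => hw ?_
    ext m
    have := h m
    rw [hγ] at this
    exact_mod_cast this
  · simp

theorem signOfFun_of_eq_off_pair {N : ℕ} {γ : Fin N → ℤ} {x y : Fin N} (hxy : x ≠ y)
    (hγ : ∀ m, m ≠ x → m ≠ y → γ m = (m : ℕ)) (hsum : γ x + γ y = (x : ℕ) + (y : ℕ)) :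
    signOfFun γ = (if γ x = (x : ℕ) then 1 else 0) - if γ x = (y : ℕ) then 1 else 0 := by
  have hxy' : (x : ℕ) ≠ y := Fin.val_ne_of_ne hxy
  by_cases h1 : γ x = (x : ℕ)
  · rw [signOfFun_id, if_pos h1, if_neg (by omega), sub_zero]
    intro m
    by_cases hx : m = x
    · rw [hx, h1]
    by_cases hy : m = y
    · rw [hy]; omega
    exact hγ m hx hy
  rw [if_neg h1, zero_sub]
  have hw : ∀ w : Equiv.Perm (Fin N), (∀ m, ((w m : ℕ) : ℤ) = γ m) →
      γ x = (y : ℕ) ∧ w = Equiv.swap x y := by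
    intro w h
    have hfix : ∀ m, m ≠ x → m ≠ y → w m = m := fun m hx hy => by
      ext
      exact_mod_cast (h m).trans (hγ m hx hy)
    have hwx : w x = y := by
      by_contra hne
      by_cases hwx : w x = x
      · exact h1 (by rw [← h, hwx])
      · exact hwx (w.injective (hfix (w x) hwx hne))
    refine ⟨by rw [← h, hwx], ?_⟩
    ext1 m
    by_cases hx : m = x
    · rw [hx, hwx, Equiv.swap_apply_left]
    by_cases hy : m = y
    · rw [hy, Equiv.swap_apply_right]
      ext
      have h1 := h x
      have h2 := h y
      rw [hwx] at h1
      omega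
    rw [hfix m hx hy, Equiv.swap_apply_of_ne_of_ne hx hy]
  split_ifs with h2
  · rw [signOfFun, Finset.sum_eq_single (Equiv.swap x y)]
    · rw [if_pos, Equiv.Perm.sign_swap hxy]
      · simp
      · intro m
        by_cases hx : m = x
        · rw [hx, h2, Equiv.swap_apply_left]
        by_cases hy : m = y
        · rw [hy, Equiv.swap_apply_right]; omega
        rw [hγ m hx hy, Equiv.swap_apply_of_ne_of_ne hx hy]
    · exact fun w _ hne => if_neg fun h => hne (hw w h).2
    · simp
  · rw [neg_zero]
    exact Finset.sum_eq_zero fun w _ => if_neg fun h => h2 (hw w h).1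

theorem frobeniusCoeff_formPerm_mul_formPerm {ι : Type*} [Fintype ι] [DecidableEq ι] {N : ℕ}
    (β : Fin N →₀ ℕ) {l₁ l₂ : List ι} (hl : (l₁ ++ l₂).Nodup) (huniv : ∀ m, m ∈ l₁ ++ l₂)
    (h₁ : l₁ ≠ []) (h₂ : l₂ ≠ []) :
    frobeniusCoeff β (l₁.formPerm * l₂.formPerm) = ∑ k, ∑ l, signOfFun fun m =>
      β m - (if m = k then (l₁.length : ℤ) else 0) - if m = l then (l₂.length : ℤ) else 0 := by
  have hpow : ∀ c : ℕ, ∀ k : Fin N, (MvPolynomial.X k ^ c : MvPolynomial (Fin N) ℤ) =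
      MvPolynomial.monomial (Finsupp.single k c) 1 := fun c k => MvPolynomial.X_pow_eq_monomial
  rw [frobeniusCoeff, det_vandermonde_X_eq_sum,
    invariantColouringSum_formPerm_mul_formPerm _ hl huniv h₁ h₂]
  rw [Finset.sum_mul_sum]
  simp only [hpow, Finset.mul_sum, MvPolynomial.monomial_mul, MvPolynomial.coeff_sum,
    Finset.sum_mul, mul_one, MvPolynomial.coeff_monomial]
  refine Finset.sum_congr rfl fun k _ => Finset.sum_congr rfl fun l _ =>
    Finset.sum_congr rfl fun w _ => ?_
  congr 1
  rw [Finsupp.ext_iff]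
  refine propext (forall_congr' fun m => ?_)
  simp only [Finsupp.add_apply, Finsupp.equivFunOnFinite_symm_apply_apply, Finsupp.single_apply,
    eq_comm (b := m)]
  split_ifs <;> omega

/-- The exponent obtained from `(0, 1, …, n - 1)` by adding `p` to the `i`-th and `q` to the `j`-th
entry. -/
noncomputable def shiftedExponent {n : ℕ} (p q : ℕ) (i j : Fin n) : Fin n →₀ ℕ :=
  Finsupp.equivFunOnFinite.symm fun m =>
    (m : ℕ) + (if m = i then p else 0) + if m = j then q else 0

section shiftedExponent

variable {n p q : ℕ} {i j : Fin n}

theorem shiftedExponent_apply (m : Fin n) : shiftedExponent p q i j m =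
    (m : ℕ) + (if m = i then p else 0) + if m = j then q else 0 := rfl

theorem sum_shiftedExponent (p q : ℕ) (i j : Fin n) :
    ∑ m, shiftedExponent p q i j m = p + q + ∑ m : Fin n, (m : ℕ) := by
  simp only [shiftedExponent_apply, Finset.sum_add_distrib, Finset.sum_ite_eq', Finset.mem_univ,
    if_true]
  ring

theorem shiftedExponent_injective (hpq : p + q = n)
    (h : i = j ∨ n ≤ i + p ∧ n ≤ j + q ∧ (i : ℕ) + p ≠ j + q) :
    Function.Injective (shiftedExponent p q i j) := by
  intro x y hxy
  simp only [shiftedExponent_apply, Fin.ext_iff] at hxy h ⊢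
  have := x.2
  have := y.2
  split_ifs at hxy <;> omega

theorem sum_sign_shiftedExponent_self (hpq : p + q = n)
    (h : i = j ∨ n ≤ i + p ∧ n ≤ j + q ∧ (i : ℕ) + p ≠ j + q) :
    ∑ w : Equiv.Perm (Fin n), (if ∀ m, shiftedExponent p q i j (w m) = shiftedExponent p q i j m
      then (Equiv.Perm.sign w : ℤ) else 0) = 1 := by
  rw [Finset.sum_eq_single 1]
  · simp
  · exact fun w _ hw => if_neg fun hw' => hw <| Equiv.ext fun m =>
      shiftedExponent_injective hpq h (hw' m)
  · simp

theorem eq_of_shiftedExponent_comp_eq (hpq : p + q = n) (hne : p ≠ q) (hp : 0 < p) (hq : 0 < q)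
    {i' j' : Fin n} (h : i = j ∨ n ≤ i + p ∧ n ≤ j + q) (h' : i' = j' ∨ n ≤ i' + p ∧ n ≤ j' + q)
    {w : Equiv.Perm (Fin n)}
    (hw : ∀ m, shiftedExponent p q i' j' (w m) = shiftedExponent p q i j m) :
    i = i' ∧ j = j' := by
  have hw' : ∀ m, shiftedExponent p q i j (w.symm m) = shiftedExponent p q i' j' m := fun m => by
    rw [← hw, Equiv.apply_symm_apply]
  have hmissing : ∀ {i j i' j' : Fin n} {w : Equiv.Perm (Fin n)},
      (i = j ∨ n ≤ i + p ∧ n ≤ j + q) →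
      (∀ m, shiftedExponent p q i' j' (w m) = shiftedExponent p q i j m) →
      (i = i' ∨ i = j') ∧ (j = i' ∨ j = j') := by
    intro i j i' j' w h hw
    have key : ∀ x : Fin n, (x = i ∨ x = j) → x = i' ∨ x = j' := by
      intro x hx
      by_contra! hx'
      have h1 := hw (w.symm x)
      rw [Equiv.apply_symm_apply] at h1
      simp only [shiftedExponent_apply, Fin.ext_iff] at h1 hx h
      have := (w.symm x).2
      have := x.2
      split_ifs at h1 <;> omega
    exact ⟨key i (.inl rfl), key j (.inr rfl)⟩
  have h1 := hmissing h hw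
  have h2 := hmissing h' hw'
  by_contra hcon
  have hi : i = j' ∧ j = i' ∧ i ≠ j := by grind
  obtain ⟨rfl, rfl, hij⟩ := hi
  have h3 := hw i
  have h4 := w.injective.ne hij
  have h5 := hw j
  simp only [shiftedExponent_apply, if_true, Fin.ext_iff] at h3 h5 h h'
  have := (w i).2
  have := (w j).2
  have := Fin.val_ne_of_ne hij
  split_ifs at h3 h5 <;> omega

theorem sum_sign_shiftedExponent_of_ne (hpq : p + q = n) (hne : p ≠ q) (hp : 0 < p) (hq : 0 < q)
    {i' j' : Fin n} (h : i = j ∨ n ≤ i + p ∧ n ≤ j + q) (h' : i' = j' ∨ n ≤ i' + p ∧ n ≤ j' + q)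
    (hij : ¬(i = i' ∧ j = j')) :
    ∑ w : Equiv.Perm (Fin n),
      (if ∀ m, shiftedExponent p q i' j' (w m) = shiftedExponent p q i j m
        then (Equiv.Perm.sign w : ℤ) else 0) = 0 :=
  Finset.sum_eq_zero fun _ _ => if_neg fun hw =>
    hij (eq_of_shiftedExponent_comp_eq hpq hne hp hq h h' hw)

theorem sum_signOfFun_shiftedExponent_of_ne (hpq : p + q = n) {a b : ℕ} (hab : a + b = n)
    (hne : i ≠ j) (hi : n ≤ i + p) (hj : n ≤ j + q) :
    (∑ k, ∑ l, signOfFun fun m => shiftedExponent p q i j m - (if m = k then (a : ℤ) else 0) -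
      if m = l then (b : ℤ) else 0) =
      (if p = a then 1 else 0) + (if p = b then 1 else 0) - (if (i : ℕ) + p = j + a then 1 else 0) -
        if (i : ℕ) + p = j + b then 1 else 0 := by
  have hne' := Fin.val_ne_of_ne hne
  have hterm : ∀ k l : Fin n, (signOfFun fun m => shiftedExponent p q i j m -
      (if m = k then (a : ℤ) else 0) - if m = l then (b : ℤ) else 0) =
      (if l = j then if k = i then
        (if p = a then 1 else 0) - (if (i : ℕ) + p = j + a then 1 else 0) else 0 else 0) +
      if l = i then if k = j then
        (if p = b then 1 else 0) - (if (i : ℕ) + p = j + b then 1 else 0) else 0 else 0 := by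
    intro k l
    by_cases hikl : k ≠ i ∧ l ≠ i
    · rw [signOfFun_eq_zero_of_le (m := i)]
      · simp [hikl]
      · simp [shiftedExponent_apply, hikl.1.symm, hikl.2.symm, hne]
        omega
    by_cases hjkl : k ≠ j ∧ l ≠ j
    · rw [signOfFun_eq_zero_of_le (m := j)]
      · simp [hjkl]
      · simp [shiftedExponent_apply, hjkl.1.symm, hjkl.2.symm, hne.symm]
        omega
    have hkl : (k = i ∧ l = j) ∨ (k = j ∧ l = i) := by grind
    rcases hkl with ⟨rfl, rfl⟩ | ⟨rfl, rfl⟩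
    · rw [signOfFun_of_eq_off_pair hne]
      · simp only [shiftedExponent_apply, if_true, if_neg hne, if_neg hne.symm]
        split_ifs <;> omega
      · intro m h1 h2
        simp [shiftedExponent_apply, h1, h2]
      · simp only [shiftedExponent_apply, if_true, if_neg hne, if_neg hne.symm]
        omega
    · rw [signOfFun_of_eq_off_pair hne.symm]
      · simp only [shiftedExponent_apply, if_true, if_neg hne, if_neg hne.symm]
        split_ifs <;> omega
      · intro m h1 h2
        simp [shiftedExponent_apply, h1, h2]
      · simp only [shiftedExponent_apply, if_true, if_neg hne, if_neg hne.symm]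
        omega
  simp only [hterm, Finset.sum_add_distrib, Finset.sum_ite_eq', Finset.mem_univ, if_true]
  ring

theorem sum_signOfFun_shiftedExponent_self (hpq : p + q = n) {a b : ℕ} (hab : a + b = n)
    (ha : 0 < a) (hb : 0 < b) :
    (∑ k, ∑ l, signOfFun fun m => shiftedExponent p q i i m - (if m = k then (a : ℤ) else 0) -
      if m = l then (b : ℤ) else 0) =
      1 - (if (i : ℕ) + a < n then 1 else 0) - if (i : ℕ) + b < n then 1 else 0 := by
  have hterm : ∀ k l : Fin n, (signOfFun fun m => shiftedExponent p q i i m -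
      (if m = k then (a : ℤ) else 0) - if m = l then (b : ℤ) else 0) =
      (if l = i then if k = i then 1 else 0 else 0) -
      (if l = i then if (i : ℕ) + a = k then 1 else 0 else 0) -
        if (i : ℕ) + b = l then if k = i then 1 else 0 else 0 := by
    intro k l
    by_cases hk : k = i
    · by_cases hl : l = i
      · subst hk
        subst hl
        rw [signOfFun_id]
        · simp [ha.ne', hb.ne']
        · intro m
          rw [shiftedExponent_apply]
          split_ifs <;> omega
      · subst hk
        rw [signOfFun_of_eq_off_pair (x := k) (y := l) (Ne.symm hl)]
        · simp only [shiftedExponent_apply, if_true, if_neg hl, if_neg (Ne.symm hl)]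
          split_ifs <;> omega
        · intro m h1 h2
          simp [shiftedExponent_apply, h1, h2]
        · simp only [shiftedExponent_apply, if_true, if_neg hl, if_neg (Ne.symm hl)]
          omega
    · by_cases hl : l = i
      · subst hl
        rw [signOfFun_of_eq_off_pair (x := l) (y := k) (Ne.symm hk)]
        · simp only [shiftedExponent_apply, if_true, if_neg hk, if_neg (Ne.symm hk)]
          split_ifs <;> omega
        · intro m h1 h2
          simp [shiftedExponent_apply, h1, h2]
        · simp only [shiftedExponent_apply, if_true, if_neg hk, if_neg (Ne.symm hk)]
          omega
      · rw [signOfFun_eq_zero_of_le (m := i)]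
        · simp [hk, hl]
        · simp [shiftedExponent_apply, Ne.symm hk, Ne.symm hl]
          omega
  have hval : ∀ c : ℕ, (∑ k : Fin n, if c = (k : ℕ) then (1 : ℤ) else 0) =
      if c < n then 1 else 0 := by
    intro c
    split_ifs with hc
    · rw [Finset.sum_eq_single ⟨c, hc⟩]
      · simp
      · exact fun k _ hk => if_neg fun h => hk (Fin.ext h.symm)
      · simp
    · exact Finset.sum_eq_zero fun k _ => if_neg fun h : c = k => hc (h ▸ k.2)
  simp only [hterm, Finset.sum_sub_distrib, Finset.sum_ite_eq', Finset.mem_univ, if_true, hval]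
  rw [Finset.sum_comm (f := fun k l : Fin n =>
    if (i : ℕ) + b = l then if k = i then (1 : ℤ) else 0 else 0)]
  congr 1
  rw [← hval]
  refine Finset.sum_congr rfl fun l _ => ?_
  split_ifs <;> simp

end shiftedExponent

section twoCycles

variable {n : ℕ}

theorem frobeniusCoeff_take_mul_drop (β : Fin n →₀ ℕ) {a : ℕ} (ha : 0 < a) (han : a < n) :
    frobeniusCoeff β (((List.finRange n).take a).formPerm * ((List.finRange n).drop a).formPerm) =
      ∑ k, ∑ l, signOfFun fun m =>
        β m - (if m = k then (a : ℤ) else 0) - if m = l then ((n - a : ℕ) : ℤ) else 0 := by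
  have h₁ : ((List.finRange n).take a).length = a := by simp [han.le]
  have h₂ : ((List.finRange n).drop a).length = n - a := by simp
  rw [frobeniusCoeff_formPerm_mul_formPerm, h₁, h₂]
  · rw [List.take_append_drop]
    exact List.nodup_finRange n
  · rw [List.take_append_drop]
    exact List.mem_finRange
  · exact List.ne_nil_of_length_pos (by omega)
  · exact List.ne_nil_of_length_pos (by omega)

theorem card_isConj_take_mul_drop {a : ℕ} (ha : 2 ≤ a) (han : a + 2 ≤ n) (hne : a ≠ n - a) :
    Nat.card {g | IsConj
      (((List.finRange n).take a).formPerm * ((List.finRange n).drop a).formPerm) g} *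
        (a * (n - a)) = n.factorial := by
  have h₁ : ((List.finRange n).take a).length = a := by simp; omega
  have h₂ : ((List.finRange n).drop a).length = n - a := by simp
  have h := card_isConj_formPerm_mul_formPerm (l₁ := (List.finRange n).take a)
    (l₂ := (List.finRange n).drop a) (by
      rw [List.take_append_drop]
      exact List.nodup_finRange n) (by
      rw [List.take_append_drop]
      exact List.mem_finRange) (by omega) (by omega) (by omega)
  rwa [h₁, h₂, Fintype.card_fin] at h

/-- Exponents whose Frobenius coefficients are, up to sign, the irreducible characters of `S_n` not
vanishing on the product of a 3-cycle and a disjoint `(n - 3)`-cycle. -/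
noncomputable def nonvanishingExponent (hn : 10 ≤ n) (t : Fin 3 × Fin (n - 3)) : Fin n →₀ ℕ :=
  shiftedExponent 3 (n - 3)
    ⟨if (t.2 : ℕ) = 0 then t.1 else n - 3 + t.1, by split_ifs <;> omega⟩
    ⟨if (t.2 : ℕ) = 0 then t.1 else if (t.2 : ℕ) ≤ t.1 then t.2 + 2 else t.2 + 3, by
      split_ifs <;> omega⟩

theorem sum_frobeniusCoeff_nonvanishingExponent (hn : 10 ≤ n) (s t : Fin 3 × Fin (n - 3)) :
    ∑ g : Equiv.Perm (Fin n), frobeniusCoeff (nonvanishingExponent hn s) g *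
      frobeniusCoeff (nonvanishingExponent hn t) g = if s = t then (n.factorial : ℤ) else 0 := by
  have hpq : 3 + (n - 3) = n := by omega
  rw [sum_frobeniusCoeff_mul, Fintype.card_fin]
  · split_ifs with h
    · subst h
      unfold nonvanishingExponent
      rw [sum_sign_shiftedExponent_self hpq, mul_one]
      simp only [Fin.ext_iff]
      split_ifs <;> omega
    · unfold nonvanishingExponent
      rw [sum_sign_shiftedExponent_of_ne hpq (by omega) (by omega) (by omega), mul_zero]
      · simp only [Fin.ext_iff]
        split_ifs <;> omega
      · simp only [Fin.ext_iff]
        split_ifs <;> omega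
      · simp only [Fin.ext_iff, Prod.ext_iff] at h ⊢
        split_ifs <;> omega
  · rw [nonvanishingExponent, sum_shiftedExponent, Fintype.card_fin, hpq]

theorem frobeniusCoeff_nonvanishingExponent_three (hn : 10 ≤ n) (t : Fin 3 × Fin (n - 3)) :
    frobeniusCoeff (nonvanishingExponent hn t)
      (((List.finRange n).take 3).formPerm * ((List.finRange n).drop 3).formPerm) =
      if (t.2 : ℕ) = 0 then -1 else 1 := by
  obtain ⟨⟨r, hr⟩, ⟨s, hs⟩⟩ := t
  rw [frobeniusCoeff_take_mul_drop _ (by omega) (by omega), nonvanishingExponent]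
  by_cases h : s = 0 ∨ s = n - 6 + r
  · have hij : ∀ {i j : Fin n}, i = j → shiftedExponent 3 (n - 3) i j =
        shiftedExponent 3 (n - 3) i i := fun h => h ▸ rfl
    rw [hij (by simp only [Fin.ext_iff]; split_ifs <;> omega),
      sum_signOfFun_shiftedExponent_self (by omega) (by omega) (by omega) (by omega)]
    simp only
    split_ifs <;> omega
  · rw [sum_signOfFun_shiftedExponent_of_ne (by omega) (by omega)]
    · simp only
      split_ifs <;> omega
    all_goals
      simp only [ne_eq, Fin.ext_iff]
      split_ifs <;> omega

theorem frobeniusCoeff_nonvanishingExponent_four (hn : 10 ≤ n) (t : Fin 3 × Fin (n - 3)) :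
    frobeniusCoeff (nonvanishingExponent hn t)
      (((List.finRange n).take 4).formPerm * ((List.finRange n).drop 4).formPerm) =
      if (t.2 : ℕ) = 0 then -1 else if (t.2 : ℕ) = n - 6 + t.1 then 1 else
        if (t.2 : ℕ) = t.1 + 1 ∨ (t.2 : ℕ) = n - 7 + t.1 then -1 else 0 := by
  obtain ⟨⟨r, hr⟩, ⟨s, hs⟩⟩ := t
  rw [frobeniusCoeff_take_mul_drop _ (by omega) (by omega), nonvanishingExponent]
  by_cases h : s = 0 ∨ s = n - 6 + r
  · have hij : ∀ {i j : Fin n}, i = j → shiftedExponent 3 (n - 3) i j =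
        shiftedExponent 3 (n - 3) i i := fun h => h ▸ rfl
    rw [hij (by simp only [Fin.ext_iff]; split_ifs <;> omega),
      sum_signOfFun_shiftedExponent_self (by omega) (by omega) (by omega) (by omega)]
    simp only
    split_ifs <;> omega
  · rw [sum_signOfFun_shiftedExponent_of_ne (by omega) (by omega)]
    · simp only
      split_ifs <;> omega
    all_goals
      simp only [ne_eq, Fin.ext_iff]
      split_ifs <;> omega

end twoCycles

theorem card_nonvanishingExponent {n : ℕ} (hn : 10 ≤ n) :
    Nat.card {t : Fin 3 × Fin (n - 3) // (t.2 : ℕ) = 0 ∨ (t.2 : ℕ) = n - 6 + t.1 ∨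
      (t.2 : ℕ) = t.1 + 1 ∨ (t.2 : ℕ) = n - 7 + t.1} = 12 := by
  have hr : ∀ r : Fin 3, #{s : Fin (n - 3) | (s : ℕ) = 0 ∨ (s : ℕ) = n - 6 + r ∨
      (s : ℕ) = r + 1 ∨ (s : ℕ) = n - 7 + r} = 4 := by
    intro r
    have : ({s : Fin (n - 3) | (s : ℕ) = 0 ∨ (s : ℕ) = n - 6 + r ∨
        (s : ℕ) = r + 1 ∨ (s : ℕ) = n - 7 + r} : Finset (Fin (n - 3))) =
        {⟨0, by omega⟩, ⟨n - 6 + r, by omega⟩, ⟨r + 1, by omega⟩, ⟨n - 7 + r, by omega⟩} := by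
      ext s
      simp only [Finset.mem_filter, Finset.mem_univ, true_and, Finset.mem_insert,
        Finset.mem_singleton, Fin.ext_iff]
    rw [this, Finset.card_insert_of_notMem, Finset.card_insert_of_notMem,
      Finset.card_insert_of_notMem, Finset.card_singleton]
    all_goals
      simp only [Finset.mem_insert, Finset.mem_singleton, Fin.ext_iff]
      omega
  rw [Nat.card_eq_fintype_card, Fintype.card_subtype, Finset.card_filter, Fintype.sum_prod_type]
  simp only [← Finset.card_filter, hr]
  rfl

end Frobenius

/-- for `n ≥ 10`, with `σ₁` a product of a 3-cycle and a disjoint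
`(n-3)`-cycle and `σ₂` a product of a 4-cycle and a disjoint `(n-4)`-cycle,
there are exactly twelve irreducible complex characters `χ` of `S_n` with
`χ(σ₁)χ(σ₂) ≠ 0`, and for each of them `χ(σ₁)χ(σ₂) = ±1`. -/
theorem stmt_19 (n : ℕ) (hn : 10 ≤ n)
    (σ₁ σ₂ : Equiv.Perm (Fin n))
    (hσ₁ : σ₁ = ((List.finRange n).take 3).formPerm * ((List.finRange n).drop 3).formPerm)
    (hσ₂ : σ₂ = ((List.finRange n).take 4).formPerm * ((List.finRange n).drop 4).formPerm) :
    Nat.card {χ : Equiv.Perm (Fin n) → ℂ //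
      (∃ V : FDRep ℂ (Equiv.Perm (Fin n)), CategoryTheory.Simple V ∧ χ = FDRep.character V) ∧
      χ σ₁ * χ σ₂ ≠ 0} = 12 ∧
    ∀ χ : Equiv.Perm (Fin n) → ℂ,
      (∃ V : FDRep ℂ (Equiv.Perm (Fin n)), CategoryTheory.Simple V ∧ χ = FDRep.character V) →
      χ σ₁ * χ σ₂ ≠ 0 →
      χ σ₁ * χ σ₂ = 1 ∨ χ σ₁ * χ σ₂ = -1 := by
  obtain ⟨χ, hinj, hirr, hsign, hall⟩ := exists_irreducibleCharacters_of_orthogonal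
    (fun t => frobeniusCoeff (ι := Fin n) (nonvanishingExponent hn t))
    (fun t => frobeniusCoeff_mem_closure _) (fun t g => frobeniusCoeff_inv _ g)
    (fun s t => by
      rw [sum_frobeniusCoeff_nonvanishingExponent, Nat.card_eq_fintype_card, Fintype.card_perm,
        Fintype.card_fin])
    σ₁ (by
      have h : ∀ t, frobeniusCoeff (nonvanishingExponent hn t) σ₁ ^ 2 = 1 := fun t => by
        rw [hσ₁, frobeniusCoeff_nonvanishingExponent_three]
        split_ifs <;> norm_num
      simp only [h, Finset.sum_const, Finset.card_univ, Fintype.card_prod, Fintype.card_fin,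
        nsmul_one, Nat.card_perm, Nat.card_fin]
      rw [hσ₁, ← card_isConj_take_mul_drop (a := 3) (by omega) (by omega) (by omega)]
      push_cast
      rfl)
  have hprod : ∀ t, χ t σ₁ * χ t σ₂ = ((if (t.2 : ℕ) = 0 then 1 else
      if (t.2 : ℕ) = n - 6 + t.1 then 1 else
        if (t.2 : ℕ) = t.1 + 1 ∨ (t.2 : ℕ) = n - 7 + t.1 then -1 else 0 : ℤ) : ℂ) := by
    intro t
    have h : χ t σ₁ * χ t σ₂ = ((frobeniusCoeff (nonvanishingExponent hn t) σ₁ *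
        frobeniusCoeff (nonvanishingExponent hn t) σ₂ : ℤ) : ℂ) := by
      push_cast
      rcases hsign t with h | h <;> rw [h, h]
      exact neg_mul_neg _ _
    rw [h, hσ₁, hσ₂, frobeniusCoeff_nonvanishingExponent_three,
      frobeniusCoeff_nonvanishingExponent_four]
    congr 1
    split_ifs <;> rfl
  have hne : ∀ t, χ t σ₁ * χ t σ₂ ≠ 0 ↔ (t.2 : ℕ) = 0 ∨ (t.2 : ℕ) = n - 6 + t.1 ∨
      (t.2 : ℕ) = t.1 + 1 ∨ (t.2 : ℕ) = n - 7 + t.1 := by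
    intro t
    rw [hprod, Int.cast_ne_zero]
    split_ifs <;> simp_all
  refine ⟨?_, fun φ hφ hφ' => ?_⟩
  · rw [← card_nonvanishingExponent hn]
    refine (Nat.card_congr (Equiv.ofBijective
      (fun t => ⟨χ t.1, hirr t.1, (hne t.1).2 t.2⟩) ⟨?_, ?_⟩)).symm
    · exact fun s t h => Subtype.ext (hinj (congrArg Subtype.val h))
    · rintro ⟨φ, hφ, hφ'⟩
      obtain ⟨t, rfl⟩ := hall φ hφ (left_ne_zero_of_mul hφ')
      exact ⟨⟨t, (hne t).1 hφ'⟩, rfl⟩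
  · obtain ⟨t, rfl⟩ := hall φ hφ (left_ne_zero_of_mul hφ')
    have h := hprod t
    split_ifs at h
    · exact .inl (h.trans Int.cast_one)
    · exact .inl (h.trans Int.cast_one)
    · exact .inr (h.trans (by norm_num))
    · exact absurd (h.trans Int.cast_zero) hφ'
end
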